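/- Let f₀ : ℝ³×ℝ³ → [0,∞) be a C¹, compactly supported function. Then there exist a global classical solution f of the Vlasov–Poisson system with parameter β = 1 (repulsive forces) and initial datum f(0,·,·) = f₀, and a constant C > 0 depending on f₀, such that the momentum support function satisfies Q(t) ≤ C(1+t)^{2/3} for all t ≥ 0 (Rein's sharpest momentum support estimate in the plasma case). -/

import Mathlib

open MeasureTheory Real Bornology

noncomputable section

/-- Three-dimensional Euclidean space. -/
abbrev E3 := EuclideanSpace ℝ (Fin 3)

/-- The spatial density `ρ(t,x) = ∫ f(t,x,v) dv` induced by a distribution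
function `F` on `ℝ × ℝ³ × ℝ³`. -/
def vpDensity (F : ℝ × E3 × E3 → ℝ) (t : ℝ) (x : E3) : ℝ :=
  ∫ v : E3, F (t, x, v)

/-- The field `E(t,x) = (1/4π) ∫ ρ(t,y)(x−y)/|x−y|³ dy` (so `E = ∇φ`, `Δφ = ρ`). -/
def vpField (F : ℝ × E3 × E3 → ℝ) (t : ℝ) (x : E3) : E3 :=
  (4 * π)⁻¹ • ∫ y : E3, (vpDensity F t y / ‖x - y‖ ^ 3) • (x - y)

/-- `F` is a global classical solution of the (nonrelativistic) Vlasov–Poisson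
system with parameter `β`: it is a nonnegative `C¹` function, it satisfies
`∂_t f + v·∇_x f + β E·∇_v f = 0` pointwise for `t ≥ 0`, and for each `t` the
set `{(s,x,v) : 0 ≤ s ≤ t, f(s,x,v) ≠ 0}` is bounded. -/
structure IsGlobalVPSolution (β : ℝ) (F : ℝ × E3 × E3 → ℝ) : Prop where
  nonneg : ∀ z, 0 ≤ F z
  smooth : ContDiff ℝ 1 F
  pde : ∀ t x v, 0 ≤ t →
    fderiv ℝ F (t, x, v) (1, v, β • vpField F t x) = 0
  support_bounded : ∀ t, 0 ≤ t →
    IsBounded {z : ℝ × E3 × E3 | 0 ≤ z.1 ∧ z.1 ≤ t ∧ F z ≠ 0}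

/-- The momentum support function
`Q(t) = sup{|v| : ∃ s ∈ [0,t], x ∈ ℝ³, f(s,x,v) ≠ 0}`. -/
def vpQ (F : ℝ × E3 × E3 → ℝ) (t : ℝ) : ℝ :=
  sSup {r : ℝ | ∃ s x v, 0 ≤ s ∧ s ≤ t ∧ F (s, x, v) ≠ 0 ∧ r = ‖v‖}


open Set Filter Topology


section ODE
variable {E : Type*} [NormedAddCommGroup E] [NormedSpace ℝ E]

lemma vp_expint (c t0 t : ℝ) (hc : 0 < c) :
    |∫ s in t0..t, Real.exp (c * |s - t0|)| ≤ Real.exp (c * |t - t0|) / c := by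
  have key : ∀ r : ℝ, 0 ≤ r → ∫ s in (0:ℝ)..r, Real.exp (c * |s|) = (Real.exp (c * r) - 1) / c := by
    intro r hr
    have h1 : ∫ s in (0:ℝ)..r, Real.exp (c * |s|) = ∫ s in (0:ℝ)..r, Real.exp (c * s) := by
      apply intervalIntegral.integral_congr
      intro s hs
      rw [uIcc_of_le hr] at hs
      simp only [abs_of_nonneg hs.1]
    rw [h1, intervalIntegral.integral_comp_mul_left (fun x => Real.exp x) hc.ne']
    simp [div_eq_inv_mul]
  have key2 : |∫ s in (0:ℝ)..(t - t0), Real.exp (c * |s|)| ≤ Real.exp (c * |t - t0|) / c := by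
    rcases le_total 0 (t - t0) with h | h
    · rw [key _ h, abs_of_nonneg h, abs_of_nonneg]
      · gcongr; linarith
      · apply div_nonneg _ hc.le
        have := Real.one_le_exp (mul_nonneg hc.le h); linarith
    · have h2 : ∫ s in (0:ℝ)..(t - t0), Real.exp (c * |s|)
          = - ∫ s in (0:ℝ)..(-(t - t0)), Real.exp (c * |s|) := by
        have := intervalIntegral.integral_comp_neg (a := 0) (b := t - t0) (fun s => Real.exp (c * |s|))
        simp only [abs_neg, neg_zero] at this
        rw [this, intervalIntegral.integral_symm]
      have h' : 0 ≤ -(t - t0) := by linarith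
      rw [h2, key _ h', abs_neg, abs_of_nonpos h, abs_of_nonneg]
      · gcongr; linarith
      · apply div_nonneg _ hc.le
        have := Real.one_le_exp (mul_nonneg hc.le h'); linarith
  have := intervalIntegral.integral_comp_sub_right (a := t0) (b := t) (fun s => Real.exp (c * |s|)) t0
  simp only [sub_self] at this
  rw [this]; exact key2

lemma vp_cont_uncurry (b : ℝ → E → E) (K : ℝ) (hL : ∀ t x y, ‖b t x - b t y‖ ≤ K * ‖x - y‖)
    (hc : ∀ x, Continuous (fun t => b t x)) (y : ℝ → E) (hy : Continuous y) :
    Continuous (fun t => b t (y t)) := by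
  rw [continuous_iff_continuousAt]
  intro t
  rw [ContinuousAt, tendsto_iff_norm_sub_tendsto_zero]
  have h1 : Tendsto (fun s => K * ‖y s - y t‖ + ‖b s (y t) - b t (y t)‖) (𝓝 t) (𝓝 (K * 0 + 0)) := by
    refine Tendsto.add (Tendsto.const_mul _ ?_) ?_
    · exact tendsto_iff_norm_sub_tendsto_zero.mp (hy.tendsto t)
    · exact tendsto_iff_norm_sub_tendsto_zero.mp ((hc (y t)).tendsto t)
  rw [mul_zero, add_zero] at h1
  refine squeeze_zero (fun _ => norm_nonneg _) (fun s => ?_) h1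
  calc ‖b s (y s) - b t (y t)‖ = ‖(b s (y s) - b s (y t)) + (b s (y t) - b t (y t))‖ := by abel_nf
    _ ≤ _ := (norm_add_le _ _).trans (by gcongr; exact hL _ _ _)

/-- Global existence for uniformly Lipschitz fields. -/
lemma vp_ode_unif [CompleteSpace E] (b : ℝ → E → E) (K C : ℝ) (hK : 0 < K)
    (hL : ∀ t x y, ‖b t x - b t y‖ ≤ K * ‖x - y‖)
    (hc : ∀ x, Continuous (fun t => b t x)) (t0 : ℝ) (x0 : E) (hC : ∀ t, ‖b t x0‖ ≤ C) :
    ∃ u : ℝ → E, u t0 = x0 ∧ ∀ t, HasDerivAt u (b t (u t)) t := by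
  have hC0 : 0 ≤ C := (norm_nonneg _).trans (hC 0)
  set w : ℝ → ℝ := fun t => Real.exp (2 * K * |t - t0|) with hw
  have hwpos : ∀ t, 0 < w t := fun t => Real.exp_pos _
  have hw1 : ∀ t, 1 ≤ w t := fun t => Real.one_le_exp (by positivity)
  have hwc : Continuous w := by fun_prop
  have hcont : ∀ y : BoundedContinuousFunction ℝ E, Continuous (fun s => b s (x0 + w s • y s)) := by
    intro y
    exact vp_cont_uncurry b K hL hc _ (by fun_prop)
  -- general integral estimate
  have hest : ∀ (g : ℝ → E) (A : ℝ), (∀ s, ‖g s‖ ≤ A * w s) → ∀ t, ‖∫ s in t0..t, g s‖ ≤ A * (w t / (2 * K)) := by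
    intro g A hg t
    have hA : 0 ≤ A := by
      have := (norm_nonneg _).trans (hg 0)
      exact nonneg_of_mul_nonneg_left this (hwpos 0)
    have h1 := intervalIntegral.norm_integral_le_abs_of_norm_le (f := g) (g := fun s => A * w s) (a := t0) (b := t)
      (μ := volume) (Filter.Eventually.of_forall fun s => by simpa using hg s)
      ((continuous_const.mul hwc).intervalIntegrable _ _)
    refine h1.trans ?_
    rw [intervalIntegral.integral_const_mul, abs_mul, abs_of_nonneg hA]
    gcongr
    exact vp_expint (2 * K) t0 t (by positivity)
  have hbd : ∀ (y : BoundedContinuousFunction ℝ E) s, ‖b s (x0 + w s • y s)‖ ≤ (C + K * ‖y‖) * w s := by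
    intro y s
    have h1 : ‖b s (x0 + w s • y s) - b s x0‖ ≤ K * (w s * ‖y‖) := by
      refine (hL _ _ _).trans ?_
      gcongr
      rw [add_sub_cancel_left, norm_smul, Real.norm_of_nonneg (hwpos s).le]
      gcongr
      exact y.norm_coe_le_norm s
    have h2 : ‖b s (x0 + w s • y s)‖ ≤ ‖b s (x0 + w s • y s) - b s x0‖ + ‖b s x0‖ := by
      simpa using norm_add_le (b s (x0 + w s • y s) - b s x0) (b s x0)
    have := hC s
    nlinarith [hw1 s]
  let N : BoundedContinuousFunction ℝ E → BoundedContinuousFunction ℝ E := fun y =>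
    BoundedContinuousFunction.ofNormedAddCommGroup
      (fun t => (w t)⁻¹ • ∫ s in t0..t, b s (x0 + w s • y s))
      (by
        have : Continuous fun t => ∫ s in t0..t, b s (x0 + w s • y s) :=
          intervalIntegral.continuous_primitive (fun a c => (hcont y).intervalIntegrable a c) t0
        exact (hwc.inv₀ (fun t => (hwpos t).ne')).smul this)
      ((C + K * ‖y‖) / (2 * K))
      (by
        intro t
        rw [norm_smul, norm_inv, Real.norm_of_nonneg (hwpos t).le]
        have := hest _ _ (hbd y) t
        rw [inv_mul_le_iff₀ (hwpos t)]
        refine this.trans (le_of_eq ?_); ring)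
  have hN : ∀ y t, N y t = (w t)⁻¹ • ∫ s in t0..t, b s (x0 + w s • y s) := fun y t => rfl
  have hcontr : ContractingWith (1/2 : NNReal) N := by
    refine ⟨by rw [← NNReal.coe_lt_coe]; norm_num, ?_⟩
    refine LipschitzWith.of_dist_le_mul fun y z => ?_
    rw [BoundedContinuousFunction.dist_le (by positivity)]
    intro t
    rw [dist_eq_norm, hN, hN, ← smul_sub, ← intervalIntegral.integral_sub
      ((hcont y).intervalIntegrable _ _) ((hcont z).intervalIntegrable _ _), norm_smul, norm_inv,
      Real.norm_of_nonneg (hwpos t).le, inv_mul_le_iff₀ (hwpos t)]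
    have := hest (fun s => b s (x0 + w s • y s) - b s (x0 + w s • z s)) (K * dist y z) (fun s => by
      refine (hL _ _ _).trans ?_
      rw [add_sub_add_left_eq_sub, ← smul_sub, norm_smul, Real.norm_of_nonneg (hwpos s).le, mul_assoc]
      rw [mul_comm (w s)]
      gcongr
      rw [← dist_eq_norm]
      exact BoundedContinuousFunction.dist_coe_le_dist s) t
    refine this.trans (le_of_eq ?_)
    simp only [NNReal.coe_div, NNReal.coe_one, NNReal.coe_ofNat]
    field_simp
  obtain ⟨y, hy⟩ : ∃ y, N y = y := ⟨_, hcontr.fixedPoint_isFixedPt⟩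
  have hy2 : ∀ t, w t • y t = ∫ s in t0..t, b s (x0 + w s • y s) := by
    intro t
    conv_lhs => rw [← hy, hN]
    rw [smul_smul, mul_inv_cancel₀ (hwpos t).ne', one_smul]
  refine ⟨fun t => x0 + w t • y t, ?_, ?_⟩
  · show x0 + w t0 • y t0 = x0
    rw [hy2 t0, intervalIntegral.integral_same, add_zero]
  · intro t
    have h1 := intervalIntegral.integral_hasDerivAt_right ((hcont y).intervalIntegrable t0 t)
      ((hcont y).stronglyMeasurableAtFilter _ _) (hcont y).continuousAt
    have h2 := h1.const_add x0
    refine h2.congr_of_eventuallyEq (Filter.Eventually.of_forall fun s => ?_)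
    show x0 + w s • y s = _
    rw [hy2 s]

/-- Uniqueness. -/
lemma vp_ode_unique (b : ℝ → E → E)
    (hL : ∀ T : ℝ, ∃ K : ℝ, ∀ t, |t| ≤ T → ∀ x y, ‖b t x - b t y‖ ≤ K * ‖x - y‖)
    (A : ℝ) (u v : ℝ → E) (t0 : ℝ) (ht0 : |t0| < A) (h0 : u t0 = v t0)
    (hu : ∀ t, |t| < A → HasDerivAt u (b t (u t)) t) (hv : ∀ t, |t| < A → HasDerivAt v (b t (v t)) t) :
    ∀ t, |t| < A → u t = v t := by
  intro t ht
  obtain ⟨K, hK⟩ := hL A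
  refine ODE_solution_unique_of_mem_Ioo (v := b) (s := fun _ => univ) (a := -A) (b := A) (K := K.toNNReal)
    (t₀ := t0) ?_ (by rwa [mem_Ioo, ← abs_lt]) ?_ ?_ h0 (by rwa [mem_Ioo, ← abs_lt])
  · intro s hs
    rw [mem_Ioo, ← abs_lt] at hs
    refine LipschitzOnWith.of_dist_le_mul fun x _ y _ => ?_
    rw [dist_eq_norm, dist_eq_norm]
    refine (hK s hs.le x y).trans ?_
    gcongr
    exact Real.le_coe_toNNReal K
  · intro s hs
    rw [mem_Ioo, ← abs_lt] at hs
    exact ⟨hu s hs, mem_univ _⟩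
  · intro s hs
    rw [mem_Ioo, ← abs_lt] at hs
    exact ⟨hv s hs, mem_univ _⟩

/-- Global existence. -/
lemma vp_ode_exists [CompleteSpace E] (b : ℝ → E → E)
    (hL : ∀ T : ℝ, ∃ K : ℝ, ∀ t, |t| ≤ T → ∀ x y, ‖b t x - b t y‖ ≤ K * ‖x - y‖)
    (hc : ∀ x, Continuous (fun t => b t x)) (t0 : ℝ) (x0 : E) :
    ∃ u : ℝ → E, u t0 = x0 ∧ ∀ t, HasDerivAt u (b t (u t)) t := by
  have step : ∀ T : ℝ, ∃ u : ℝ → E, u t0 = x0 ∧ ∀ t, |t| < T → HasDerivAt u (b t (u t)) t := by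
    intro T
    rcases le_or_gt T 0 with hT | hT
    · exact ⟨fun _ => x0, rfl, fun t ht => absurd (ht.trans_le hT) (not_lt.mpr (abs_nonneg t))⟩
    obtain ⟨K, hK⟩ := hL T
    set pr : ℝ → ℝ := fun t => max (-T) (min t T) with hpr
    have hpc : Continuous pr := by fun_prop
    have hpT : ∀ t, |pr t| ≤ T := by
      intro t; rw [abs_le]; refine ⟨le_max_left _ _, max_le (by linarith) (min_le_right _ _)⟩
    have hpe : ∀ t, |t| < T → pr t = t := by
      intro t ht; rw [abs_lt] at ht
      simp only [hpr]; rw [min_eq_left ht.2.le, max_eq_right ht.1.le]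
    obtain ⟨C, hC⟩ := (isCompact_Icc (a := -T) (b := T)).exists_bound_of_continuousOn (hc x0).continuousOn
    obtain ⟨u, hu0, hu⟩ := vp_ode_unif (fun t x => b (pr t) x) (|K| + 1) C (by positivity)
      (fun t x y => (hK _ (hpT t) x y).trans (by gcongr; exact (le_abs_self K).trans (by linarith)))
      (fun x => (hc x).comp hpc) t0 x0 (fun t => hC _ (by rw [mem_Icc, ← abs_le]; exact hpT t))
    refine ⟨u, hu0, fun t ht => ?_⟩
    have := hu t
    simp only [hpe t ht] at this
    exact this
  choose U hU0 hU using step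
  have hcoh : ∀ T T' t, |t0| < T → |t| < T → T ≤ T' → U T t = U T' t := by
    intro T T' t h0 ht hTT
    exact vp_ode_unique b hL T (U T) (U T') t0 h0 (by rw [hU0, hU0]) (hU T)
      (fun s hs => hU T' s (hs.trans_le hTT)) t ht
  refine ⟨fun t => U (|t| + |t0| + 1) t, hU0 _, fun t => ?_⟩
  have h1 := hU (|t| + |t0| + 2) t (by linarith [abs_nonneg t0])
  have h2 : (fun s => U (|s| + |t0| + 1) s) =ᶠ[𝓝 t] U (|t| + |t0| + 2) := by
    have : ∀ᶠ s in 𝓝 t, |s| < |t| + 1 := (continuous_abs.tendsto t).eventually_lt_const (by linarith)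
    filter_upwards [this] with s hs
    exact hcoh _ _ _ (by linarith [abs_nonneg s]) (by linarith [abs_nonneg t0]) (by linarith)
  have h3 : U (|t| + |t0| + 1) t = U (|t| + |t0| + 2) t := h2.eq_of_nhds
  show HasDerivAt _ (b t (U (|t| + |t0| + 1) t)) t
  rw [h3]
  exact h1.congr_of_eventuallyEq h2

/-- Two-sided Gronwall. -/
lemma vp_gron (d d' : ℝ → E) (K ε t0 t : ℝ) (hd : ∀ s ∈ uIcc t0 t, HasDerivAt d (d' s) s)
    (hb : ∀ s ∈ uIcc t0 t, ‖d' s‖ ≤ K * ‖d s‖ + ε) :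
    ‖d t‖ ≤ gronwallBound ‖d t0‖ K ε |t - t0| := by
  rcases le_total t0 t with h | h
  · rw [abs_of_nonneg (sub_nonneg.mpr h)]
    rw [uIcc_of_le h] at hb hd
    exact norm_le_gronwallBound_of_norm_deriv_right_le (f := d) (f' := d')
      (HasDerivAt.continuousOn fun s hs => hd s hs) (fun s hs => (hd s ⟨hs.1, hs.2.le⟩).hasDerivWithinAt) le_rfl
      (fun s hs => hb s ⟨hs.1, hs.2.le⟩) t ⟨h, le_rfl⟩
  · rw [abs_of_nonpos (sub_nonpos.mpr h)]
    rw [uIcc_of_ge h] at hb hd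
    have hd2 : ∀ s ∈ Icc (-t0) (-t), HasDerivAt (fun s => d (-s)) (-d' (-s)) s := by
      intro s hs
      have := (hd (-s) ⟨by linarith [hs.2], by linarith [hs.1]⟩).scomp s (hasDerivAt_neg s)
      simpa [Function.comp_def] using this
    have := norm_le_gronwallBound_of_norm_deriv_right_le (f := fun s => d (-s)) (f' := fun s => -d' (-s))
      (a := -t0) (b := -t) (δ := ‖d t0‖) (K := K) (ε := ε)
      (HasDerivAt.continuousOn fun s hs => hd2 s hs) (fun s hs => (hd2 s ⟨hs.1, hs.2.le⟩).hasDerivWithinAt) (by simp)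
      (fun s hs => by
        rw [norm_neg]; exact hb (-s) ⟨by linarith [hs.2], by linarith [hs.1]⟩) (-t) ⟨by linarith, le_rfl⟩
    simp only [neg_neg] at this
    convert this using 2
    ring

end ODE


section Flow
variable {E : Type*} [NormedAddCommGroup E] [NormedSpace ℝ E]

/-- Fields that are continuous in time and Lipschitz in space, locally uniformly in time. -/
structure VPOk (b : ℝ → E → E) : Prop where
  lip : ∀ T : ℝ, ∃ K : ℝ, ∀ t, |t| ≤ T → ∀ x y, ‖b t x - b t y‖ ≤ K * ‖x - y‖
  cont : ∀ x, Continuous (fun t => b t x)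

lemma VPOk.lip' {b : ℝ → E → E} (hb : VPOk b) (T : ℝ) :
    ∃ K : ℝ, 0 ≤ K ∧ ∀ t, |t| ≤ T → ∀ x y, ‖b t x - b t y‖ ≤ K * ‖x - y‖ := by
  obtain ⟨K, hK⟩ := hb.lip T
  exact ⟨|K|, abs_nonneg _, fun t ht x y => (hK t ht x y).trans (by gcongr; exact le_abs_self K)⟩

/-- The solution of `u' = b(t,u)` through `(t0,x0)`. -/
def vpSol (b : ℝ → E → E) (t0 : ℝ) (x0 : E) : ℝ → E :=
  Classical.epsilon (fun u : ℝ → E => u t0 = x0 ∧ ∀ t, HasDerivAt u (b t (u t)) t)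

variable {b : ℝ → E → E}

lemma vpSol_spec [CompleteSpace E] (hb : VPOk b) (t0 : ℝ) (x0 : E) :
    vpSol b t0 x0 t0 = x0 ∧ ∀ t, HasDerivAt (vpSol b t0 x0) (b t (vpSol b t0 x0 t)) t :=
  Classical.epsilon_spec (p := fun u : ℝ → E => u t0 = x0 ∧ ∀ t, HasDerivAt u (b t (u t)) t)
    (vp_ode_exists b hb.lip hb.cont t0 x0)

lemma vpSol_self [CompleteSpace E] (hb : VPOk b) (t0 : ℝ) (x0 : E) : vpSol b t0 x0 t0 = x0 :=
  (vpSol_spec hb t0 x0).1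

lemma vpSol_deriv [CompleteSpace E] (hb : VPOk b) (t0 : ℝ) (x0 : E) (t : ℝ) :
    HasDerivAt (vpSol b t0 x0) (b t (vpSol b t0 x0 t)) t :=
  (vpSol_spec hb t0 x0).2 t

lemma vpSol_unique [CompleteSpace E] (hb : VPOk b) (u : ℝ → E) (t0 : ℝ)
    (hu : ∀ t, HasDerivAt u (b t (u t)) t) (t : ℝ) : vpSol b t0 (u t0) t = u t := by
  have hA : |t0| < |t0| + |t| + 1 := by linarith [abs_nonneg t]
  exact vp_ode_unique b hb.lip (|t0| + |t| + 1) _ u t0 hA (vpSol_self hb _ _)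
    (fun s _ => vpSol_deriv hb _ _ s) (fun s _ => hu s) t (by linarith [abs_nonneg t0])

lemma vpSol_comp [CompleteSpace E] (hb : VPOk b) (t0 t1 t2 : ℝ) (x : E) :
    vpSol b t1 (vpSol b t0 x t1) t2 = vpSol b t0 x t2 :=
  vpSol_unique hb (vpSol b t0 x) t1 (fun t => vpSol_deriv hb t0 x t) t2

lemma vp_gron0 (d d' : ℝ → E) (K t0 t : ℝ) (hd : ∀ s ∈ uIcc t0 t, HasDerivAt d (d' s) s)
    (hb : ∀ s ∈ uIcc t0 t, ‖d' s‖ ≤ K * ‖d s‖) :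
    ‖d t‖ ≤ ‖d t0‖ * Real.exp (K * |t - t0|) := by
  have := vp_gron d d' K 0 t0 t hd (fun s hs => by simpa using hb s hs)
  rwa [gronwallBound_ε0] at this

lemma vp_gron1 (d d' : ℝ → E) (K ε t0 t T : ℝ) (hK : 0 ≤ K) (hε : 0 ≤ ε) (hd : ∀ s ∈ uIcc t0 t, HasDerivAt d (d' s) s)
    (hT : |t - t0| ≤ T) (h0 : d t0 = 0)
    (hb : ∀ s ∈ uIcc t0 t, ‖d' s‖ ≤ K * ‖d s‖ + ε) :
    ‖d t‖ ≤ ε * gronwallBound 0 K 1 T := by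
  have := vp_gron d d' K ε t0 t hd hb
  rw [h0, norm_zero] at this
  have h2 : ∀ x, gronwallBound 0 K ε x = ε * gronwallBound 0 K 1 x := by
    intro x
    unfold gronwallBound
    split_ifs
    · ring
    · ring
  rw [h2] at this
  refine this.trans ?_
  gcongr
  exact gronwallBound_mono le_rfl zero_le_one hK hT

lemma vp_uIcc_abs {t0 t s T : ℝ} (h0 : |t0| ≤ T) (h : |t| ≤ T) (hs : s ∈ uIcc t0 t) : |s| ≤ T := by
  rw [abs_le] at *
  rw [mem_uIcc] at hs
  rcases hs with hs | hs <;> constructor <;> linarith [hs.1, hs.2, h0.1, h0.2]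

lemma vpSol_lip [CompleteSpace E] (hb : VPOk b) (K T : ℝ)
    (hK : ∀ t, |t| ≤ T → ∀ x y, ‖b t x - b t y‖ ≤ K * ‖x - y‖) (t0 t : ℝ) (h0 : |t0| ≤ T) (h : |t| ≤ T) (x y : E) :
    ‖vpSol b t0 x t - vpSol b t0 y t‖ ≤ Real.exp (K * |t - t0|) * ‖x - y‖ := by
  have := vp_gron0 (fun s => vpSol b t0 x s - vpSol b t0 y s) _ K t0 t
    (fun s _ => (vpSol_deriv hb t0 x s).sub (vpSol_deriv hb t0 y s))
    (fun s hs => hK s (vp_uIcc_abs h0 h hs) _ _)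
  rw [vpSol_self hb, vpSol_self hb, mul_comm] at this
  exact this

lemma vpSol_lip2 [CompleteSpace E] (hb : VPOk b) (T : ℝ) : ∃ L : ℝ, 0 ≤ L ∧ ∀ t0 t : ℝ, |t0| ≤ T → |t| ≤ T →
    ∀ x y : E, ‖vpSol b t0 x t - vpSol b t0 y t‖ ≤ L * ‖x - y‖ := by
  obtain ⟨K, hK0, hK⟩ := hb.lip' T
  refine ⟨Real.exp (K * (2 * T)), (Real.exp_pos _).le, fun t0 t h0 h x y => ?_⟩
  refine (vpSol_lip hb K T hK t0 t h0 h x y).trans ?_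
  gcongr
  refine (abs_sub _ _).trans (by linarith)

lemma vpSol_continuous_t [CompleteSpace E] (hb : VPOk b) (t0 : ℝ) (x : E) : Continuous (vpSol b t0 x) :=
  continuous_iff_continuousAt.mpr fun t => (vpSol_deriv hb t0 x t).continuousAt

/-- general squeeze -/
lemma vp_cont_of_bound {X Y : Type*} [TopologicalSpace X] [NormedAddCommGroup Y] (g : X → Y) (x : X)
    (B : X → ℝ) (hB : Tendsto B (𝓝 x) (𝓝 0)) (h : ∀ᶠ y in 𝓝 x, ‖g y - g x‖ ≤ B y) : ContinuousAt g x := by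
  rw [ContinuousAt, tendsto_iff_norm_sub_tendsto_zero]
  exact squeeze_zero' (Filter.Eventually.of_forall fun _ => norm_nonneg _) h hB

lemma vpFlow_cont [CompleteSpace E] (hb : VPOk b) : Continuous (fun q : ℝ × E => vpSol b 0 q.2 q.1) := by
  rw [continuous_iff_continuousAt]
  rintro ⟨t1, y1⟩
  obtain ⟨L, hL0, hL⟩ := vpSol_lip2 hb (|t1| + 1)
  have hev : ∀ᶠ q : ℝ × E in 𝓝 (t1, y1), |q.1| ≤ |t1| + 1 := by
    have : Tendsto (fun q : ℝ × E => |q.1|) (𝓝 (t1, y1)) (𝓝 |t1|) :=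
      (continuous_abs.comp continuous_fst).tendsto _
    exact (this.eventually_lt_const (by linarith)).mono fun _ h => h.le
  refine vp_cont_of_bound _ _ (fun q => L * ‖q.2 - y1‖ + ‖vpSol b 0 y1 q.1 - vpSol b 0 y1 t1‖) ?_ ?_
  · have : Continuous (fun q : ℝ × E => L * ‖q.2 - y1‖ + ‖vpSol b 0 y1 q.1 - vpSol b 0 y1 t1‖) := by
      have := vpSol_continuous_t hb 0 y1
      fun_prop
    have := this.tendsto (t1, y1)
    simpa using this
  · filter_upwards [hev] with q hq
    have h1 := hL 0 q.1 (by simp; positivity) hq q.2 y1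
    calc ‖vpSol b 0 q.2 q.1 - vpSol b 0 y1 t1‖ = ‖(vpSol b 0 q.2 q.1 - vpSol b 0 y1 q.1)
          + (vpSol b 0 y1 q.1 - vpSol b 0 y1 t1)‖ := by abel_nf
      _ ≤ _ := (norm_add_le _ _).trans (by gcongr)

lemma vpInv_cont [CompleteSpace E] (hb : VPOk b) : Continuous (fun q : ℝ × E => vpSol b q.1 q.2 0) := by
  rw [continuous_iff_continuousAt]
  rintro ⟨t1, x1⟩
  obtain ⟨L, hL0, hL⟩ := vpSol_lip2 hb (|t1| + 1)
  have hev : ∀ᶠ q : ℝ × E in 𝓝 (t1, x1), |q.1| ≤ |t1| + 1 := by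
    have : Tendsto (fun q : ℝ × E => |q.1|) (𝓝 (t1, x1)) (𝓝 |t1|) :=
      (continuous_abs.comp continuous_fst).tendsto _
    exact (this.eventually_lt_const (by linarith)).mono fun _ h => h.le
  refine vp_cont_of_bound _ _ (fun q => L * ‖q.2 - vpSol b t1 x1 q.1‖) ?_ ?_
  · have : Continuous (fun q : ℝ × E => L * ‖q.2 - vpSol b t1 x1 q.1‖) := by
      have := vpSol_continuous_t hb t1 x1
      fun_prop
    have := this.tendsto (t1, x1)
    simpa [vpSol_self hb] using this
  · filter_upwards [hev] with q hq
    have h1 := hL q.1 0 hq (by simp; positivity) q.2 (vpSol b t1 x1 q.1)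
    rwa [vpSol_comp hb] at h1

/-- The homeomorphism `(t,y) ↦ (t, Φ_t y)`. -/
def vpHomeo [CompleteSpace E] (hb : VPOk b) : (ℝ × E) ≃ₜ (ℝ × E) where
  toFun q := (q.1, vpSol b 0 q.2 q.1)
  invFun q := (q.1, vpSol b q.1 q.2 0)
  left_inv q := by simp [vpSol_comp hb, vpSol_self hb]
  right_inv q := by simp [vpSol_comp hb, vpSol_self hb]
  continuous_toFun := continuous_fst.prodMk (vpFlow_cont hb)
  continuous_invFun := continuous_fst.prodMk (vpInv_cont hb)

/-- C¹ fields. -/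
structure VPOk1 (b : ℝ → E → E) (db : ℝ → E → E →L[ℝ] E) : Prop where
  ok : VPOk b
  bc : Continuous (fun q : ℝ × E => b q.1 q.2)
  der : ∀ t x, HasFDerivAt (b t) (db t x) x
  dc : Continuous (fun q : ℝ × E => db q.1 q.2)

variable {db : ℝ → E → E →L[ℝ] E}

lemma VPOk1.dbd (h : VPOk1 b db) (T : ℝ) : ∃ K : ℝ, 0 ≤ K ∧ (∀ t, |t| ≤ T → ∀ x, ‖db t x‖ ≤ K) ∧
    ∀ t, |t| ≤ T → ∀ x y, ‖b t x - b t y‖ ≤ K * ‖x - y‖ := by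
  obtain ⟨K, hK0, hK⟩ := h.ok.lip' T
  refine ⟨K, hK0, fun t ht x => ?_, hK⟩
  have : LipschitzWith K.toNNReal (b t) := by
    refine LipschitzWith.of_dist_le_mul fun x y => ?_
    rw [dist_eq_norm, dist_eq_norm, Real.coe_toNNReal _ hK0]
    exact hK t ht x y
  have := (h.der t x).le_of_lipschitz this
  rwa [Real.coe_toNNReal _ hK0] at this

/-- linearised field along a trajectory -/
def vpLin (b : ℝ → E → E) (db : ℝ → E → E →L[ℝ] E) (y : E) (t : ℝ) (N : E →L[ℝ] E) : E →L[ℝ] E :=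
  (db t (vpSol b 0 y t)).comp N

variable [CompleteSpace E]

lemma VPOk1.Acont (h : VPOk1 b db) : Continuous (fun q : ℝ × E => db q.1 (vpSol b 0 q.2 q.1)) :=
  h.dc.comp (continuous_fst.prodMk (vpFlow_cont h.ok))

lemma vpLin_ok (h : VPOk1 b db) (y : E) : VPOk (vpLin b db y) where
  lip T := by
    obtain ⟨K, hK0, hK, _⟩ := h.dbd T
    refine ⟨K, fun t ht M N => ?_⟩
    have : vpLin b db y t M - vpLin b db y t N = (db t (vpSol b 0 y t)).comp (M - N) := by
      ext; simp [vpLin]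
    rw [this]
    exact (ContinuousLinearMap.opNorm_comp_le _ _).trans (by gcongr; exact hK t ht _)
  cont N := by
    have h1 : Continuous (fun t => db t (vpSol b 0 y t)) :=
      h.Acont.comp (continuous_id.prodMk continuous_const)
    exact h1.clm_comp continuous_const

/-- The derivative of the flow. -/
def vpN (b : ℝ → E → E) (db : ℝ → E → E →L[ℝ] E) (t : ℝ) (y : E) : E →L[ℝ] E :=
  vpSol (vpLin b db y) 0 (ContinuousLinearMap.id ℝ E) t

lemma vpN_deriv (h : VPOk1 b db) (y : E) (t : ℝ) :
    HasDerivAt (fun s => vpN b db s y) ((db t (vpSol b 0 y t)).comp (vpN b db t y)) t :=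
  vpSol_deriv (vpLin_ok h y) 0 _ t

lemma vpN_zero (h : VPOk1 b db) (y : E) : vpN b db 0 y = ContinuousLinearMap.id ℝ E :=
  vpSol_self (vpLin_ok h y) 0 _

lemma vpN_bd (h : VPOk1 b db) (T : ℝ) : ∃ M : ℝ, 0 ≤ M ∧ ∀ t, |t| ≤ T → ∀ y, ‖vpN b db t y‖ ≤ M := by
  obtain ⟨K, hK0, hK, _⟩ := h.dbd T
  refine ⟨1 * Real.exp (K * T), by positivity, fun t ht y => ?_⟩
  have hT : 0 ≤ T := (abs_nonneg t).trans ht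
  have := vp_gron0 (fun s => vpN b db s y) _ K 0 t (fun s _ => vpN_deriv h y s) (fun s hs =>
    (ContinuousLinearMap.opNorm_comp_le _ _).trans (by gcongr; exact hK s (vp_uIcc_abs (by simpa) ht hs) _))
  rw [vpN_zero h] at this
  refine this.trans ?_
  gcongr
  · exact ContinuousLinearMap.norm_id_le
  · simpa using ht

lemma vpN_cont (h : VPOk1 b db) : Continuous (fun q : ℝ × E => vpN b db q.1 q.2) := by
  rw [continuous_iff_continuousAt]
  rintro ⟨t1, y1⟩
  set T := |t1| + 1 with hT
  have hT0 : 0 ≤ T := by positivity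
  obtain ⟨K, hK0, hK, _⟩ := h.dbd T
  obtain ⟨M, hM0, hM⟩ := vpN_bd h T
  set γ := gronwallBound 0 K 1 T with hγ
  have hγ0 : 0 ≤ γ := by
    have := gronwallBound_mono (δ := 0) (ε := 1) le_rfl zero_le_one hK0 hT0
    rw [gronwallBound_x0] at this; exact this
  rw [Metric.continuousAt_iff']
  intro ε hε
  set η := ε / 2 / (M * γ + 1) with hη
  have hη0 : 0 < η := by positivity
  have tube : ∀ᶠ y in 𝓝 y1, ∀ s ∈ Icc (-T) T, ‖db s (vpSol b 0 y s) - db s (vpSol b 0 y1 s)‖ ≤ η := by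
    refine isCompact_Icc.eventually_forall_of_forall_eventually (x₀ := y1)
      (P := fun y s => ‖db s (vpSol b 0 y s) - db s (vpSol b 0 y1 s)‖ ≤ η) fun s _ => ?_
    have hc : Continuous (fun z : E × ℝ => ‖db z.2 (vpSol b 0 z.1 z.2) - db z.2 (vpSol b 0 y1 z.2)‖) := by
      have h1 := h.Acont.comp (continuous_snd.prodMk continuous_fst : Continuous fun z : E × ℝ => (z.2, z.1))
      have h2 := h.Acont.comp (continuous_snd.prodMk continuous_const : Continuous fun z : E × ℝ => (z.2, y1))
      exact (h1.sub h2).norm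
    have := hc.tendsto (y1, s)
    simp only [sub_self, norm_zero] at this
    exact (this.eventually_lt_const hη0).mono fun _ h => h.le
  have hev : ∀ᶠ q : ℝ × E in 𝓝 (t1, y1), |q.1| ≤ T := by
    have : Tendsto (fun q : ℝ × E => |q.1|) (𝓝 (t1, y1)) (𝓝 |t1|) :=
      (continuous_abs.comp continuous_fst).tendsto _
    exact (this.eventually_lt_const (by linarith)).mono fun _ h => h.le
  have hct : ∀ᶠ q : ℝ × E in 𝓝 (t1, y1), ‖vpN b db q.1 y1 - vpN b db t1 y1‖ < ε / 2 := by
    have : ContinuousAt (fun s => vpN b db s y1) t1 := (vpN_deriv h y1 t1).continuousAt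
    have h2 : Tendsto (fun q : ℝ × E => ‖vpN b db q.1 y1 - vpN b db t1 y1‖) (𝓝 (t1, y1)) (𝓝 0) := by
      have := ((this.tendsto.comp (continuous_fst.tendsto (t1, y1))).sub_const (vpN b db t1 y1)).norm
      simpa using this
    exact h2.eventually_lt_const (by positivity)
  have tube' := (continuous_snd.tendsto ((t1, y1) : ℝ × E)).eventually tube
  filter_upwards [tube', hev, hct] with q hq1 hq2 hq3
  have key : ‖vpN b db q.1 q.2 - vpN b db q.1 y1‖ ≤ (η * M) * γ := by
    refine vp_gron1 (fun s => vpN b db s q.2 - vpN b db s y1) _ K (η * M) 0 q.1 T hK0 (by positivity)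
      (fun s _ => (vpN_deriv h q.2 s).sub (vpN_deriv h y1 s)) (by simpa using hq2) (by simp [vpN_zero h]) ?_
    intro s hs
    have hsT := vp_uIcc_abs (by simpa using hT0) hq2 hs
    have e : (db s (vpSol b 0 q.2 s)).comp (vpN b db s q.2) - (db s (vpSol b 0 y1 s)).comp (vpN b db s y1)
        = (db s (vpSol b 0 q.2 s)).comp (vpN b db s q.2 - vpN b db s y1)
          + (db s (vpSol b 0 q.2 s) - db s (vpSol b 0 y1 s)).comp (vpN b db s y1) := by
      ext; simp
    rw [e]
    refine (norm_add_le _ _).trans (add_le_add ?_ ?_)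
    · exact (ContinuousLinearMap.opNorm_comp_le _ _).trans (by gcongr; exact hK s hsT _)
    · refine (ContinuousLinearMap.opNorm_comp_le _ _).trans ?_
      gcongr
      · exact hq1 s (abs_le.mp hsT)
      · exact hM s hsT _
  have : (η * M) * γ ≤ ε / 2 := by
    rw [hη]
    have : ε / 2 / (M * γ + 1) * M * γ = ε / 2 * ((M * γ) / (M * γ + 1)) := by ring
    rw [this]
    have : (M * γ) / (M * γ + 1) ≤ 1 := by
      rw [div_le_one (by positivity)]; linarith
    nlinarith
  rw [dist_eq_norm]
  calc ‖vpN b db q.1 q.2 - vpN b db t1 y1‖ = ‖(vpN b db q.1 q.2 - vpN b db q.1 y1)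
          + (vpN b db q.1 y1 - vpN b db t1 y1)‖ := by abel_nf
    _ ≤ _ := norm_add_le _ _
    _ < ε := by linarith

lemma vpFlow_fderiv (h : VPOk1 b db) (t : ℝ) (y : E) :
    HasFDerivAt (fun y => vpSol b 0 y t) (vpN b db t y) y := by
  set T := |t| with hT
  have hT0 : 0 ≤ T := by positivity
  obtain ⟨K, hK0, hK, _⟩ := h.dbd T
  obtain ⟨L, hL0, hL⟩ := vpSol_lip2 h.ok T
  set γ := gronwallBound 0 K 1 T with hγ
  have hγ0 : 0 ≤ γ := by
    have := gronwallBound_mono (δ := 0) (ε := 1) le_rfl zero_le_one hK0 hT0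
    rw [gronwallBound_x0] at this; exact this
  rw [hasFDerivAt_iff_isLittleO_nhds_zero, Asymptotics.isLittleO_iff]
  intro ε hε
  set η := ε / (L * γ + 1) with hη
  have hη0 : 0 < η := by positivity
  have tube : ∀ᶠ w in 𝓝 (0 : E), ∀ s ∈ Icc (-T) T,
      ‖db s (vpSol b 0 y s + w) - db s (vpSol b 0 y s)‖ ≤ η := by
    refine isCompact_Icc.eventually_forall_of_forall_eventually (x₀ := (0:E))
      (P := fun w s => ‖db s (vpSol b 0 y s + w) - db s (vpSol b 0 y s)‖ ≤ η) fun s _ => ?_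
    have hc : Continuous (fun z : E × ℝ => ‖db z.2 (vpSol b 0 y z.2 + z.1) - db z.2 (vpSol b 0 y z.2)‖) := by
      have h0 := vpSol_continuous_t h.ok 0 y
      have h1 := h.dc.comp ((by fun_prop) : Continuous fun z : E × ℝ => (z.2, vpSol b 0 y z.2 + z.1))
      have h2 := h.dc.comp ((by fun_prop) : Continuous fun z : E × ℝ => (z.2, vpSol b 0 y z.2))
      exact (h1.sub h2).norm
    have := hc.tendsto (0, s)
    simp only [sub_self, norm_zero, add_zero] at this
    exact (this.eventually_lt_const hη0).mono fun _ h => h.le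
  obtain ⟨δ, hδ0, hδ⟩ := Metric.eventually_nhds_iff_ball.mp tube
  have hk : ∀ᶠ k : E in 𝓝 0, L * ‖k‖ < δ := by
    have : Tendsto (fun k : E => L * ‖k‖) (𝓝 0) (𝓝 (L * ‖(0:E)‖)) := (by fun_prop : Continuous fun k : E => L * ‖k‖).tendsto 0
    exact this.eventually_lt_const (by simpa)
  filter_upwards [hk] with k hk
  have hdiff : ∀ s, |s| ≤ T → ‖vpSol b 0 (y + k) s - vpSol b 0 y s‖ ≤ L * ‖k‖ := by
    intro s hs
    have := hL 0 s (by simpa using hT0) hs (y + k) y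
    simpa using this
  have key : ‖vpSol b 0 (y + k) t - vpSol b 0 y t - vpN b db t y k‖ ≤ (η * (L * ‖k‖)) * γ := by
    refine vp_gron1 (fun s => vpSol b 0 (y + k) s - vpSol b 0 y s - vpN b db s y k) 
      (fun s => b s (vpSol b 0 (y + k) s) - b s (vpSol b 0 y s) - (db s (vpSol b 0 y s)) (vpN b db s y k))
      K (η * (L * ‖k‖)) 0 t T hK0 (by positivity)
      (fun s _ => ((vpSol_deriv h.ok 0 (y+k) s).sub (vpSol_deriv h.ok 0 y s)).sub ?_) (by simp [hT])
      (by simp [vpN_zero h, vpSol_self h.ok]) ?_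
    · have := (vpN_deriv h y s).clm_apply (hasDerivAt_const s k)
      simpa using this
    intro s hs
    have hsT := vp_uIcc_abs (by simpa using hT0) (le_refl |t|) hs
    have hball : ∀ z ∈ Metric.ball (vpSol b 0 y s) δ, ‖db s z - db s (vpSol b 0 y s)‖ ≤ η := by
      intro z hz
      have := hδ (z - vpSol b 0 y s) (by simpa [dist_eq_norm] using hz) s (abs_le.mp hsT)
      simpa using this
    have hmv := (convex_ball (vpSol b 0 y s) δ).norm_image_sub_le_of_norm_hasFDerivWithin_le'
      (f := b s) (f' := fun z => db s z) (φ := db s (vpSol b 0 y s)) (C := η)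
      (x := vpSol b 0 y s) (y := vpSol b 0 (y + k) s)
      (fun z _ => (h.der s z).hasFDerivWithinAt) hball (Metric.mem_ball_self hδ0)
      (by rw [Metric.mem_ball, dist_eq_norm]; exact (hdiff s hsT).trans_lt hk)
    have e : b s (vpSol b 0 (y + k) s) - b s (vpSol b 0 y s) - (db s (vpSol b 0 y s)) (vpN b db s y k)
        = (db s (vpSol b 0 y s)) (vpSol b 0 (y + k) s - vpSol b 0 y s - vpN b db s y k) +
         (b s (vpSol b 0 (y + k) s) - b s (vpSol b 0 y s)
          - db s (vpSol b 0 y s) (vpSol b 0 (y + k) s - vpSol b 0 y s)) := by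
      simp only [map_sub]; abel
    rw [e]
    refine (norm_add_le _ _).trans (add_le_add ?_ ?_)
    · exact ((db s (vpSol b 0 y s)).le_opNorm _).trans (by gcongr; exact hK s hsT _)
    · exact hmv.trans (by gcongr; exact hdiff s hsT)
  refine key.trans ?_
  have : η * (L * ‖k‖) * γ = ε * ((L * γ) / (L * γ + 1)) * ‖k‖ := by rw [hη]; ring
  rw [this]
  gcongr
  have : (L * γ) / (L * γ + 1) ≤ 1 := by
    rw [div_le_one (by positivity)]; linarith
  nlinarith

lemma vpFlow_joint (h : VPOk1 b db) (q : ℝ × E) :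
    HasFDerivAt (fun q : ℝ × E => vpSol b 0 q.2 q.1)
      ((ContinuousLinearMap.toSpanSingleton ℝ (b q.1 (vpSol b 0 q.2 q.1))).coprod (vpN b db q.1 q.2)) q := by
  refine (hasStrictFDerivAt_uncurry_coprod (u := q) (f := fun t y => vpSol b 0 y t)
    (f₁ := fun t y => ContinuousLinearMap.toSpanSingleton ℝ (b t (vpSol b 0 y t)))
    (f₂ := fun t y => vpN b db t y) ?_ ?_ ?_ ?_).hasFDerivAt
  · exact Filter.Eventually.of_forall fun v => (vpSol_deriv h.ok 0 v.2 v.1).hasFDerivAt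
  · exact Filter.Eventually.of_forall fun v => vpFlow_fderiv h v.1 v.2
  · have h1 : Continuous (fun q : ℝ × E => b q.1 (vpSol b 0 q.2 q.1)) :=
      h.bc.comp (continuous_fst.prodMk (vpFlow_cont h.ok))
    have h2 := (ContinuousLinearMap.toSpanSingletonCLE (𝕜 := ℝ) (E := E)).continuous.comp h1
    exact h2.continuousAt
  · exact (vpN_cont h).continuousAt

lemma vpFlow_contDiff (h : VPOk1 b db) : ContDiff ℝ 1 (fun q : ℝ × E => vpSol b 0 q.2 q.1) := by
  rw [contDiff_one_iff_hasFDerivAt]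
  refine ⟨_, ?_, vpFlow_joint h⟩
  have h1 : Continuous (fun q : ℝ × E => b q.1 (vpSol b 0 q.2 q.1)) :=
      h.bc.comp (continuous_fst.prodMk (vpFlow_cont h.ok))
  have h2 := (ContinuousLinearMap.toSpanSingletonCLE (𝕜 := ℝ) (E := E)).continuous.comp h1
  have h3 := (ContinuousLinearMap.coprodEquivL (𝕜 := ℝ) (E := ℝ) (F := E) (G := E) ℝ).continuous.comp (h2.prodMk (vpN_cont h))
  exact h3

lemma vpN_inj (h : VPOk1 b db) (t : ℝ) (y k : E) (hk : vpN b db t y k = 0) : k = 0 := by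
  obtain ⟨K, hK0, hK, _⟩ := h.dbd |t|
  have := vp_gron0 (fun s => vpN b db s y k) (fun s => (db s (vpSol b 0 y s)) (vpN b db s y k)) K t 0
    (fun s _ => by simpa using (vpN_deriv h y s).clm_apply (hasDerivAt_const s k))
    (fun s hs => ((db s (vpSol b 0 y s)).le_opNorm _).trans
      (by gcongr; exact hK s (vp_uIcc_abs le_rfl (by simp) hs) _))
  rw [hk, norm_zero, zero_mul, vpN_zero h] at this
  simpa using this

lemma vpInv_contDiff [FiniteDimensional ℝ E] (h : VPOk1 b db) :
    ContDiff ℝ 1 (fun q : ℝ × E => vpSol b q.1 q.2 0) := by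
  have hd : ∀ q, HasFDerivAt (vpHomeo h.ok) ((ContinuousLinearMap.fst ℝ ℝ E).prod
      ((ContinuousLinearMap.toSpanSingleton ℝ (b q.1 (vpSol b 0 q.2 q.1))).coprod (vpN b db q.1 q.2))) q := by
    intro q
    exact (hasFDerivAt_fst (p := q)).prodMk (vpFlow_joint h q)
  have hinj : ∀ q : ℝ × E, Function.Injective ((ContinuousLinearMap.fst ℝ ℝ E).prod
      ((ContinuousLinearMap.toSpanSingleton ℝ (b q.1 (vpSol b 0 q.2 q.1))).coprod (vpN b db q.1 q.2)) : ℝ × E →L[ℝ] ℝ × E).toLinearMap := by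
    intro q
    rw [injective_iff_map_eq_zero]
    rintro ⟨a, k⟩ hz
    simp only [ContinuousLinearMap.coe_coe, ContinuousLinearMap.prod_apply, ContinuousLinearMap.coe_fst', ContinuousLinearMap.coprod_apply, Prod.mk_eq_zero, ContinuousLinearMap.toSpanSingleton_apply] at hz
    obtain ⟨rfl, hz⟩ := hz
    rw [zero_smul, zero_add] at hz
    rw [vpN_inj h _ _ _ hz]; rfl
  have hc : ContDiff ℝ 1 (vpHomeo h.ok) := contDiff_fst.prodMk (vpFlow_contDiff h)
  have := (vpHomeo h.ok).contDiff_symm (n := 1)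
    (f₀' := fun q => (LinearEquiv.ofInjectiveEndo _ (hinj q)).toContinuousLinearEquiv) (fun q => by
      have e : (((LinearEquiv.ofInjectiveEndo _ (hinj q)).toContinuousLinearEquiv : (ℝ × E) ≃L[ℝ] (ℝ × E)) :
          ℝ × E →L[ℝ] ℝ × E) = ((ContinuousLinearMap.fst ℝ ℝ E).prod
      ((ContinuousLinearMap.toSpanSingleton ℝ (b q.1 (vpSol b 0 q.2 q.1))).coprod (vpN b db q.1 q.2))) := by
        refine ContinuousLinearMap.ext fun z => rfl
      rw [e]
      exact hd q) hc
  exact contDiff_snd.comp this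

end Flow


section Liouville

lemma vp_det_deriv {ι : Type*} [Fintype ι] [DecidableEq ι] (M : ℝ → Matrix ι ι ℝ) (A : Matrix ι ι ℝ) (t : ℝ)
    (hM : ∀ i j, HasDerivAt (fun s => M s i j) ((A * M t) i j) t) :
    HasDerivAt (fun s => (M s).det) (A.trace * (M t).det) t := by
  let D : ContinuousMultilinearMap ℝ (fun _ : ι => (ι → ℝ)) ℝ :=
    { Matrix.detRowAlternating.toMultilinearMap with
      cont := Continuous.matrix_det continuous_id }
  have hD : ∀ m, D m = Matrix.det m := fun m => rfl
  have hM' : HasDerivAt (fun s => ((fun i => M s i) : ι → (ι → ℝ))) (fun i => (A * M t) i) t := by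
    rw [hasDerivAt_pi]; intro i
    rw [hasDerivAt_pi]; intro j
    exact hM i j
  have h1 := (D.hasFDerivAt (x := fun i => M t i)).comp_hasDerivAt t hM'
  have h2 : (D.linearDeriv (fun i => M t i)) (fun i => (A * M t) i) = A.trace * (M t).det := by
    rw [ContinuousMultilinearMap.linearDeriv_apply]
    have : ∀ i, D (Function.update (fun i => M t i) i ((A * M t) i)) = ((A * M t) * (M t).adjugate) i i := by
      intro i
      rw [hD]
      have e := Matrix.cramer_transpose_apply (M t) ((A * M t) i) i
      have e2 : (Matrix.det (Function.update (fun i => M t i) i ((A * M t) i))) = ((M t).updateRow i ((A * M t) i)).det := rfl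
      rw [e2, ← e, Matrix.cramer_eq_adjugate_mulVec, Matrix.mulVec, Matrix.mul_apply, dotProduct]
      refine Finset.sum_congr rfl fun k _ => ?_
      rw [← Matrix.adjugate_transpose, Matrix.transpose_apply, mul_comm]
    rw [Finset.sum_congr rfl fun i _ => this i, Matrix.mul_assoc, Matrix.mul_adjugate]
    simp only [Matrix.trace, Matrix.diag_apply, Finset.sum_mul]
    refine Finset.sum_congr rfl fun i _ => ?_
    simp [mul_comm]
  rw [h2] at h1
  exact h1

variable {E : Type*} [NormedAddCommGroup E] [NormedSpace ℝ E] [FiniteDimensional ℝ E] [CompleteSpace E]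
  {b : ℝ → E → E} {db : ℝ → E → E →L[ℝ] E}

lemma vpN_det {ι : Type*} [Fintype ι] [DecidableEq ι] (e : Module.Basis ι ℝ E) (h : VPOk1 b db)
    (htr : ∀ t x i, e.repr (db t x (e i)) i = 0) (t : ℝ) (y : E) : (vpN b db t y).det = 1 := by
  set M : ℝ → Matrix ι ι ℝ := fun s => LinearMap.toMatrix e e (vpN b db s y).toLinearMap with hM
  have hdet : ∀ s, (vpN b db s y).det = (M s).det := fun s => by
    rw [hM, LinearMap.det_toMatrix]
  have hd : ∀ s, HasDerivAt (fun s => (M s).det) 0 s := by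
    intro s
    have key := vp_det_deriv M (LinearMap.toMatrix e e (db s (vpSol b 0 y s)).toLinearMap) s (fun i j => by
      have h1 := vpN_deriv h y s
      have h2 := h1.clm_apply (hasDerivAt_const s (e j))
      have h3 := (LinearMap.toContinuousLinearMap (e.coord i)).hasFDerivAt.comp_hasDerivAt s h2
      have e1 : (LinearMap.toMatrix e e (db s (vpSol b 0 y s)).toLinearMap * M s) i j
          = (LinearMap.toContinuousLinearMap (e.coord i)) ((db s (vpSol b 0 y s) ∘SL vpN b db s y) (e j) + (vpN b db s y) 0) := by
        simp only [hM]
        rw [← LinearMap.toMatrix_comp, LinearMap.toMatrix_apply]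
        simp
      have e2 : (fun s => M s i j) = (LinearMap.toContinuousLinearMap (e.coord i)) ∘ fun r => (vpN b db r y) (e j) := by
        funext r
        simp only [hM, LinearMap.toMatrix_apply]
        simp
      rw [e1, e2]
      exact h3)
    have tr0 : (LinearMap.toMatrix e e (db s (vpSol b 0 y s)).toLinearMap).trace = 0 := by
      simp only [Matrix.trace, Matrix.diag_apply, LinearMap.toMatrix_apply]
      exact Finset.sum_eq_zero fun i _ => htr _ _ i
    rwa [tr0, zero_mul] at key
  rw [hdet]
  have := is_const_of_deriv_eq_zero (fun s => (hd s).differentiableAt) (fun s => (hd s).deriv) t 0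
  rw [this, ← hdet, vpN_zero h]
  simp [ContinuousLinearMap.det]

lemma vpFlow_mp {ι : Type*} [Fintype ι] [DecidableEq ι] [MeasurableSpace E] [BorelSpace E]
    (μ : Measure E) [μ.IsAddHaarMeasure] (e : Module.Basis ι ℝ E) (h : VPOk1 b db)
    (htr : ∀ t x i, e.repr (db t x (e i)) i = 0) (t : ℝ) :
    MeasurePreserving (fun y => vpSol b 0 y t) μ μ := by
  have hc : Continuous (fun y => vpSol b 0 y t) := (vpFlow_cont h.ok).comp (continuous_const.prodMk continuous_id)
  refine ⟨hc.measurable, ?_⟩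
  ext S hS
  rw [Measure.map_apply hc.measurable hS]
  have inj : Function.Injective (fun y => vpSol b 0 y t) := by
    intro y z hyz
    have hy := vpSol_comp h.ok 0 t 0 y
    have hz := vpSol_comp h.ok 0 t 0 z
    simp only at hyz
    rw [hyz] at hy
    rw [hy, vpSol_self h.ok, vpSol_self h.ok] at hz
    exact hz
  have surj : Function.Surjective (fun y => vpSol b 0 y t) := by
    intro x
    refine ⟨vpSol b t x 0, ?_⟩
    simp only
    rw [vpSol_comp h.ok, vpSol_self h.ok]
  have := lintegral_abs_det_fderiv_eq_addHaar_image μ (hc.measurable hS)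
    (fun y _ => (vpFlow_fderiv h t y).hasFDerivWithinAt) inj.injOn
  rw [image_preimage_eq _ surj] at this
  rw [← this]
  simp [vpN_det e h htr]

end Liouville


section Kernel

/-- regularised Coulomb potential -/
def vph (δ : ℝ) (x : E3) : ℝ := (√(‖x‖ ^ 2 + δ ^ 2))⁻¹

/-- regularised Coulomb kernel -/
def vpk (δ : ℝ) (x : E3) : E3 := (vph δ x) ^ 3 • x

/-- derivative of the kernel -/
def vpdk (δ : ℝ) (x : E3) : E3 →L[ℝ] E3 :=
  (vph δ x) ^ 3 • ContinuousLinearMap.id ℝ E3 +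
    ((-3 * (vph δ x) ^ 5) • innerSL ℝ x).smulRight x

lemma vph_nonneg (δ : ℝ) (x : E3) : 0 ≤ vph δ x := by unfold vph; positivity

lemma vph_neg (δ : ℝ) (x : E3) : vph δ (-x) = vph δ x := by unfold vph; simp

lemma vpk_neg (δ : ℝ) (x : E3) : vpk δ (-x) = - vpk δ x := by unfold vpk; rw [vph_neg, smul_neg]

lemma vph_zero (x : E3) : vph 0 x = ‖x‖⁻¹ := by
  unfold vph; simp

lemma vph_mul_norm (δ : ℝ) (x : E3) : vph δ x * ‖x‖ ≤ 1 := by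
  unfold vph
  rcases eq_or_ne x 0 with rfl | hx
  · simp
  have h1 : 0 < ‖x‖ := norm_pos_iff.mpr hx
  rw [inv_mul_le_one₀ (Real.sqrt_pos.mpr (by positivity))]
  apply Real.le_sqrt_of_sq_le
  nlinarith [sq_nonneg δ]

lemma vph_le_inv (δ : ℝ) (x : E3) (hδ : 0 < δ) : vph δ x ≤ δ⁻¹ := by
  unfold vph
  gcongr
  apply Real.le_sqrt_of_sq_le
  nlinarith [sq_nonneg ‖x‖]

lemma vph_le_norm (δ : ℝ) (x : E3) (hx : x ≠ 0) : vph δ x ≤ ‖x‖⁻¹ := by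
  have h1 : 0 < ‖x‖ := norm_pos_iff.mpr hx
  rw [← one_div, le_div_iff₀ h1]
  exact vph_mul_norm δ x

lemma vph_pos (δ : ℝ) (x : E3) (hδ : 0 < δ) : 0 < vph δ x := by
  unfold vph
  have : 0 < √(‖x‖ ^ 2 + δ ^ 2) := Real.sqrt_pos.mpr (by positivity)
  positivity

lemma vpk_norm (δ : ℝ) (x : E3) : ‖vpk δ x‖ = (vph δ x) ^ 3 * ‖x‖ := by
  unfold vpk
  rw [norm_smul, Real.norm_of_nonneg (pow_nonneg (vph_nonneg _ _) _)]

lemma vpk_norm_le_sq (δ : ℝ) (x : E3) : ‖vpk δ x‖ ≤ (vph δ x) ^ 2 := by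
  rw [vpk_norm]
  have h1 := vph_mul_norm δ x
  have h2 := vph_nonneg δ x
  calc (vph δ x) ^ 3 * ‖x‖ = (vph δ x) ^ 2 * (vph δ x * ‖x‖) := by ring
    _ ≤ (vph δ x) ^ 2 * 1 := by gcongr
    _ = _ := mul_one _

lemma vpk_zero_arg (δ : ℝ) : vpk δ 0 = 0 := by unfold vpk; simp

lemma vpk_norm_le (δ : ℝ) (x : E3) : ‖vpk δ x‖ ≤ (‖x‖ ^ 2)⁻¹ := by
  rcases eq_or_ne x 0 with rfl | hx
  · simp [vpk_zero_arg]
  refine (vpk_norm_le_sq δ x).trans ?_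
  rw [← inv_pow]
  exact pow_le_pow_left₀ (vph_nonneg _ _) (vph_le_norm δ x hx) 2

lemma vpk_norm_le_delta (δ : ℝ) (x : E3) (hδ : 0 < δ) : ‖vpk δ x‖ ≤ (δ ^ 2)⁻¹ := by
  refine (vpk_norm_le_sq δ x).trans ?_
  rw [← inv_pow]
  exact pow_le_pow_left₀ (vph_nonneg _ _) (vph_le_inv δ x hδ) 2

lemma vph_hasFDerivAt (δ : ℝ) (hδ : 0 < δ) (x : E3) :
    HasFDerivAt (vph δ) ((-(vph δ x) ^ 3) • innerSL ℝ x) x := by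
  have hpos : 0 < ‖x‖ ^ 2 + δ ^ 2 := by positivity
  have h1 : HasFDerivAt (fun x : E3 => ‖x‖ ^ 2 + δ ^ 2) (2 • (innerSL ℝ x)) x :=
    (hasStrictFDerivAt_norm_sq x).hasFDerivAt.add_const _
  have h2 : HasDerivAt (fun y : ℝ => (√y)⁻¹) (-(1 / (2 * √(‖x‖ ^ 2 + δ ^ 2))) / (√(‖x‖ ^ 2 + δ ^ 2)) ^ 2) (‖x‖ ^ 2 + δ ^ 2) :=
    (Real.hasDerivAt_sqrt hpos.ne').inv (Real.sqrt_pos.mpr hpos).ne'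
  have h3 := h2.comp_hasFDerivAt x h1
  refine h3.congr_fderiv ?_
  have hs : √(‖x‖ ^ 2 + δ ^ 2) ≠ 0 := (Real.sqrt_pos.mpr hpos).ne'
  ext1 v
  simp only [vph, ContinuousLinearMap.smul_apply, smul_eq_mul, nsmul_eq_mul, ContinuousLinearMap.coe_smul', Pi.smul_apply]
  field_simp
  simp

lemma vph_cont (δ : ℝ) (hδ : 0 < δ) : Continuous (vph δ) :=
  continuous_iff_continuousAt.mpr fun x => (vph_hasFDerivAt δ hδ x).continuousAt

lemma vpk_hasFDerivAt (δ : ℝ) (hδ : 0 < δ) (x : E3) : HasFDerivAt (vpk δ) (vpdk δ x) x := by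
  have h1 := ((vph_hasFDerivAt δ hδ x).pow 3).smul (hasFDerivAt_id x)
  refine h1.congr_fderiv ?_
  ext1 v
  simp only [vpdk, ContinuousLinearMap.add_apply, ContinuousLinearMap.smul_apply, ContinuousLinearMap.smulRight_apply,
    ContinuousLinearMap.id_apply, smul_eq_mul, id]
  congr 2
  simp
  ring

lemma vpk_cont (δ : ℝ) (hδ : 0 < δ) : Continuous (vpk δ) :=
  ((vph_cont δ hδ).pow 3).smul continuous_id

lemma vpdk_cont (δ : ℝ) (hδ : 0 < δ) : Continuous (vpdk δ) := by
  have h := vph_cont δ hδ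
  unfold vpdk
  have h1 : Continuous fun x : E3 => (-3 * (vph δ x) ^ 5) • innerSL ℝ x :=
    (continuous_const.mul (h.pow 5)).smul (innerSL ℝ).continuous
  refine ((h.pow 3).smul continuous_const).add ?_
  exact (ContinuousLinearMap.smulRightL ℝ E3 E3).continuous.comp h1 |>.clm_apply continuous_id

lemma vpdk_norm_le (δ : ℝ) (x : E3) : ‖vpdk δ x‖ ≤ 4 * (vph δ x) ^ 3 := by
  have h0 := vph_nonneg δ x
  have h1 := vph_mul_norm δ x
  unfold vpdk
  refine (norm_add_le _ _).trans ?_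
  have a1 : ‖(vph δ x) ^ 3 • ContinuousLinearMap.id ℝ E3‖ ≤ (vph δ x) ^ 3 := by
    rw [norm_smul, Real.norm_of_nonneg (by positivity)]
    calc _ ≤ (vph δ x) ^ 3 * 1 := by gcongr; exact ContinuousLinearMap.norm_id_le
      _ = _ := mul_one _
  have a2 : ‖((-3 * (vph δ x) ^ 5) • innerSL ℝ x).smulRight x‖ ≤ 3 * (vph δ x) ^ 3 := by
    rw [ContinuousLinearMap.norm_smulRight_apply, norm_smul, innerSL_apply_norm, norm_mul,
      Real.norm_of_nonneg (pow_nonneg h0 5)]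
    have : ‖(-3:ℝ)‖ = 3 := by norm_num
    rw [this]
    have h2 : (vph δ x * ‖x‖) ^ 2 ≤ 1 := pow_le_one₀ (by positivity) h1
    calc 3 * vph δ x ^ 5 * ‖x‖ * ‖x‖ = 3 * vph δ x ^ 3 * ((vph δ x * ‖x‖) ^ 2) := by ring
      _ ≤ 3 * vph δ x ^ 3 * 1 := by gcongr
      _ = _ := mul_one _
  linarith

lemma vpk_diff (δ : ℝ) (hδ : 0 ≤ δ) (x : E3) :
    ‖vpk δ x - vpk 0 x‖ ≤ 2 * δ ^ 2 * (‖x‖ ^ 2)⁻¹ * (‖x‖ ^ 2 + δ ^ 2)⁻¹ := by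
  rcases eq_or_ne x 0 with rfl | hx
  · simp [vpk_zero_arg]
  have h1 : 0 < ‖x‖ := norm_pos_iff.mpr hx
  have hs : 0 < ‖x‖ ^ 2 + δ ^ 2 := by positivity
  set a := vph δ x * ‖x‖ with ha
  have ha0 : 0 ≤ a := mul_nonneg (vph_nonneg _ _) h1.le
  have ha1 : a ≤ 1 := vph_mul_norm δ x
  have ha2 : a ^ 2 = ‖x‖ ^ 2 / (‖x‖ ^ 2 + δ ^ 2) := by
    rw [ha, mul_pow, vph, inv_pow, Real.sq_sqrt hs.le]; field_simp
  have e : vpk δ x - vpk 0 x = ((a ^ 3 - 1) * (‖x‖⁻¹) ^ 3) • x := by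
    unfold vpk
    rw [← sub_smul, vph_zero, ha]
    congr 1
    field_simp
  rw [e, norm_smul, norm_mul, Real.norm_of_nonpos (by nlinarith [pow_le_one₀ ha0 ha1 (n := 3)]),
    Real.norm_of_nonneg (by positivity)]
  have h3 : -(a ^ 3 - 1) ≤ 2 * (1 - a ^ 2) := by
    nlinarith [mul_nonneg (sub_nonneg.mpr ha1) (by nlinarith : (0:ℝ) ≤ 1 + a - a ^ 2)]
  have h4 : 1 - a ^ 2 = δ ^ 2 / (‖x‖ ^ 2 + δ ^ 2) := by rw [ha2]; field_simp; ring
  rw [h4] at h3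
  calc -(a ^ 3 - 1) * ‖x‖⁻¹ ^ 3 * ‖x‖ = -(a ^ 3 - 1) * (‖x‖ ^ 2)⁻¹ := by field_simp
    _ ≤ 2 * (δ ^ 2 / (‖x‖ ^ 2 + δ ^ 2)) * (‖x‖ ^ 2)⁻¹ := by gcongr
    _ = _ := by rw [div_eq_mul_inv]; ring

end Kernel


section Radial

/-- area-type constant -/
def vpκ : ℝ := 3 * (volume.real (Metric.ball (0 : E3) 1))

lemma vpκ_nonneg : 0 ≤ vpκ := by unfold vpκ; positivity

lemma vp_radial (h Q : ℝ → ℝ) (I : ℝ) (hm : Measurable h) (h0 : ∀ r, 0 ≤ h r)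
    (hQ : IntegrableOn Q (Ioi 0)) (hle : ∀ r, 0 < r → r ^ 2 * h r ≤ Q r)
    (hI : ∫ r in Ioi (0:ℝ), Q r ≤ I) :
    ∫⁻ x : E3, ENNReal.ofReal (h ‖x‖) ≤ ENNReal.ofReal (vpκ * I) := by
  have hd : Module.finrank ℝ E3 = 3 := by simp
  have hq : IntegrableOn (fun r : ℝ => r ^ 2 * h r) (Ioi 0) := by
    refine Integrable.mono' hQ (by fun_prop) ?_
    filter_upwards [ae_restrict_mem measurableSet_Ioi] with r hr
    rw [Real.norm_of_nonneg (mul_nonneg (sq_nonneg _) (h0 r))]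
    exact hle r hr
  have h1 : Integrable (fun x : E3 => h ‖x‖) := by
    rw [integrable_fun_norm_addHaar (μ := (volume : Measure E3)), hd]
    simpa using hq
  rw [← ofReal_integral_eq_lintegral_ofReal h1 (Eventually.of_forall fun x => h0 _)]
  apply ENNReal.ofReal_le_ofReal
  rw [integral_fun_norm_addHaar (volume : Measure E3) h, hd]
  have h2 : ∫ r in Ioi (0:ℝ), r ^ 2 * h r ≤ I := by
    refine le_trans ?_ hI
    exact setIntegral_mono_on hq hQ measurableSet_Ioi (fun r hr => hle r hr)
  have h3 : 0 ≤ volume.real (Metric.ball (0 : E3) 1) := by positivity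
  simp only [nsmul_eq_mul, smul_eq_mul, vpκ]
  norm_num
  rw [mul_assoc]
  gcongr

lemma vp_A1 (s : ℝ) (hs : 0 ≤ s) :
    ∫⁻ x : E3, (if ‖x‖ < s then ENNReal.ofReal ((‖x‖ ^ 2)⁻¹) else 0) ≤ ENNReal.ofReal (vpκ * s) := by
  have := vp_radial (fun r => if r < s then (r ^ 2)⁻¹ else 0) ((Ioo 0 s).indicator fun _ => 1) s
    (by
      refine Measurable.ite (measurableSet_lt measurable_id measurable_const) (by fun_prop) measurable_const)
    (fun r => by split_ifs <;> positivity) ?_ ?_ ?_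
  · refine le_trans (le_of_eq ?_) this
    congr 1; ext x; split_ifs <;> simp
  · exact ((integrable_indicator_iff measurableSet_Ioo).mpr (by simp)).integrableOn
  · intro r hr
    by_cases h : r < s
    · have : r ∈ Ioo 0 s := ⟨hr, h⟩
      simp [h, this]
      rw [mul_inv_cancel₀ (by positivity)]
    · simp [h]
  · rw [integral_indicator measurableSet_Ioo, Measure.restrict_restrict measurableSet_Ioo]
    have : Ioo 0 s ∩ Ioi 0 = Ioo 0 s := by ext; simp; tauto
    rw [this]; simp [hs]

lemma vp_A3 (s : ℝ) (hs : 0 ≤ s) :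
    volume (Metric.ball (0 : E3) s) ≤ ENNReal.ofReal (vpκ * s ^ 3) := by
  rw [Measure.addHaar_ball _ _ hs]
  have : Module.finrank ℝ E3 = 3 := by simp
  rw [this, mul_comm vpκ, ENNReal.ofReal_mul (by positivity)]
  gcongr
  rw [← ENNReal.ofReal_toReal (measure_ball_lt_top.ne)]
  apply ENNReal.ofReal_le_ofReal
  unfold vpκ Measure.real
  have : 0 ≤ (volume (Metric.ball (0 : E3) 1)).toReal := by positivity
  linarith

lemma vp_A2 (s : ℝ) (hs : 0 < s) :
    ∫⁻ x : E3, (if s ≤ ‖x‖ then ENNReal.ofReal ((‖x‖ ^ 5)⁻¹) else 0) ≤ ENNReal.ofReal (vpκ * (2 * s ^ 2)⁻¹) := by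
  have hder : ∀ x ∈ Ioi s, HasDerivAt (fun r : ℝ => -(2 * r ^ 2)⁻¹) ((x ^ 3)⁻¹) x := by
    intro x hx
    have hx0 : 0 < x := hs.trans hx
    have h1 : HasDerivAt (fun r : ℝ => 2 * r ^ 2) (2 * (2 * x)) x := by
      simpa using (hasDerivAt_pow 2 x).const_mul 2
    have h2 : HasDerivAt (fun r : ℝ => -(2 * r ^ 2)⁻¹) _ x := (h1.inv (by positivity)).neg
    refine h2.congr_deriv ?_
    field_simp
  have hcont : ContinuousWithinAt (fun r : ℝ => -(2 * r ^ 2)⁻¹) (Ici s) s := by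
    refine ContinuousAt.continuousWithinAt ?_
    have : (2 * s ^ 2) ≠ 0 := by positivity
    fun_prop (disch := assumption)
  have hlim : Tendsto (fun r : ℝ => -(2 * r ^ 2)⁻¹) atTop (𝓝 0) := by
    have : Tendsto (fun r : ℝ => 2 * r ^ 2) atTop atTop :=
      (tendsto_pow_atTop (by norm_num)).const_mul_atTop (by norm_num)
    simpa using this.inv_tendsto_atTop.neg
  have hpos : ∀ x ∈ Ioi s, 0 ≤ (x ^ 3)⁻¹ := fun x hx => by
    have hx0 : 0 < x := hs.trans hx
    positivity
  have hint := integrableOn_Ioi_deriv_of_nonneg hcont hder hpos hlim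
  have hval := integral_Ioi_of_hasDerivAt_of_nonneg hcont hder hpos hlim
  have := vp_radial (fun r => if s ≤ r then (r ^ 5)⁻¹ else 0) ((Ici s).indicator fun r => (r ^ 3)⁻¹) ((2 * s ^ 2)⁻¹)
    (by
      refine Measurable.ite (measurableSet_le measurable_const measurable_id) (by fun_prop) measurable_const)
    (fun r => by
      split_ifs with h
      · have := hs.trans_le h
        positivity
      · rfl) ?_ ?_ ?_
  · refine le_trans (le_of_eq ?_) this
    congr 1; ext x; split_ifs <;> simp
  · refine ((integrable_indicator_iff measurableSet_Ici).mpr ?_).integrableOn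
    exact (integrableOn_Ici_iff_integrableOn_Ioi).mpr hint
  · intro r hr
    by_cases h : s ≤ r
    · have : r ∈ Ici s := h
      simp only [h, if_true, indicator_of_mem this]
      apply le_of_eq; field_simp
    · simp [h]
  · rw [integral_indicator measurableSet_Ici, Measure.restrict_restrict measurableSet_Ici]
    have : Ici s ∩ Ioi 0 = Ici s := by ext y; simp; intro h; linarith
    rw [this, integral_Ici_eq_integral_Ioi, hval]; simp

lemma vp_A4 (δ : ℝ) (hδ : 0 < δ) :
    ∫⁻ x : E3, ENNReal.ofReal (2 * δ ^ 2 * (‖x‖ ^ 2)⁻¹ * (‖x‖ ^ 2 + δ ^ 2)⁻¹) ≤ ENNReal.ofReal (vpκ * (π * δ)) := by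
  have hder : ∀ x ∈ Ioi (0:ℝ), HasDerivAt (fun r : ℝ => 2 * δ * arctan (r / δ)) (2 * δ ^ 2 * (x ^ 2 + δ ^ 2)⁻¹) x := by
    intro x hx
    have h1 : HasDerivAt (fun r : ℝ => r / δ) (1 / δ) x := (hasDerivAt_id x).div_const δ
    have h2 : HasDerivAt (fun r : ℝ => 2 * δ * arctan (r / δ)) _ x := (h1.arctan).const_mul (2 * δ)
    refine h2.congr_deriv ?_
    field_simp
    ring
  have hcont : ContinuousWithinAt (fun r : ℝ => 2 * δ * arctan (r / δ)) (Ici 0) 0 := by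
    refine ContinuousAt.continuousWithinAt ?_
    fun_prop
  have hlim : Tendsto (fun r : ℝ => 2 * δ * arctan (r / δ)) atTop (𝓝 (2 * δ * (π / 2))) := by
    refine Tendsto.const_mul _ ?_
    have h2 : Tendsto (fun r : ℝ => r / δ) atTop atTop := tendsto_id.atTop_div_const hδ
    exact (tendsto_nhds_of_tendsto_nhdsWithin tendsto_arctan_atTop).comp h2
  have hpos : ∀ x ∈ Ioi (0:ℝ), 0 ≤ 2 * δ ^ 2 * (x ^ 2 + δ ^ 2)⁻¹ := fun x hx => by positivity
  have hint := integrableOn_Ioi_deriv_of_nonneg hcont hder hpos hlim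
  have hval := integral_Ioi_of_hasDerivAt_of_nonneg hcont hder hpos hlim
  refine vp_radial (fun r => 2 * δ ^ 2 * (r ^ 2)⁻¹ * (r ^ 2 + δ ^ 2)⁻¹) _ (π * δ) (by fun_prop)
    (fun r => by positivity) hint ?_ ?_
  · intro r hr
    apply le_of_eq; field_simp
  · rw [hval]; simp; linarith

lemma vp_A5 (d : ℝ) (hd : 0 < d) :
    ∫⁻ x : E3, (if ‖x‖ < 1 then ENNReal.ofReal ((vph d x) ^ 3) else 0) ≤
      ENNReal.ofReal (vpκ * (2 * Real.log (1 + d⁻¹))) := by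
  have hlog : ∫ r in (0:ℝ)..1, 2 * (r + d)⁻¹ = 2 * Real.log (1 + d⁻¹) := by
    rw [intervalIntegral.integral_const_mul, intervalIntegral.integral_comp_add_right (fun r => r⁻¹),
      integral_inv_of_pos (by linarith) (by linarith)]
    congr 2
    field_simp; ring
  have hii : IntervalIntegrable (fun r => 2 * (r + d)⁻¹) volume 0 1 := by
    apply ContinuousOn.intervalIntegrable
    intro r hr
    rw [uIcc_of_le (by norm_num)] at hr
    have : r + d ≠ 0 := by have := hr.1; positivity
    refine ContinuousAt.continuousWithinAt ?_
    fun_prop (disch := assumption)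
  rw [intervalIntegrable_iff_integrableOn_Ioc_of_le (by norm_num)] at hii
  have := vp_radial (fun r => if r < 1 then ((√(r ^ 2 + d ^ 2))⁻¹) ^ 3 else 0)
    ((Ioc 0 1).indicator fun r => 2 * (r + d)⁻¹) (2 * Real.log (1 + d⁻¹))
    (by
      refine Measurable.ite (measurableSet_lt measurable_id measurable_const) (by fun_prop) measurable_const)
    (fun r => by split_ifs <;> positivity) ?_ ?_ ?_
  · refine le_trans (le_of_eq ?_) this
    congr 1; ext x; split_ifs <;> simp [vph]
  · exact ((integrable_indicator_iff measurableSet_Ioc).mpr hii).integrableOn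
  · intro r hr
    by_cases h : r < 1
    · have h1 : r ∈ Ioc 0 1 := ⟨hr, h.le⟩
      simp only [h, if_true, indicator_of_mem h1]
      set w := √(r ^ 2 + d ^ 2) with hw
      have hw2 : w ^ 2 = r ^ 2 + d ^ 2 := Real.sq_sqrt (by positivity)
      have hw0 : 0 < w := Real.sqrt_pos.mpr (by positivity)
      have h2 : r + d ≤ 2 * w := by
        apply le_of_sq_le_sq ?_ (by positivity)
        nlinarith [sq_nonneg (r - d), sq_nonneg (r+d)]
      have h3 : r ^ 2 * w⁻¹ ^ 3 ≤ w⁻¹ := by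
        have : r ^ 2 ≤ w ^ 2 := by nlinarith
        calc r ^ 2 * w⁻¹ ^ 3 ≤ w ^ 2 * w⁻¹ ^ 3 := by gcongr
          _ = w⁻¹ := by field_simp
      refine h3.trans ?_
      rw [← div_eq_mul_inv, le_div_iff₀ (by positivity), inv_mul_le_iff₀ hw0]
      linarith
    · simp only [h, if_false]
      rw [mul_zero]
      refine indicator_nonneg (fun x hx => ?_) _
      have := hx.1
      positivity
  · rw [integral_indicator measurableSet_Ioc, Measure.restrict_restrict measurableSet_Ioc]
    have : Ioc (0:ℝ) 1 ∩ Ioi 0 = Ioc 0 1 := by ext; simp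
    rw [this, ← intervalIntegral.integral_of_le (by norm_num), hlog]

end Radial


/-- phase space -/
abbrev Z3 := E3 × E3

section Tau

/-- time scale, equal to `1+t` for `t ≥ 0`, positive everywhere -/
def vpτ (t : ℝ) : ℝ := 1 + t + (min t 0) ^ 2

lemma vpτ_of_nonneg {t : ℝ} (ht : 0 ≤ t) : vpτ t = 1 + t := by simp [vpτ, ht]

lemma vpτ_ge (t : ℝ) : 3 / 4 ≤ vpτ t := by
  unfold vpτ
  rcases le_total t 0 with h | h
  · rw [min_eq_left h]; nlinarith [sq_nonneg (t + 1/2)]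
  · rw [min_eq_right h]; linarith

lemma vpτ_pos (t : ℝ) : 0 < vpτ t := by linarith [vpτ_ge t]

lemma vpτ_ge_one {t : ℝ} (ht : 0 ≤ t) : 1 ≤ vpτ t := by rw [vpτ_of_nonneg ht]; linarith

lemma vpτ_cont : Continuous vpτ := by unfold vpτ; fun_prop

lemma vp_minsq_deriv (t : ℝ) : HasDerivAt (fun s : ℝ => (min s 0) ^ 2) (2 * min t 0) t := by
  rcases lt_trichotomy t 0 with h | h | h
  · rw [min_eq_left h.le]
    have : (fun s : ℝ => (min s 0) ^ 2) =ᶠ[𝓝 t] fun s => s ^ 2 := by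
      filter_upwards [Iio_mem_nhds h] with s hs
      rw [min_eq_left (le_of_lt hs)]
    refine HasDerivAt.congr_of_eventuallyEq ?_ this
    simpa using hasDerivAt_pow 2 t
  · subst h
    simp only [min_self, mul_zero]
    rw [hasDerivAt_iff_isLittleO_nhds_zero]
    simp only [zero_add, min_self, ne_eq, OfNat.ofNat_ne_zero, not_false_eq_true, zero_pow, sub_zero, smul_zero]
    have h1 : (fun h : ℝ => (min h 0) ^ 2) =O[𝓝 0] fun h : ℝ => h ^ 2 := by
      refine Asymptotics.IsBigO.of_bound 1 (Eventually.of_forall fun s => ?_)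
      simp only [norm_pow, one_mul, Real.norm_eq_abs, sq_abs]
      rcases le_total s 0 with h | h
      · rw [min_eq_left h]
      · rw [min_eq_right h]; simpa using sq_nonneg s
    refine h1.trans_isLittleO ?_
    simpa using Asymptotics.isLittleO_pow_pow (𝕜 := ℝ) (m := 1) (n := 2) (by norm_num)
  · rw [min_eq_right h.le]
    have : (fun s : ℝ => (min s 0) ^ 2) =ᶠ[𝓝 t] fun s => 0 := by
      filter_upwards [Ioi_mem_nhds h] with s hs
      rw [min_eq_right (le_of_lt hs)]; simp
    refine HasDerivAt.congr_of_eventuallyEq ?_ this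
    simpa using hasDerivAt_const t (0:ℝ)

lemma vpτ_deriv (t : ℝ) : HasDerivAt vpτ (1 + 2 * min t 0) t := by
  unfold vpτ
  exact ((hasDerivAt_id t).const_add 1).add (vp_minsq_deriv t)

lemma vpτ_deriv' {t : ℝ} (ht : 0 ≤ t) : HasDerivAt vpτ 1 t := by
  have := vpτ_deriv t
  rw [min_eq_right ht] at this
  simpa using this

lemma vpτ_contDiff : ContDiff ℝ 1 vpτ := by
  rw [contDiff_one_iff_deriv]
  refine ⟨fun t => (vpτ_deriv t).differentiableAt, ?_⟩
  have : deriv vpτ = fun t => 1 + 2 * min t 0 := funext fun t => (vpτ_deriv t).deriv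
  rw [this]; fun_prop

end Tau

section Vpb

/-- phase-space field in the scaled variables -/
def vpb (F : ℝ → E3 → E3) (t : ℝ) (z : Z3) : Z3 := ((vpτ t ^ 2)⁻¹ • z.2, (vpτ t)⁻¹ • F t z.1)

/-- its derivative -/
def vpdb (dF : ℝ → E3 → E3 →L[ℝ] E3) (t : ℝ) (z : Z3) : Z3 →L[ℝ] Z3 :=
  ((vpτ t ^ 2)⁻¹ • ContinuousLinearMap.snd ℝ E3 E3).prod
    ((vpτ t)⁻¹ • (dF t z.1).comp (ContinuousLinearMap.fst ℝ E3 E3))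

lemma vpτ_inv_le (t : ℝ) : (vpτ t)⁻¹ ≤ 2 := by
  have := vpτ_ge t
  rw [inv_le_comm₀ (vpτ_pos t) (by norm_num)]; linarith

lemma vpτ_inv_cont : Continuous fun t => (vpτ t)⁻¹ := vpτ_cont.inv₀ fun t => (vpτ_pos t).ne'

lemma vpτ_inv2_cont : Continuous fun t => (vpτ t ^ 2)⁻¹ := (vpτ_cont.pow 2).inv₀ fun t => (pow_pos (vpτ_pos t) 2).ne'

lemma vpτ_inv2_le (t : ℝ) : (vpτ t ^ 2)⁻¹ ≤ 4 := by
  have h := vpτ_inv_le t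
  have h0 : 0 ≤ (vpτ t)⁻¹ := inv_nonneg.mpr (vpτ_pos t).le
  rw [← inv_pow]; nlinarith

variable {F : ℝ → E3 → E3} {dF : ℝ → E3 → E3 →L[ℝ] E3}

lemma vpb_ok (hF : VPOk F) : VPOk (vpb F) where
  lip T := by
    obtain ⟨K, hK0, hK⟩ := hF.lip' T
    refine ⟨max 4 (2 * K), fun t ht x y => ?_⟩
    unfold vpb
    have h1 := norm_fst_le (x - y)
    have h2 := norm_snd_le (x - y)
    have hp := inv_nonneg.mpr (vpτ_pos t).le
    have hp2 : 0 ≤ (vpτ t ^ 2)⁻¹ := by have := vpτ_pos t; positivity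
    rw [Prod.mk_sub_mk, ← smul_sub, ← smul_sub, Prod.norm_mk, norm_smul, norm_smul, Real.norm_of_nonneg hp,
      Real.norm_of_nonneg hp2]
    refine max_le ?_ ?_
    · calc _ ≤ 4 * ‖x - y‖ := by gcongr; exacts [vpτ_inv2_le t, h2]
        _ ≤ _ := by gcongr; exact le_max_left _ _
    · calc _ ≤ 2 * (K * ‖x - y‖) := by
            gcongr
            · exact vpτ_inv_le t
            · refine (hK t ht _ _).trans ?_
              gcongr
              exact h1
        _ = (2 * K) * ‖x - y‖ := by ring
        _ ≤ _ := by gcongr; exact le_max_right _ _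
  cont x := by
    unfold vpb
    exact (vpτ_inv2_cont.smul continuous_const).prodMk (vpτ_inv_cont.smul (hF.cont _))

lemma vpb_ok1 (hF : VPOk1 F dF) : VPOk1 (vpb F) (vpdb dF) where
  ok := vpb_ok hF.ok
  bc := by
    unfold vpb
    have h1 : Continuous fun q : ℝ × Z3 => F q.1 q.2.1 :=
      hF.bc.comp (continuous_fst.prodMk (continuous_fst.comp continuous_snd))
    exact ((vpτ_inv2_cont.comp continuous_fst).smul (continuous_snd.comp continuous_snd)).prodMk
      ((vpτ_inv_cont.comp continuous_fst).smul h1)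
  der t x := by
    unfold vpb vpdb
    refine HasFDerivAt.prodMk ?_ ?_
    · exact (hasFDerivAt_snd (𝕜 := ℝ) (E := E3) (F := E3) (p := x)).const_smul ((vpτ t ^ 2)⁻¹)
    · exact HasFDerivAt.const_smul (f := fun z : Z3 => F t z.1)
        ((hF.der t x.1).comp x (hasFDerivAt_fst (𝕜 := ℝ) (E := E3) (F := E3) (p := x))) ((vpτ t)⁻¹)
  dc := by
    unfold vpdb
    have h1 : Continuous fun q : ℝ × Z3 => dF q.1 q.2.1 :=
      hF.dc.comp (continuous_fst.prodMk (continuous_fst.comp continuous_snd))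
    have h2 : Continuous fun q : ℝ × Z3 => (vpτ q.1 ^ 2)⁻¹ • ContinuousLinearMap.snd ℝ E3 E3 :=
      (vpτ_inv2_cont.comp continuous_fst).smul continuous_const
    have h3 : Continuous fun q : ℝ × Z3 => (vpτ q.1)⁻¹ • (dF q.1 q.2.1).comp (ContinuousLinearMap.fst ℝ E3 E3) :=
      (vpτ_inv_cont.comp continuous_fst).smul (h1.clm_comp continuous_const)
    exact (ContinuousLinearMap.prodₗᵢ (𝕜 := ℝ) (E := Z3) (F := E3) (G := E3) ℝ).continuous.comp (h2.prodMk h3)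

instance vpHaar : (volume : Measure Z3).IsAddHaarMeasure :=
  inferInstanceAs (((volume : Measure E3).prod (volume : Measure E3)).IsAddHaarMeasure)

lemma vpb_mp (hF : VPOk1 F dF) (t : ℝ) :
    MeasurePreserving (fun y : Z3 => vpSol (vpb F) 0 y t) volume volume := by
  set e := (EuclideanSpace.basisFun (Fin 3) ℝ).toBasis
  refine vpFlow_mp volume (e.prod e) (vpb_ok1 hF) ?_ t
  rintro t x (i | i)
  · simp [vpdb]
  · simp [vpdb]

end Vpb


section ParamInt
variable {Y : Type*} [TopologicalSpace Y] [MeasurableSpace Y] [OpensMeasurableSpace Y] [SecondCountableTopology Y]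
  {μ : Measure Y} [IsLocallyFiniteMeasure μ]
  {V : Type*} [NormedAddCommGroup V] [NormedSpace ℝ V]

lemma vp_int_wF {w : Y → ℝ} (hw : Continuous w) (hwc : HasCompactSupport w) {F : Y → V} (hF : Continuous F) :
    Integrable (fun y => w y • F y) μ := by
  apply Continuous.integrable_of_hasCompactSupport (hw.smul hF)
  exact hwc.smul_right

lemma vp_cpi {X : Type*} [TopologicalSpace X] [FirstCountableTopology X] [LocallyCompactSpace X]
    {w : Y → ℝ} (hw : Continuous w) (hwc : HasCompactSupport w) {F : X → Y → V} (hF : Continuous (fun q : X × Y => F q.1 q.2)) :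
    Continuous (fun x => ∫ y, w y • F x y ∂μ) := by
  have h1 : ∀ x, ∫ y, w y • F x y ∂μ = ∫ y in tsupport w, w y • F x y ∂μ := by
    intro x
    rw [setIntegral_eq_integral_of_forall_compl_eq_zero]
    intro y hy
    rw [image_eq_zero_of_notMem_tsupport hy, zero_smul]
  simp_rw [h1]
  refine continuous_parametric_integral_of_continuous (f := fun x y => w y • F x y) ?_ hwc
  exact (hw.comp continuous_snd).smul hF

lemma vp_dpi {X : Type*} [NormedAddCommGroup X] [NormedSpace ℝ X] [ProperSpace X]
    {w : Y → ℝ} (hw : Continuous w) (hwc : HasCompactSupport w) {F : X → Y → V} {F' : X → Y → X →L[ℝ] V}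
    (hF : ∀ x, Continuous (F x)) (hF' : Continuous (fun q : X × Y => F' q.1 q.2))
    (hd : ∀ x y, HasFDerivAt (fun x => F x y) (F' x y) x) (x₀ : X) :
    HasFDerivAt (fun x => ∫ y, w y • F x y ∂μ) (∫ y, w y • F' x₀ y ∂μ) x₀ := by
  have hcp : IsCompact (Metric.closedBall x₀ 1 ×ˢ tsupport w) := (isCompact_closedBall x₀ 1).prod hwc
  obtain ⟨C, hC⟩ := hcp.exists_bound_of_continuousOn hF'.continuousOn
  refine hasFDerivAt_integral_of_dominated_of_fderiv_le (𝕜 := ℝ) (F := fun x y => w y • F x y)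
    (F' := fun x y => w y • F' x y) (bound := fun y => ‖w y‖ * C)
    (Metric.ball_mem_nhds x₀ one_pos) ?_ ?_ ?_ ?_ ?_ ?_
  · exact Eventually.of_forall fun x => (vp_int_wF hw hwc (hF x)).aestronglyMeasurable
  · exact vp_int_wF hw hwc (hF x₀)
  · exact (vp_int_wF hw hwc (hF'.comp (continuous_const.prodMk continuous_id) : Continuous fun y => F' x₀ y)).aestronglyMeasurable
  · refine Eventually.of_forall fun y x hx => ?_
    rw [norm_smul]
    by_cases hy : y ∈ tsupport w
    · gcongr
      exact hC (x, y) ⟨Metric.ball_subset_closedBall hx, hy⟩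
    · rw [image_eq_zero_of_notMem_tsupport hy]; simp
  · have : Integrable w μ := hw.integrable_of_hasCompactSupport hwc
    exact this.norm.mul_const C
  · exact Eventually.of_forall fun y x hx => (hd x y).const_smul (w y)

lemma vp_dpi1 
    {w : Y → ℝ} (hw : Continuous w) (hwc : HasCompactSupport w) {F : ℝ → Y → V} {F' : ℝ → Y → V}
    (hF : ∀ x, Continuous (F x)) (hF' : Continuous (fun q : ℝ × Y => F' q.1 q.2))
    (hd : ∀ x y, HasDerivAt (fun x => F x y) (F' x y) x) (x₀ : ℝ) :
    HasDerivAt (fun x => ∫ y, w y • F x y ∂μ) (∫ y, w y • F' x₀ y ∂μ) x₀ := by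
  have hcp : IsCompact (Metric.closedBall x₀ 1 ×ˢ tsupport w) := (isCompact_closedBall x₀ 1).prod hwc
  obtain ⟨C, hC⟩ := hcp.exists_bound_of_continuousOn hF'.continuousOn
  refine (hasDerivAt_integral_of_dominated_loc_of_deriv_le (𝕜 := ℝ) (F := fun x y => w y • F x y)
    (F' := fun x y => w y • F' x y) (bound := fun y => ‖w y‖ * C)
    (Metric.ball_mem_nhds x₀ one_pos) ?_ ?_ ?_ ?_ ?_ ?_).2
  · exact Eventually.of_forall fun x => (vp_int_wF hw hwc (hF x)).aestronglyMeasurable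
  · exact vp_int_wF hw hwc (hF x₀)
  · exact (vp_int_wF hw hwc (hF'.comp (continuous_const.prodMk continuous_id) : Continuous fun y => F' x₀ y)).aestronglyMeasurable
  · refine Eventually.of_forall fun y x hx => ?_
    rw [norm_smul]
    by_cases hy : y ∈ tsupport w
    · gcongr
      exact hC (x, y) ⟨Metric.ball_subset_closedBall hx, hy⟩
    · rw [image_eq_zero_of_notMem_tsupport hy]; simp
  · have : Integrable w μ := hw.integrable_of_hasCompactSupport hwc
    exact this.norm.mul_const C
  · exact Eventually.of_forall fun y x hx => (hd x y).const_smul (w y)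

end ParamInt

section Reg

lemma vpk_lip (δ : ℝ) (hδ : 0 < δ) (x y : E3) : ‖vpk δ x - vpk δ y‖ ≤ 4 * δ⁻¹ ^ 3 * ‖x - y‖ := by
  refine Convex.norm_image_sub_le_of_norm_hasFDerivWithin_le (𝕜 := ℝ) (s := univ) (f' := vpdk δ)
    (fun z _ => (vpk_hasFDerivAt δ hδ z).hasFDerivWithinAt) (fun z _ => ?_) convex_univ (mem_univ y) (mem_univ x)
  refine (vpdk_norm_le δ z).trans ?_
  gcongr
  · exact vph_nonneg _ _
  · exact vph_le_inv δ z hδ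

/-- regularised solution data -/
structure VPReg (g : Z3 → ℝ) (δ : ℝ) (F : ℝ → E3 → E3) (dF : ℝ → E3 → E3 →L[ℝ] E3) : Prop where
  ok1 : VPOk1 F dF
  self : ∀ t, 0 ≤ t → ∀ x, F t x = ∫ z, g z • vpk δ (x - (vpSol (vpb F) 0 z t).1)

variable {g : Z3 → ℝ} {δ : ℝ}

/-- field generated by particles at `Ξ` -/
def vpFld (g : Z3 → ℝ) (δ : ℝ) (Ξ : ℝ → Z3 → E3) (t : ℝ) (x : E3) : E3 := ∫ z, g z • vpk δ (x - Ξ t z)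

/-- its derivative -/
def vpdFld (g : Z3 → ℝ) (δ : ℝ) (Ξ : ℝ → Z3 → E3) (t : ℝ) (x : E3) : E3 →L[ℝ] E3 := ∫ z, g z • vpdk δ (x - Ξ t z)

lemma vp_fieldok (hg : Continuous g) (hgc : HasCompactSupport g) (hδ : 0 < δ)
    (Ξ : ℝ → Z3 → E3) (hΞ : Continuous fun q : ℝ × Z3 => Ξ q.1 q.2) :
    VPOk1 (vpFld g δ Ξ) (vpdFld g δ Ξ) := by
  have hgi : Integrable g := hg.integrable_of_hasCompactSupport hgc
  have hc1 : Continuous fun q : (ℝ × E3) × Z3 => q.1.2 - Ξ q.1.1 q.2 := by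
    have : Continuous fun q : (ℝ × E3) × Z3 => Ξ q.1.1 q.2 := hΞ.comp (by fun_prop : Continuous fun q : (ℝ × E3) × Z3 => (q.1.1, q.2))
    exact (continuous_snd.comp continuous_fst).sub this
  have hcz : ∀ t x, Continuous fun z => vpk δ (x - Ξ t z) := fun t x =>
    (vpk_cont δ hδ).comp (hc1.comp (by fun_prop : Continuous fun z : Z3 => ((t, x), z)))
  have hbc : Continuous (fun q : ℝ × E3 => vpFld g δ Ξ q.1 q.2) :=
    vp_cpi (F := fun (q : ℝ × E3) z => vpk δ (q.2 - Ξ q.1 z)) hg hgc ((vpk_cont δ hδ).comp hc1)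
  refine ⟨⟨fun T => ⟨(∫ z, ‖g z‖) * (4 * δ⁻¹ ^ 3), fun t _ x y => ?_⟩, fun x => ?_⟩, hbc, ?_, ?_⟩
  · unfold vpFld
    rw [← integral_sub (vp_int_wF hg hgc (hcz t x)) (vp_int_wF hg hgc (hcz t y))]
    rw [mul_assoc, ← integral_mul_const]
    refine norm_integral_le_of_norm_le (hgi.norm.mul_const _) (Eventually.of_forall fun z => ?_)
    rw [← smul_sub, norm_smul]
    gcongr
    have := vpk_lip δ hδ (x - Ξ t z) (y - Ξ t z)
    rwa [sub_sub_sub_cancel_right] at this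
  · have h : Continuous fun t : ℝ => (t, x) := by fun_prop
    have h2 := hbc.comp h
    exact h2
  · intro t x
    refine vp_dpi (F := fun x z => vpk δ (x - Ξ t z)) (F' := fun x z => vpdk δ (x - Ξ t z)) hg hgc (hcz t) ?_ ?_ x
    · exact (vpdk_cont δ hδ).comp (hc1.comp (by fun_prop : Continuous fun q : E3 × Z3 => ((t, q.1), q.2)))
    · intro x z
      have := (vpk_hasFDerivAt δ hδ (x - Ξ t z)).comp x ((hasFDerivAt_id x).sub_const (Ξ t z))
      simpa [Function.comp_def] using this
  · exact vp_cpi (F := fun (q : ℝ × E3) z => vpdk δ (q.2 - Ξ q.1 z)) hg hgc ((vpdk_cont δ hδ).comp hc1)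

end Reg


section RegEx
open BoundedContinuousFunction
variable {g : Z3 → ℝ} {δ : ℝ}

/-- radial projection -/
def vpProj (R : ℝ) (z : Z3) : Z3 := (R / max R ‖z‖) • z

lemma vpProj_eq (R : ℝ) (hR : 0 < R) (z : Z3) (hz : ‖z‖ ≤ R) : vpProj R z = z := by
  unfold vpProj; rw [max_eq_left hz, div_self hR.ne', one_smul]

lemma vpProj_norm (R : ℝ) (hR : 0 < R) (z : Z3) : ‖vpProj R z‖ ≤ R := by
  unfold vpProj
  have h : 0 < max R ‖z‖ := lt_max_of_lt_left hR
  rw [norm_smul, Real.norm_of_nonneg (by positivity), div_mul_eq_mul_div, div_le_iff₀ h]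
  gcongr
  exact le_max_right _ _

lemma vpProj_cont (R : ℝ) (hR : 0 < R) : Continuous (vpProj R) := by
  unfold vpProj
  have : ∀ z : Z3, max R ‖z‖ ≠ 0 := fun z => (lt_max_of_lt_left hR).ne'
  fun_prop (disch := exact this _)

/-- one bounded function as the field along the particle cloud -/
def vpW (g : Z3 → ℝ) (δ : ℝ) (X : Z3 →ᵇ Z3) (x : E3) : E3 := ∫ z, g z • vpk δ (x - (X z).1)

lemma vpW_lip (hg : Continuous g) (hgc : HasCompactSupport g) (hδ : 0 < δ) (X X' : Z3 →ᵇ Z3) (x x' : E3) :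
    ‖vpW g δ X x - vpW g δ X' x'‖ ≤ (∫ z, ‖g z‖) * (4 * δ⁻¹ ^ 3) * (‖x - x'‖ + ‖X - X'‖) := by
  have hgi : Integrable g := hg.integrable_of_hasCompactSupport hgc
  have hcz : ∀ (X : Z3 →ᵇ Z3) x, Continuous fun z => vpk δ (x - (X z).1) := fun X x =>
    (vpk_cont δ hδ).comp (continuous_const.sub (continuous_fst.comp X.continuous))
  unfold vpW
  rw [← integral_sub (vp_int_wF hg hgc (hcz X x)) (vp_int_wF hg hgc (hcz X' x'))]
  rw [mul_assoc, ← integral_mul_const]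
  refine norm_integral_le_of_norm_le (hgi.norm.mul_const _) (Eventually.of_forall fun z => ?_)
  rw [← smul_sub, norm_smul]
  gcongr
  refine (vpk_lip δ hδ _ _).trans ?_
  gcongr
  have e : x - (X z).1 - (x' - (X' z).1) = (x - x') - ((X - X') z).1 := by
    simp; abel
  rw [e]
  refine (norm_sub_le _ _).trans ?_
  gcongr
  exact (norm_fst_le _).trans ((X - X').norm_coe_le_norm z)

lemma vpW_bd (hg : Continuous g) (hgc : HasCompactSupport g) (hδ : 0 < δ) (X : Z3 →ᵇ Z3) (x : E3) :
    ‖vpW g δ X x‖ ≤ (∫ z, ‖g z‖) * (δ ^ 2)⁻¹ := by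
  have hgi : Integrable g := hg.integrable_of_hasCompactSupport hgc
  unfold vpW
  rw [← integral_mul_const]
  refine norm_integral_le_of_norm_le (hgi.norm.mul_const _) (Eventually.of_forall fun z => ?_)
  rw [norm_smul]
  gcongr
  exact vpk_norm_le_delta δ _ hδ

/-- the Banach-space field -/
def vpB (hg : Continuous g) (hgc : HasCompactSupport g) (hδ : 0 < δ) (t : ℝ) (X : Z3 →ᵇ Z3) : Z3 →ᵇ Z3 :=
  BoundedContinuousFunction.ofNormedAddCommGroup
    (fun z => ((vpτ t ^ 2)⁻¹ • (X z).2, (vpτ t)⁻¹ • vpW g δ X (X z).1))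
    (by
      have h1 : Continuous (vpW g δ X) := by
        have : LipschitzWith ((∫ z, ‖g z‖) * (4 * δ⁻¹ ^ 3)).toNNReal (vpW g δ X) := by
          refine LipschitzWith.of_dist_le_mul fun x y => ?_
          rw [dist_eq_norm, dist_eq_norm, Real.coe_toNNReal _ (by positivity)]
          simpa using vpW_lip hg hgc hδ X X x y
        exact this.continuous
      have h2 := X.continuous
      exact ((continuous_snd.comp h2).const_smul ((vpτ t ^ 2)⁻¹)).prodMk
        ((h1.comp (continuous_fst.comp h2)).const_smul ((vpτ t)⁻¹)))
    (4 * ‖X‖ + 2 * ((∫ z, ‖g z‖) * (δ ^ 2)⁻¹))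
    (by
      intro z
      have hp := inv_nonneg.mpr (vpτ_pos t).le
      have hp2 : 0 ≤ (vpτ t ^ 2)⁻¹ := by have := vpτ_pos t; positivity
      have hW := vpW_bd hg hgc hδ X (X z).1
      have hI : 0 ≤ (∫ z, ‖g z‖) * (δ ^ 2)⁻¹ := by positivity
      rw [Prod.norm_mk, norm_smul, norm_smul, Real.norm_of_nonneg hp, Real.norm_of_nonneg hp2]
      have hX := (norm_snd_le (X z)).trans (X.norm_coe_le_norm z)
      refine max_le ?_ ?_
      · calc _ ≤ 4 * ‖X‖ := by gcongr; exact vpτ_inv2_le t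
          _ ≤ _ := by linarith
      · calc _ ≤ 2 * ((∫ z, ‖g z‖) * (δ ^ 2)⁻¹) := by gcongr; exact vpτ_inv_le t
          _ ≤ _ := by linarith [norm_nonneg X])

lemma vpB_apply (hg : Continuous g) (hgc : HasCompactSupport g) (hδ : 0 < δ) (t : ℝ) (X : Z3 →ᵇ Z3) (z : Z3) :
    vpB hg hgc hδ t X z = ((vpτ t ^ 2)⁻¹ • (X z).2, (vpτ t)⁻¹ • vpW g δ X (X z).1) := rfl

lemma vpB_ok (hg : Continuous g) (hgc : HasCompactSupport g) (hδ : 0 < δ) : VPOk (vpB hg hgc hδ) where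
  lip T := by
    set A := (∫ z, ‖g z‖) * (4 * δ⁻¹ ^ 3) with hA
    have hA0 : 0 ≤ A := by positivity
    refine ⟨4 + 4 * A, fun t _ X X' => ?_⟩
    rw [BoundedContinuousFunction.norm_le (by positivity)]
    intro z
    rw [BoundedContinuousFunction.sub_apply, vpB_apply, vpB_apply]
    have hp := inv_nonneg.mpr (vpτ_pos t).le
    have hp2 : 0 ≤ (vpτ t ^ 2)⁻¹ := by have := vpτ_pos t; positivity
    rw [Prod.mk_sub_mk, ← smul_sub, ← smul_sub, Prod.norm_mk, norm_smul, norm_smul, Real.norm_of_nonneg hp,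
      Real.norm_of_nonneg hp2]
    have hz := (X - X').norm_coe_le_norm z
    rw [BoundedContinuousFunction.sub_apply] at hz
    have h1 : ‖(X z).1 - (X' z).1‖ ≤ ‖X - X'‖ := (norm_fst_le (X z - X' z)).trans hz
    have h2 : ‖(X z).2 - (X' z).2‖ ≤ ‖X - X'‖ := (norm_snd_le (X z - X' z)).trans hz
    refine max_le ?_ ?_
    · calc _ ≤ 4 * ‖X - X'‖ := by gcongr; exact vpτ_inv2_le t
        _ ≤ _ := by nlinarith [norm_nonneg (X - X'), mul_nonneg hA0 (norm_nonneg (X - X'))]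
    · calc _ ≤ 2 * (A * (‖X - X'‖ + ‖X - X'‖)) := by
            gcongr
            · exact vpτ_inv_le t
            · refine (vpW_lip hg hgc hδ _ _ _ _).trans ?_
              gcongr
        _ ≤ _ := by nlinarith [norm_nonneg (X - X'), mul_nonneg hA0 (norm_nonneg (X - X'))]
  cont X := by
    set M := ‖X‖ + (∫ z, ‖g z‖) * (δ ^ 2)⁻¹ with hM
    have hI : 0 ≤ (∫ z, ‖g z‖) * (δ ^ 2)⁻¹ := by positivity
    have hM0 : 0 ≤ M := by positivity
    rw [continuous_iff_continuousAt]
    intro t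
    apply vp_cont_of_bound _ _ (fun s => (|(vpτ s ^ 2)⁻¹ - (vpτ t ^ 2)⁻¹| + |(vpτ s)⁻¹ - (vpτ t)⁻¹|) * M)
    swap
    · refine Eventually.of_forall fun s => ?_
      rw [BoundedContinuousFunction.norm_le (by positivity)]
      intro z
      rw [BoundedContinuousFunction.sub_apply, vpB_apply, vpB_apply]
      rw [Prod.mk_sub_mk, ← sub_smul, ← sub_smul, Prod.norm_mk, norm_smul, norm_smul]
      have hX := (norm_snd_le (X z)).trans (X.norm_coe_le_norm z)
      have hW := vpW_bd hg hgc hδ X (X z).1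
      simp only [Real.norm_eq_abs]
      have p1 := abs_nonneg ((vpτ s ^ 2)⁻¹ - (vpτ t ^ 2)⁻¹)
      have p2 := abs_nonneg ((vpτ s)⁻¹ - (vpτ t)⁻¹)
      refine max_le ?_ ?_
      · gcongr
        · linarith
        · linarith
      · gcongr
        · linarith
        · linarith [norm_nonneg X]
    · have h1 := vpτ_inv2_cont
      have h2 := vpτ_inv_cont
      have : Continuous (fun s => (|(vpτ s ^ 2)⁻¹ - (vpτ t ^ 2)⁻¹| + |(vpτ s)⁻¹ - (vpτ t)⁻¹|) * M) := by fun_prop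
      have h3 := this.tendsto t
      simpa using h3

theorem vp_reg_exists (hg : Continuous g) (hgc : HasCompactSupport g) (hδ : 0 < δ) :
    ∃ F dF, VPReg g δ F dF := by
  obtain ⟨R, hR, hRs⟩ : ∃ R : ℝ, 0 < R ∧ ∀ z ∈ tsupport g, ‖z‖ ≤ R := by
    obtain ⟨R, hR⟩ := hgc.isBounded.exists_norm_le
    exact ⟨|R| + 1, by positivity, fun z hz => (hR z hz).trans (by linarith [le_abs_self R])⟩
  set θ : Z3 →ᵇ Z3 := BoundedContinuousFunction.ofNormedAddCommGroup (vpProj R) (vpProj_cont R hR) R (vpProj_norm R hR)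
  have hok := vpB_ok hg hgc hδ
  set X : ℝ → (Z3 →ᵇ Z3) := vpSol (vpB hg hgc hδ) 0 θ with hX
  have hX0 : X 0 = θ := vpSol_self hok 0 θ
  have hXd : ∀ t, HasDerivAt X (vpB hg hgc hδ t (X t)) t := vpSol_deriv hok 0 θ
  have hXc : Continuous X := vpSol_continuous_t hok 0 θ
  set Ξ : ℝ → Z3 → E3 := fun t z => (X (max t 0) z).1 with hΞ
  have hΞc : Continuous fun q : ℝ × Z3 => Ξ q.1 q.2 := by
    have h1 : Continuous fun q : ℝ × Z3 => (X (max q.1 0), q.2) :=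
      (hXc.comp (continuous_fst.max continuous_const)).prodMk continuous_snd
    have h2 := (continuous_eval (F := Z3 →ᵇ Z3)).comp h1
    exact continuous_fst.comp h2
  have hF := vp_fieldok hg hgc hδ Ξ hΞc
  refine ⟨_, _, hF, ?_⟩
  intro t ht x
  unfold vpFld
  refine integral_congr_ae (Eventually.of_forall fun z => ?_)
  by_cases hz : z ∈ tsupport g
  swap
  · simp only [image_eq_zero_of_notMem_tsupport hz, zero_smul]
  suffices h : vpSol (vpb (vpFld g δ Ξ)) 0 z t = X t z by
    show g z • vpk δ (x - Ξ t z) = g z • vpk δ (x - (vpSol (vpb (vpFld g δ Ξ)) 0 z t).1)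
    rw [h, hΞ]
    simp only [max_eq_left ht]
  have hbok := vpb_ok hF.ok
  obtain ⟨K, hK0, hK⟩ := hbok.lip' t
  have hd : ∀ s, HasDerivAt (fun s => X s z) (vpB hg hgc hδ s (X s) z) s := fun s => by
    have := (hXd s)
    exact ((BoundedContinuousFunction.evalCLM ℝ z).hasFDerivAt.comp_hasDerivAt s this)
  have hgr := vp_gron0 (fun s => vpSol (vpb (vpFld g δ Ξ)) 0 z s - X s z)
    (fun s => vpb (vpFld g δ Ξ) s (vpSol (vpb (vpFld g δ Ξ)) 0 z s) - vpB hg hgc hδ s (X s) z) K 0 t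
    (fun s _ => (vpSol_deriv hbok 0 z s).sub (hd s)) ?_
  · have h0 : vpSol (vpb (vpFld g δ Ξ)) 0 z 0 - X 0 z = 0 := by
      rw [vpSol_self hbok, hX0, sub_eq_zero]
      exact (vpProj_eq R hR z (hRs z hz)).symm
    simp only [h0, norm_zero, zero_mul] at hgr
    exact sub_eq_zero.mp (norm_le_zero_iff.mp hgr)
  · intro s hs
    rw [uIcc_of_le ht] at hs
    have e : vpB hg hgc hδ s (X s) z = vpb (vpFld g δ Ξ) s (X s z) := by
      rw [vpB_apply]
      unfold vpb vpFld vpW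
      simp only [hΞ, max_eq_left hs.1]
    rw [e]
    refine hK s ?_ _ _
    rw [abs_of_nonneg hs.1]; exact hs.2

end RegEx


section Energy
open scoped InnerProductSpace
variable {g : Z3 → ℝ} {δ : ℝ} {F : ℝ → E3 → E3} {dF : ℝ → E3 → E3 →L[ℝ] E3}

/-- forward flow -/
def vpX (F : ℝ → E3 → E3) (t : ℝ) (z : Z3) : Z3 := vpSol (vpb F) 0 z t

lemma vpX_zero (hF : VPOk F) (z : Z3) : vpX F 0 z = z := vpSol_self (vpb_ok hF) 0 z

lemma vpX_cont (hF : VPOk F) : Continuous fun q : ℝ × Z3 => vpX F q.1 q.2 := vpFlow_cont (vpb_ok hF)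

lemma vpX_deriv (hF : VPOk F) (t : ℝ) (z : Z3) :
    HasDerivAt (fun s => vpX F s z) (vpb F t (vpX F t z)) t := vpSol_deriv (vpb_ok hF) 0 z t

lemma vpX_deriv1 (hF : VPOk F) (t : ℝ) (z : Z3) :
    HasDerivAt (fun s => (vpX F s z).1) ((vpτ t ^ 2)⁻¹ • (vpX F t z).2) t := by
  have h := (ContinuousLinearMap.fst ℝ E3 E3).hasFDerivAt.comp_hasDerivAt t (vpX_deriv hF t z)
  exact h

lemma vpX_deriv2 (hF : VPOk F) (t : ℝ) (z : Z3) :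
    HasDerivAt (fun s => (vpX F s z).2) ((vpτ t)⁻¹ • F t (vpX F t z).1) t := by
  have h := (ContinuousLinearMap.snd ℝ E3 E3).hasFDerivAt.comp_hasDerivAt t (vpX_deriv hF t z)
  exact h

lemma vpX_mp (hF : VPOk1 F dF) (t : ℝ) : MeasurePreserving (vpX F t) volume volume := vpb_mp hF t

lemma vpReg_self (h : VPReg g δ F dF) (t : ℝ) (ht : 0 ≤ t) (x : E3) :
    F t x = ∫ z, g z • vpk δ (x - (vpX F t z).1) := h.self t ht x

/-- interaction power -/
def vpD (g : Z3 → ℝ) (δ : ℝ) (F : ℝ → E3 → E3) (t : ℝ) : ℝ :=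
  ∫ q : Z3 × Z3, (g q.1 * g q.2) • ⟪vpk δ ((vpX F t q.1).1 - (vpX F t q.2).1), (vpX F t q.1).2⟫_ℝ

/-- kinetic part -/
def vpK (g : Z3 → ℝ) (F : ℝ → E3 → E3) (t : ℝ) : ℝ := ∫ z : Z3, g z • ‖(vpX F t z).2‖ ^ 2

/-- potential part -/
def vpU (g : Z3 → ℝ) (δ : ℝ) (F : ℝ → E3 → E3) (t : ℝ) : ℝ :=
  ∫ q : Z3 × Z3, (g q.1 * g q.2) • vph δ ((vpX F t q.1).1 - (vpX F t q.2).1)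

lemma vp_ggc (hg : Continuous g) : Continuous fun q : Z3 × Z3 => g q.1 * g q.2 :=
  (hg.comp continuous_fst).mul (hg.comp continuous_snd)

lemma vp_ggs (hgc : HasCompactSupport g) : HasCompactSupport fun q : Z3 × Z3 => g q.1 * g q.2 := by
  refine HasCompactSupport.intro (K := tsupport g ×ˢ tsupport g) (hgc.prod hgc) ?_
  rintro ⟨a, b⟩ h
  rw [mem_prod, not_and_or] at h
  rcases h with h | h
  · simp [image_eq_zero_of_notMem_tsupport h]
  · simp [image_eq_zero_of_notMem_tsupport h]

lemma vp_Ycont (hF : VPOk F) : Continuous fun q : ℝ × (Z3 × Z3) => (vpX F q.1 q.2.1).1 - (vpX F q.1 q.2.2).1 := by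
  have h := vpX_cont hF
  have h1 := continuous_fst.comp (h.comp (by fun_prop : Continuous fun q : ℝ × (Z3 × Z3) => (q.1, q.2.1)))
  have h2 := continuous_fst.comp (h.comp (by fun_prop : Continuous fun q : ℝ × (Z3 × Z3) => (q.1, q.2.2)))
  exact h1.sub h2

lemma vp_Pcont1 (hF : VPOk F) : Continuous fun q : ℝ × (Z3 × Z3) => (vpX F q.1 q.2.1).2 := by
  have h := vpX_cont hF
  have h1 := continuous_snd.comp (h.comp (by fun_prop : Continuous fun q : ℝ × (Z3 × Z3) => (q.1, q.2.1)))
  exact h1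

lemma vp_Pcont2 (hF : VPOk F) : Continuous fun q : ℝ × (Z3 × Z3) => (vpX F q.1 q.2.2).2 := by
  have h := vpX_cont hF
  have h1 := continuous_snd.comp (h.comp (by fun_prop : Continuous fun q : ℝ × (Z3 × Z3) => (q.1, q.2.2)))
  exact h1

lemma vp_tcont {V : Type*} [TopologicalSpace V] {f : ℝ × (Z3 × Z3) → V} (hf : Continuous f) (t : ℝ) :
    Continuous fun q : Z3 × Z3 => f (t, q) := by
  have h := hf.comp (by fun_prop : Continuous fun q : Z3 × Z3 => (t, q))
  exact h

lemma vpU_deriv (hδ : 0 < δ) (hg : Continuous g) (hgc : HasCompactSupport g) (h : VPReg g δ F dF) (t : ℝ) :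
    HasDerivAt (vpU g δ F) (-(2 * (vpτ t ^ 2)⁻¹ * vpD g δ F t)) t := by
  have hF := h.ok1.ok
  have hY := vp_Ycont hF
  have hk : Continuous fun q : ℝ × (Z3 × Z3) => vpk δ ((vpX F q.1 q.2.1).1 - (vpX F q.1 q.2.2).1) :=
    (vpk_cont δ hδ).comp hY
  have hP1 := vp_Pcont1 hF
  have hP2 := vp_Pcont2 hF
  have key := vp_dpi1 (μ := (volume : Measure (Z3 × Z3))) (vp_ggc hg) (vp_ggs hgc)
    (F := fun t q => vph δ ((vpX F t q.1).1 - (vpX F t q.2).1))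
    (F' := fun t q => - ((vpτ t ^ 2)⁻¹ * ⟪vpk δ ((vpX F t q.1).1 - (vpX F t q.2).1), (vpX F t q.1).2 - (vpX F t q.2).2⟫_ℝ))
    (fun s => vp_tcont ((vph_cont δ hδ).comp hY) s)
    (by
      have hτ := vpτ_inv2_cont.comp (continuous_fst : Continuous (Prod.fst : ℝ × (Z3 × Z3) → ℝ))
      exact (hτ.mul (hk.inner (𝕜 := ℝ) (hP1.sub hP2))).neg)
    (by
      intro s q
      have h1 := (vpX_deriv1 hF s q.1).sub (vpX_deriv1 hF s q.2)
      have h2 := (vph_hasFDerivAt δ hδ ((vpX F s q.1).1 - (vpX F s q.2).1)).comp_hasDerivAt s h1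
      refine h2.congr_deriv ?_
      rw [← smul_sub]
      simp only [vpk, ContinuousLinearMap.smul_apply, innerSL_apply_apply, inner_smul_right, inner_smul_left, smul_eq_mul]
      simp
      ring) t
  refine key.congr_deriv ?_
  have hi1 : Integrable (fun q : Z3 × Z3 => (g q.1 * g q.2) • ⟪vpk δ ((vpX F t q.1).1 - (vpX F t q.2).1), (vpX F t q.1).2⟫_ℝ) :=
    vp_int_wF (vp_ggc hg) (vp_ggs hgc) (vp_tcont (hk.inner (𝕜 := ℝ) hP1) t)
  have hi2 : Integrable (fun q : Z3 × Z3 => (g q.1 * g q.2) • ⟪vpk δ ((vpX F t q.1).1 - (vpX F t q.2).1), (vpX F t q.2).2⟫_ℝ) :=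
    vp_int_wF (vp_ggc hg) (vp_ggs hgc) (vp_tcont (hk.inner (𝕜 := ℝ) hP2) t)
  have hsw : ∫ q : Z3 × Z3, (g q.1 * g q.2) • ⟪vpk δ ((vpX F t q.1).1 - (vpX F t q.2).1), (vpX F t q.2).2⟫_ℝ = - vpD g δ F t := by
    unfold vpD
    rw [Measure.volume_eq_prod, ← integral_prod_swap, ← integral_neg]
    refine integral_congr_ae (Eventually.of_forall fun q => ?_)
    simp only [Prod.fst_swap, Prod.snd_swap]
    rw [← neg_sub, vpk_neg, inner_neg_left, mul_comm, smul_neg]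
  calc _ = ∫ q : Z3 × Z3, (-(vpτ t ^ 2)⁻¹) * ((g q.1 * g q.2) • ⟪vpk δ ((vpX F t q.1).1 - (vpX F t q.2).1), (vpX F t q.1).2⟫_ℝ
          - (g q.1 * g q.2) • ⟪vpk δ ((vpX F t q.1).1 - (vpX F t q.2).1), (vpX F t q.2).2⟫_ℝ) := by
        refine integral_congr_ae (Eventually.of_forall fun q => ?_)
        simp only [inner_sub_right, smul_eq_mul]
        ring
    _ = (-(vpτ t ^ 2)⁻¹) * (vpD g δ F t - (- vpD g δ F t)) := by
        rw [integral_const_mul, integral_sub hi1 hi2, hsw]; rfl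
    _ = _ := by ring

lemma vpD_eq (hδ : 0 < δ) (hg : Continuous g) (hgc : HasCompactSupport g) (h : VPReg g δ F dF) (t : ℝ) (ht : 0 ≤ t) :
    vpD g δ F t = ∫ z, g z • ⟪F t (vpX F t z).1, (vpX F t z).2⟫_ℝ := by
  have hF := h.ok1.ok
  have hY := vp_Ycont hF
  have hk : Continuous fun q : ℝ × (Z3 × Z3) => vpk δ ((vpX F q.1 q.2.1).1 - (vpX F q.1 q.2.2).1) :=
    (vpk_cont δ hδ).comp hY
  have hi1 : Integrable (fun q : Z3 × Z3 => (g q.1 * g q.2) • ⟪vpk δ ((vpX F t q.1).1 - (vpX F t q.2).1), (vpX F t q.1).2⟫_ℝ) :=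
    vp_int_wF (vp_ggc hg) (vp_ggs hgc) (vp_tcont (hk.inner (𝕜 := ℝ) (vp_Pcont1 hF)) t)
  unfold vpD
  rw [Measure.volume_eq_prod] at hi1 ⊢
  rw [integral_prod _ hi1]
  refine integral_congr_ae (Eventually.of_forall fun z => ?_)
  simp only
  rw [vpReg_self h t ht]
  have hint : Integrable fun z' => g z' • vpk δ ((vpX F t z).1 - (vpX F t z').1) :=
    vp_int_wF hg hgc (by
      have h2 := (vp_tcont hk t).comp (by fun_prop : Continuous fun z' : Z3 => (z, z'))
      exact h2)
  rw [real_inner_comm, ← integral_inner hint, ← integral_smul]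
  refine integral_congr_ae (Eventually.of_forall fun z' => ?_)
  simp only [inner_smul_right, smul_eq_mul]
  rw [real_inner_comm]; ring

lemma vpK_deriv (hδ : 0 < δ) (hg : Continuous g) (hgc : HasCompactSupport g) (h : VPReg g δ F dF) (t : ℝ) (ht : 0 ≤ t) :
    HasDerivAt (vpK g F) (2 * (vpτ t)⁻¹ * vpD g δ F t) t := by
  have hF := h.ok1.ok
  have hX := vpX_cont hF
  have key := vp_dpi1 (μ := (volume : Measure Z3)) hg hgc
    (F := fun t z => ‖(vpX F t z).2‖ ^ 2)
    (F' := fun t z => 2 * ⟪(vpX F t z).2, (vpτ t)⁻¹ • F t (vpX F t z).1⟫_ℝ)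
    (by
      intro s
      have h1 := (continuous_snd.comp hX).comp (by fun_prop : Continuous fun z : Z3 => (s, z))
      exact h1.norm.pow 2)
    (by
      have h1 : Continuous fun q : ℝ × Z3 => (vpX F q.1 q.2).2 := continuous_snd.comp hX
      have h2 : Continuous fun q : ℝ × Z3 => F q.1 (vpX F q.1 q.2).1 :=
        h.ok1.bc.comp (continuous_fst.prodMk (continuous_fst.comp hX))
      have h3 : Continuous fun q : ℝ × Z3 => (vpτ q.1)⁻¹ := vpτ_inv_cont.comp continuous_fst
      exact continuous_const.mul (h1.inner (𝕜 := ℝ) (h3.smul h2)))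
    (by
      intro s z
      exact (vpX_deriv2 hF s z).norm_sq) t
  refine key.congr_deriv ?_
  rw [vpD_eq hδ hg hgc h t ht, ← integral_const_mul]
  refine integral_congr_ae (Eventually.of_forall fun z => ?_)
  simp only [inner_smul_right, smul_eq_mul]
  rw [real_inner_comm]
  ring

lemma vp_energy (hδ : 0 < δ) (hg : Continuous g) (hgc : HasCompactSupport g) (hg0 : ∀ z, 0 ≤ g z)
    (h : VPReg g δ F dF) (t : ℝ) (ht : 0 ≤ t) :
    vpK g F t ≤ vpτ t * (vpK g F 0 + vpU g δ F 0) := by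
  have hK0 : ∀ t, 0 ≤ vpK g F t := fun t => integral_nonneg fun z => mul_nonneg (hg0 z) (sq_nonneg _)
  have hU0 : ∀ t, 0 ≤ vpU g δ F t := fun t => integral_nonneg fun z =>
    mul_nonneg (mul_nonneg (hg0 _) (hg0 _)) (vph_nonneg _ _)
  have hd : ∀ s, 0 ≤ s → HasDerivAt (fun s => (vpK g F s + vpτ s * vpU g δ F s) * (vpτ s)⁻¹)
      (- (vpK g F s * (vpτ s ^ 2)⁻¹)) s := by
    intro s hs
    have hτ := (vpτ_pos s).ne'
    have h1 := ((vpK_deriv hδ hg hgc h s hs).add ((vpτ_deriv' hs).mul (vpU_deriv hδ hg hgc h s))).mul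
      ((vpτ_deriv' hs).inv hτ)
    refine h1.congr_deriv ?_
    simp
    field_simp
    ring
  have hanti : AntitoneOn (fun s => (vpK g F s + vpτ s * vpU g δ F s) * (vpτ s)⁻¹) (Ici 0) := by
    refine antitoneOn_of_deriv_nonpos (convex_Ici 0) (fun s hs => (hd s hs).continuousAt.continuousWithinAt)
      (fun s hs => ?_) (fun s hs => ?_)
    · rw [interior_Ici] at hs
      exact (hd s (le_of_lt hs)).differentiableAt.differentiableWithinAt
    · rw [interior_Ici] at hs
      rw [(hd s (le_of_lt hs)).deriv]
      have := hK0 s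
      have := vpτ_pos s
      simp only [Left.neg_nonpos_iff]; positivity
  have h1 := hanti (mem_Ici.mpr le_rfl) (mem_Ici.mpr ht) ht
  have hτ := vpτ_pos t
  simp only [vpτ_of_nonneg le_rfl] at h1
  rw [← div_eq_mul_inv, div_le_iff₀ hτ] at h1
  have := mul_nonneg hτ.le (hU0 t)
  calc _ ≤ _ := by linarith
    _ ≤ _ := h1
    _ = _ := by simp; ring


lemma vp_normint_le {Y : Type*} [MeasurableSpace Y] {μ : Measure Y} {V : Type*} [NormedAddCommGroup V] [NormedSpace ℝ V]
    {f : Y → V} {C : ℝ} (hC : 0 ≤ C) (h : ∫⁻ y, ENNReal.ofReal ‖f y‖ ∂μ ≤ ENNReal.ofReal C) : ‖∫ y, f y ∂μ‖ ≤ C := by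
  refine (norm_integral_le_lintegral_norm f).trans ?_
  exact ENNReal.toReal_le_of_le_ofReal hC h

lemma vp_A1h (δ s : ℝ) (hs : 0 ≤ s) :
    ∫⁻ x : E3, (if ‖x‖ < s then ENNReal.ofReal ((vph δ x) ^ 2) else 0) ≤ ENNReal.ofReal (vpκ * s) := by
  refine le_trans (lintegral_mono_ae ?_) (vp_A1 s hs)
  filter_upwards [Measure.ae_ne volume (0 : E3)] with x hx
  split_ifs
  · apply ENNReal.ofReal_le_ofReal
    rw [← inv_pow]
    exact pow_le_pow_left₀ (vph_nonneg _ _) (vph_le_norm δ x hx) 2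
  · exact le_rfl

/-- Eulerian product bound -/
lemma vp_euler (A : E3 → ENNReal) (hA : Measurable A) (x : E3) (B : E3 → ENNReal) (hB : Measurable B) :
    ∫⁻ z : Z3, A (x - z.1) * B z.2 = (∫⁻ y, A y) * ∫⁻ p, B p := by
  rw [Measure.volume_eq_prod, lintegral_prod_mul (f := fun y => A (x - y)) (g := B)
    (hA.comp (measurable_const.sub measurable_id)).aemeasurable hB.aemeasurable]
  congr 1
  exact lintegral_sub_left_eq_self A x

lemma vph_meas (δ : ℝ) : Measurable (vph δ) := by unfold vph; fun_prop

lemma vp_potential {G : Z3 → ℝ} {M R I : ℝ} (hG0 : ∀ z, 0 ≤ G z) (hM : ∀ z, G z ≤ M) (hR : 0 ≤ R)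
    (hs : ∀ z, G z ≠ 0 → ‖z.2‖ < R) (hI0 : 0 ≤ I) (hI : ∫⁻ z, ENNReal.ofReal (G z) ≤ ENNReal.ofReal I)
    (δ : ℝ) (x : E3) :
    ∫⁻ z, ENNReal.ofReal (G z * (vph δ (x - z.1)) ^ 2) ≤ ENNReal.ofReal (M * (vpκ * (vpκ * R ^ 3)) + I) := by
  have hM0 : 0 ≤ M := (hG0 0).trans (hM 0)
  set A : E3 → ENNReal := fun y => if ‖y‖ < 1 then ENNReal.ofReal ((vph δ y) ^ 2) else 0 with hA
  set B : E3 → ENNReal := (Metric.ball (0:E3) R).indicator 1 with hB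
  have hAm : Measurable A := by
    refine Measurable.ite (measurableSet_lt measurable_norm measurable_const) ?_ measurable_const
    exact ((vph_meas δ).pow_const 2).ennreal_ofReal
  have hBm : Measurable B := measurable_one.indicator Metric.isOpen_ball.measurableSet
  have hκ := vpκ_nonneg
  calc ∫⁻ z, ENNReal.ofReal (G z * (vph δ (x - z.1)) ^ 2)
      ≤ ∫⁻ z, (ENNReal.ofReal M * (A (x - z.1) * B z.2) + ENNReal.ofReal (G z)) := by
        refine lintegral_mono fun z => ?_
        by_cases hz : G z = 0
        · simp [hz]
        have hzB : B z.2 = 1 := by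
          rw [hB, indicator_of_mem]; · rfl
          simpa using hs z hz
        rw [hzB, mul_one]
        by_cases h1 : ‖x - z.1‖ < 1
        · rw [ENNReal.ofReal_mul (hG0 z)]
          simp only [hA, h1, if_true]
          refine le_trans ?_ le_self_add
          gcongr
          exact hM z
        · simp only [hA, h1, if_false, mul_zero, zero_add]
          apply ENNReal.ofReal_le_ofReal
          have : vph δ (x - z.1) ≤ 1 := by
            have h2 := vph_mul_norm δ (x - z.1)
            have h3 := vph_nonneg δ (x - z.1)
            nlinarith
          exact mul_le_of_le_one_right (hG0 z) (pow_le_one₀ (vph_nonneg _ _) this)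
    _ = ENNReal.ofReal M * ((∫⁻ y, A y) * ∫⁻ p, B p) + ∫⁻ z, ENNReal.ofReal (G z) := by
        rw [lintegral_add_left, lintegral_const_mul, vp_euler A hAm x B hBm]
        · exact (hAm.comp (measurable_const.sub measurable_fst)).mul (hBm.comp measurable_snd)
        · exact ((hAm.comp (measurable_const.sub measurable_fst)).mul (hBm.comp measurable_snd)).const_mul _
    _ ≤ ENNReal.ofReal M * (ENNReal.ofReal (vpκ * 1) * ENNReal.ofReal (vpκ * R ^ 3)) + ENNReal.ofReal I := by
        gcongr
        · exact vp_A1h δ 1 (by norm_num)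
        · rw [hB, lintegral_indicator_one Metric.isOpen_ball.measurableSet]
          exact vp_A3 R hR
    _ = _ := by
        rw [← ENNReal.ofReal_mul (by positivity), ← ENNReal.ofReal_mul hM0, ← ENNReal.ofReal_add (by positivity) hI0, mul_one]

lemma vp_energy0 (hg : Continuous g) (hgc : HasCompactSupport g) (hg0 : ∀ z, 0 ≤ g z) :
    ∃ H0 : ℝ, 0 ≤ H0 ∧ ∀ δ F dF, 0 < δ → VPReg g δ F dF → ∀ t, 0 ≤ t → vpK g F t ≤ H0 * vpτ t := by
  obtain ⟨R, hR, hRs⟩ : ∃ R : ℝ, 0 < R ∧ ∀ z ∈ tsupport g, ‖z‖ < R := by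
    obtain ⟨R, hR⟩ := hgc.isBounded.exists_norm_le
    exact ⟨|R| + 1, by positivity, fun z hz => (hR z hz).trans_lt (by linarith [le_abs_self R])⟩
  obtain ⟨M, hM⟩ := hg.bounded_above_of_compact_support hgc
  have hM' : ∀ z, g z ≤ M := fun z => (le_abs_self _).trans (hM z)
  have hgi : Integrable g := hg.integrable_of_hasCompactSupport hgc
  set I := ∫ z, g z with hI
  have hI0 : 0 ≤ I := integral_nonneg hg0
  have hIl : ∫⁻ z, ENNReal.ofReal (g z) ≤ ENNReal.ofReal I := by
    rw [hI, ofReal_integral_eq_lintegral_ofReal hgi (Eventually.of_forall hg0)]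
  set A := M * (vpκ * (vpκ * R ^ 3)) + I with hA
  have hA0 : 0 ≤ A := by
    have := (hg0 0).trans (hM' 0)
    have := vpκ_nonneg
    positivity
  refine ⟨(∫ z : Z3, g z • ‖z.2‖ ^ 2) + I * (I + A), ?_, ?_⟩
  · have : 0 ≤ ∫ z : Z3, g z • ‖z.2‖ ^ 2 := integral_nonneg fun z => mul_nonneg (hg0 z) (sq_nonneg _)
    positivity
  intro δ F dF hδ h t ht
  have hF := h.ok1.ok
  refine (vp_energy hδ hg hgc hg0 h t ht).trans ?_
  rw [mul_comm]
  have hτ := vpτ_pos t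
  gcongr
  · unfold vpK
    simp only [vpX_zero hF]
    exact le_rfl
  · unfold vpU
    simp only [vpX_zero hF]
    have hint : Integrable (fun q : Z3 × Z3 => (g q.1 * g q.2) • vph δ (q.1.1 - q.2.1)) :=
      vp_int_wF (vp_ggc hg) (vp_ggs hgc) ((vph_cont δ hδ).comp (by fun_prop))
    rw [Measure.volume_eq_prod] at hint ⊢
    rw [integral_prod _ hint, hI, ← integral_mul_const]
    refine integral_mono hint.integral_prod_left (hgi.mul_const _) fun z => ?_
    have hc : Continuous fun z' : Z3 => vph δ (z.1 - z'.1) := (vph_cont δ hδ).comp (by fun_prop)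
    have hi2 : Integrable fun z' : Z3 => g z' * (vph δ (z.1 - z'.1)) ^ 2 := vp_int_wF hg hgc (hc.pow 2)
    have hb : ∫ z', g z' * (vph δ (z.1 - z'.1)) ^ 2 ≤ A := by
      refine (Real.le_norm_self _).trans ?_
      refine vp_normint_le (V := ℝ) (f := fun z' : Z3 => g z' * (vph δ (z.1 - z'.1)) ^ 2) hA0 ?_
      refine le_trans (le_of_eq ?_) (vp_potential hg0 hM' hR.le (fun z hz => ?_) hI0 hIl δ z.1)
      · congr 1; ext z'
        rw [Real.norm_of_nonneg (mul_nonneg (hg0 _) (sq_nonneg _))]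
      · exact (norm_snd_le z).trans_lt (hRs z (subset_tsupport g hz))
    calc ∫ z', (g z * g z') • vph δ (z.1 - z'.1) = g z * ∫ z', g z' • vph δ (z.1 - z'.1) := by
          rw [← integral_const_mul]; congr 1; ext z'; simp only [smul_eq_mul]; ring
      _ ≤ g z * ∫ z', (g z' + g z' * (vph δ (z.1 - z'.1)) ^ 2) := by
          refine mul_le_mul_of_nonneg_left ?_ (hg0 z)
          refine integral_mono (vp_int_wF hg hgc hc) (hgi.add hi2) fun z' => ?_
          have := hg0 z'
          simp only [smul_eq_mul, Pi.add_apply]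
          nlinarith [sq_nonneg (vph δ (z.1 - z'.1) - 1/2), mul_nonneg this (sq_nonneg (vph δ (z.1 - z'.1) - 1/2))]
      _ ≤ g z * (I + A) := by
          refine mul_le_mul_of_nonneg_left ?_ (hg0 z)
          rw [integral_add hgi hi2]
          linarith

end Energy


section Pfaff
open scoped InnerProductSpace

lemma vp_arctan {u u' : ℝ → ℝ} {t0 t r β : ℝ} (ht : t0 ≤ t) (hr : 0 < r) (hβ : 0 < β)
    (hu : ∀ s, HasDerivAt u (u' s) s) (hc : Continuous u') (hb : ∀ s ∈ Icc t0 t, β ≤ u' s) :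
    ∫⁻ s in Icc t0 t, ENNReal.ofReal (2 * (r ^ 2 + u s ^ 2)⁻¹) ≤ ENNReal.ofReal (2 * π * (β * r)⁻¹) := by
  have huc : Continuous u := continuous_iff_continuousAt.mpr fun s => (hu s).continuousAt
  have hpos : ∀ s, 0 < r ^ 2 + u s ^ 2 := fun s => by positivity
  have hw : ∀ s, HasDerivAt (fun s => Real.arctan (u s / r)) (r * u' s * (r ^ 2 + u s ^ 2)⁻¹) s := by
    intro s
    have h := ((hu s).div_const r).arctan
    refine h.congr_deriv ?_
    have := hpos s
    have h2 : (1 + (u s / r) ^ 2) = (r ^ 2 + u s ^ 2) / r ^ 2 := by field_simp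
    rw [h2]
    field_simp
  have hic : Continuous fun s => (r ^ 2 + u s ^ 2)⁻¹ :=
    Continuous.inv₀ (by fun_prop) (fun s => (hpos s).ne')
  have hwc : Continuous fun s => r * u' s * (r ^ 2 + u s ^ 2)⁻¹ := (continuous_const.mul hc).mul hic
  have hint := intervalIntegral.integral_eq_sub_of_hasDerivAt (a := t0) (b := t) (fun s _ => hw s)
    (hwc.intervalIntegrable _ _)
  have hle : ∫ s in t0..t, 2 * (r ^ 2 + u s ^ 2)⁻¹ ≤ ∫ s in t0..t, (2 * (β * r)⁻¹) * (r * u' s * (r ^ 2 + u s ^ 2)⁻¹) := by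
    refine intervalIntegral.integral_mono_on ht ?_ ?_ fun s hs => ?_
    · exact (continuous_const.mul hic).intervalIntegrable _ _
    · exact (continuous_const.mul hwc).intervalIntegrable _ _
    · have h1 := hb s hs
      have h2 : 0 < (r ^ 2 + u s ^ 2)⁻¹ := inv_pos.mpr (hpos s)
      have h3 : (2 * (β * r)⁻¹) * (r * u' s * (r ^ 2 + u s ^ 2)⁻¹) = 2 * (u' s / β) * (r ^ 2 + u s ^ 2)⁻¹ := by
        field_simp
      rw [h3]
      have : 1 ≤ u' s / β := (one_le_div hβ).mpr h1
      nlinarith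
  rw [intervalIntegral.integral_const_mul (2 * (β * r)⁻¹), hint] at hle
  rw [← ofReal_integral_eq_lintegral_ofReal]
  · apply ENNReal.ofReal_le_ofReal
    rw [integral_Icc_eq_integral_Ioc, ← intervalIntegral.integral_of_le ht]
    refine hle.trans ?_
    have h1 := Real.arctan_lt_pi_div_two (u t / r)
    have h2 := Real.neg_pi_div_two_lt_arctan (u t0 / r)
    have h3 : 0 < 2 * (β * r)⁻¹ := by positivity
    nlinarith
  · exact (continuous_const.mul hic).continuousOn.integrableOn_Icc
  · exact Eventually.of_forall fun s => by have := hpos s; positivity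

lemma vp_vol_ball (c : E3) (R : ℝ) (hR : 0 ≤ R) : volume (Metric.ball c R) ≤ ENNReal.ofReal (vpκ * R ^ 3) := by
  rw [Measure.addHaar_ball_center]
  exact vp_A3 R hR

lemma vp_T1 (x : E3) (s0 q : ℝ) (hs : 0 < s0) (hq : 0 < q) :
    ∫⁻ z : Z3, (if s0 ≤ ‖x - z.1‖ ∧ ‖z.2‖ * ‖x - z.1‖ ≤ q then ENNReal.ofReal ((‖x - z.1‖ ^ 2)⁻¹) else 0)
      ≤ ENNReal.ofReal (vpκ * (8 * q ^ 3) * (vpκ * (2 * s0 ^ 2)⁻¹)) := by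
  have hκ := vpκ_nonneg
  have hm : Measurable fun z : Z3 => (if s0 ≤ ‖x - z.1‖ ∧ ‖z.2‖ * ‖x - z.1‖ ≤ q then ENNReal.ofReal ((‖x - z.1‖ ^ 2)⁻¹) else 0) := by
    refine Measurable.ite ?_ (by fun_prop) measurable_const
    refine MeasurableSet.inter ?_ ?_
    · exact measurableSet_le (g := fun z : Z3 => ‖x - z.1‖) measurable_const (by fun_prop)
    · exact measurableSet_le (f := fun z : Z3 => ‖z.2‖ * ‖x - z.1‖) (by fun_prop) measurable_const
  rw [Measure.volume_eq_prod, lintegral_prod _ hm.aemeasurable]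
  have h1 : ∀ y : E3, ∫⁻ p : E3, (if s0 ≤ ‖x - y‖ ∧ ‖p‖ * ‖x - y‖ ≤ q then ENNReal.ofReal ((‖x - y‖ ^ 2)⁻¹) else 0)
      ≤ ENNReal.ofReal (vpκ * (8 * q ^ 3)) * (if s0 ≤ ‖x - y‖ then ENNReal.ofReal ((‖x - y‖ ^ 5)⁻¹) else 0) := by
    intro y
    by_cases hy : s0 ≤ ‖x - y‖
    · have hy0 : 0 < ‖x - y‖ := hs.trans_le hy
      simp only [hy, true_and, if_true]
      calc _ ≤ ∫⁻ p : E3, ENNReal.ofReal ((‖x - y‖ ^ 2)⁻¹) * (Metric.ball (0:E3) (2 * q / ‖x - y‖)).indicator 1 p := by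
            refine lintegral_mono fun p => ?_
            split_ifs with hp
            · rw [indicator_of_mem]
              · simp
              · rw [mem_ball_zero_iff, lt_div_iff₀ hy0]; linarith
            · exact zero_le
        _ = ENNReal.ofReal ((‖x - y‖ ^ 2)⁻¹) * volume (Metric.ball (0:E3) (2 * q / ‖x - y‖)) := by
            rw [lintegral_const_mul _ (measurable_one.indicator Metric.isOpen_ball.measurableSet),
              lintegral_indicator_one Metric.isOpen_ball.measurableSet]
        _ ≤ ENNReal.ofReal ((‖x - y‖ ^ 2)⁻¹) * ENNReal.ofReal (vpκ * (2 * q / ‖x - y‖) ^ 3) := by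
            gcongr; exact vp_A3 _ (by positivity)
        _ = _ := by
            rw [← ENNReal.ofReal_mul (by positivity), ← ENNReal.ofReal_mul (by positivity)]
            congr 1; field_simp; ring
    · simp [hy]
  refine (lintegral_mono h1).trans ?_
  rw [lintegral_const_mul' _ _ ENNReal.ofReal_ne_top]
  have h2 := lintegral_sub_left_eq_self (μ := (volume : Measure E3)) (fun y : E3 => (if s0 ≤ ‖y‖ then ENNReal.ofReal ((‖y‖ ^ 5)⁻¹) else 0)) x
  rw [h2, ENNReal.ofReal_mul (p := vpκ * (8 * q ^ 3)) (by positivity)]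
  exact mul_le_mul_right (vp_A2 s0 hs) _

lemma vp_T2 (δ : ℝ) (x c : E3) (s0 ρ : ℝ) (hs : 0 ≤ s0) (hρ : 0 ≤ ρ) :
    ∫⁻ z : Z3, (if ‖x - z.1‖ < s0 ∧ ‖z.2 - c‖ < ρ then ENNReal.ofReal ((vph δ (x - z.1)) ^ 2) else 0)
      ≤ ENNReal.ofReal (vpκ * s0 * (vpκ * ρ ^ 3)) := by
  have hκ := vpκ_nonneg
  set A : E3 → ENNReal := fun y => if ‖y‖ < s0 then ENNReal.ofReal ((vph δ y) ^ 2) else 0 with hA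
  have hAm : Measurable A := by
    refine Measurable.ite (measurableSet_lt measurable_norm measurable_const) ?_ measurable_const
    exact ((vph_meas δ).pow_const 2).ennreal_ofReal
  have hBm : Measurable ((Metric.ball c ρ).indicator (1 : E3 → ENNReal)) :=
    measurable_one.indicator Metric.isOpen_ball.measurableSet
  calc _ = ∫⁻ z : Z3, A (x - z.1) * (Metric.ball c ρ).indicator 1 z.2 := by
        refine lintegral_congr fun z => ?_
        by_cases h2 : ‖z.2 - c‖ < ρ
        · rw [indicator_of_mem (by rwa [mem_ball_iff_norm])]
          simp [hA, h2]
        · rw [indicator_of_notMem (by rwa [mem_ball_iff_norm])]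
          simp [h2]
    _ = (∫⁻ y, A y) * volume (Metric.ball c ρ) := by
        rw [vp_euler A hAm x _ hBm, lintegral_indicator_one Metric.isOpen_ball.measurableSet]
    _ ≤ ENNReal.ofReal (vpκ * s0) * ENNReal.ofReal (vpκ * ρ ^ 3) := by
        gcongr
        · exact vp_A1h δ s0 hs
        · exact vp_vol_ball c ρ hρ
    _ = _ := by rw [← ENNReal.ofReal_mul (by positivity)]

lemma vp_T4 (δ : ℝ) (x : E3) (b ρ : ℝ) (hb : 0 ≤ b) (hρ : 0 ≤ ρ) :
    ∫⁻ z : Z3, (if ‖x - z.1‖ < b * (‖z.2‖ ^ 2)⁻¹ ∧ ‖z.2‖ < ρ then ENNReal.ofReal ((vph δ (x - z.1)) ^ 2) else 0)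
      ≤ ENNReal.ofReal (vpκ * b * (vpκ * ρ)) := by
  have hκ := vpκ_nonneg
  have hm : Measurable fun z : Z3 => (if ‖x - z.1‖ < b * (‖z.2‖ ^ 2)⁻¹ ∧ ‖z.2‖ < ρ then ENNReal.ofReal ((vph δ (x - z.1)) ^ 2) else 0) := by
    refine Measurable.ite ?_ ?_ measurable_const
    · refine MeasurableSet.inter ?_ ?_
      · exact measurableSet_lt (f := fun z : Z3 => ‖x - z.1‖) (g := fun z : Z3 => b * (‖z.2‖ ^ 2)⁻¹) (by fun_prop) (by fun_prop)
      · exact measurableSet_lt (f := fun z : Z3 => ‖z.2‖) (by fun_prop) measurable_const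
    · have := (vph_meas δ).comp (by fun_prop : Measurable fun z : Z3 => x - z.1)
      exact (this.pow_const 2).ennreal_ofReal
  rw [Measure.volume_eq_prod, lintegral_prod_symm _ hm.aemeasurable]
  have h1 : ∀ p : E3, ∫⁻ y : E3, (if ‖x - y‖ < b * (‖p‖ ^ 2)⁻¹ ∧ ‖p‖ < ρ then ENNReal.ofReal ((vph δ (x - y)) ^ 2) else 0)
      ≤ ENNReal.ofReal (vpκ * b) * (if ‖p‖ < ρ then ENNReal.ofReal ((‖p‖ ^ 2)⁻¹) else 0) := by
    intro p
    by_cases hp : ‖p‖ < ρ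
    · simp only [hp, and_true, if_true]
      rw [lintegral_sub_left_eq_self (μ := (volume : Measure E3))
        (fun y : E3 => (if ‖y‖ < b * (‖p‖ ^ 2)⁻¹ then ENNReal.ofReal ((vph δ y) ^ 2) else 0)) x]
      refine (vp_A1h δ _ (by positivity)).trans ?_
      rw [← ENNReal.ofReal_mul (by positivity), mul_assoc]
    · simp [hp]
  refine (lintegral_mono h1).trans ?_
  rw [lintegral_const_mul' _ _ ENNReal.ofReal_ne_top, ENNReal.ofReal_mul (p := vpκ * b) (by positivity)]
  exact mul_le_mul_right (vp_A1 ρ hρ) _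

end Pfaff


section Pfaff2
open scoped InnerProductSpace
variable {g : Z3 → ℝ} {δ : ℝ} {F : ℝ → E3 → E3} {dF : ℝ → E3 → E3 →L[ℝ] E3}

lemma vp_field_lint (hg0 : ∀ z, 0 ≤ g z) (h : VPReg g δ F dF) (t : ℝ) (ht : 0 ≤ t) (x : E3) :
    ENNReal.ofReal ‖F t x‖ ≤ ∫⁻ z, ENNReal.ofReal (g z * (vph δ (x - (vpX F t z).1)) ^ 2) := by
  rw [vpReg_self h t ht, ofReal_norm_eq_enorm]
  refine (enorm_integral_le_lintegral_enorm _).trans (lintegral_mono fun z => ?_)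
  rw [← ofReal_norm_eq_enorm, norm_smul, Real.norm_of_nonneg (hg0 z)]
  exact ENNReal.ofReal_le_ofReal (mul_le_mul_of_nonneg_left (vpk_norm_le_sq δ _) (hg0 z))

/-- Eulerian part of the splitting -/
def vpTE (δ M a P Q R : ℝ) (x q : E3) (w : Z3) : ENNReal :=
  ENNReal.ofReal M * (
    (if (a ^ 4)⁻¹ ≤ ‖x - w.1‖ ∧ ‖w.2‖ * ‖x - w.1‖ ≤ a⁻¹ then ENNReal.ofReal ((‖x - w.1‖ ^ 2)⁻¹) else 0)
    + ((if ‖x - w.1‖ < (a ^ 4)⁻¹ ∧ ‖w.2 - 0‖ < 6 * P * a ^ 3 then ENNReal.ofReal ((vph δ (x - w.1)) ^ 2) else 0)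
    + ((if ‖x - w.1‖ < (a ^ 4)⁻¹ ∧ ‖w.2 - q‖ < 6 * P * a ^ 3 then ENNReal.ofReal ((vph δ (x - w.1)) ^ 2) else 0)
    + (if ‖x - w.1‖ < (2 * R) * (‖w.2‖ ^ 2)⁻¹ ∧ ‖w.2‖ < 3 * Q * a ^ 5 then ENNReal.ofReal ((vph δ (x - w.1)) ^ 2) else 0))))

lemma vp_Tm1 (δ : ℝ) (x : E3) : Measurable fun w : Z3 => ENNReal.ofReal ((vph δ (x - w.1)) ^ 2) := by
  have := (vph_meas δ).comp (by fun_prop : Measurable fun z : Z3 => x - z.1)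
  exact (this.pow_const 2).ennreal_ofReal

lemma vp_Tm2 (δ : ℝ) (x c : E3) (s ρ : ℝ) : Measurable fun w : Z3 =>
    (if ‖x - w.1‖ < s ∧ ‖w.2 - c‖ < ρ then ENNReal.ofReal ((vph δ (x - w.1)) ^ 2) else 0) := by
  refine Measurable.ite ?_ (vp_Tm1 δ x) measurable_const
  refine MeasurableSet.inter ?_ ?_
  · exact measurableSet_lt (f := fun z : Z3 => ‖x - z.1‖) (by fun_prop) measurable_const
  · exact measurableSet_lt (f := fun z : Z3 => ‖z.2 - c‖) (by fun_prop) measurable_const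

lemma vp_Tm4 (δ : ℝ) (x : E3) (b ρ : ℝ) : Measurable fun z : Z3 =>
    (if ‖x - z.1‖ < b * (‖z.2‖ ^ 2)⁻¹ ∧ ‖z.2‖ < ρ then ENNReal.ofReal ((vph δ (x - z.1)) ^ 2) else 0) := by
  refine Measurable.ite ?_ (vp_Tm1 δ x) measurable_const
  refine MeasurableSet.inter ?_ ?_
  · exact measurableSet_lt (f := fun z : Z3 => ‖x - z.1‖) (g := fun z : Z3 => b * (‖z.2‖ ^ 2)⁻¹) (by fun_prop) (by fun_prop)
  · exact measurableSet_lt (f := fun z : Z3 => ‖z.2‖) (by fun_prop) measurable_const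

lemma vp_Tm3 (x : E3) (s q : ℝ) : Measurable fun z : Z3 =>
    (if s ≤ ‖x - z.1‖ ∧ ‖z.2‖ * ‖x - z.1‖ ≤ q then ENNReal.ofReal ((‖x - z.1‖ ^ 2)⁻¹) else 0) := by
  refine Measurable.ite ?_ (by fun_prop) measurable_const
  refine MeasurableSet.inter ?_ ?_
  · exact measurableSet_le (g := fun z : Z3 => ‖x - z.1‖) measurable_const (by fun_prop)
  · exact measurableSet_le (f := fun z : Z3 => ‖z.2‖ * ‖x - z.1‖) (by fun_prop) measurable_const

lemma vpTE_meas (δ M a P Q R : ℝ) (x q : E3) : Measurable (vpTE δ M a P Q R x q) := by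
  unfold vpTE
  exact ((vp_Tm3 _ _ _).add ((vp_Tm2 _ _ _ _ _).add ((vp_Tm2 _ _ _ _ _).add (vp_Tm4 _ _ _ _)))).const_mul _

lemma vpTE_int (δ M a P Q R : ℝ) (x q : E3) (hM : 0 ≤ M) (ha : 1 ≤ a) (hP : 0 ≤ P) (hQ : 0 ≤ Q) (hR : 0 ≤ R) :
    ∫⁻ w, vpTE δ M a P Q R x q w ≤
      ENNReal.ofReal (M * (4 * vpκ ^ 2 + 432 * vpκ ^ 2 * P ^ 3 + 6 * vpκ ^ 2 * R * Q) * a ^ 5) := by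
  have hκ := vpκ_nonneg
  have ha0 : 0 < a := by linarith
  unfold vpTE
  rw [lintegral_const_mul' _ _ ENNReal.ofReal_ne_top, lintegral_add_left (vp_Tm3 _ _ _),
    lintegral_add_left (vp_Tm2 _ _ _ _ _), lintegral_add_left (vp_Tm2 _ _ _ _ _)]
  have h1 := vp_T1 x (a ^ 4)⁻¹ a⁻¹ (by positivity) (by positivity)
  have h2 := vp_T2 δ x 0 (a ^ 4)⁻¹ (6 * P * a ^ 3) (by positivity) (by positivity)
  have h3 := vp_T2 δ x q (a ^ 4)⁻¹ (6 * P * a ^ 3) (by positivity) (by positivity)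
  have h4 := vp_T4 δ x (2 * R) (3 * Q * a ^ 5) (by positivity) (by positivity)
  refine (mul_le_mul_right (add_le_add h1 (add_le_add h2 (add_le_add h3 h4))) _).trans ?_
  rw [← ENNReal.ofReal_add (by positivity) (by positivity), ← ENNReal.ofReal_add (by positivity) (by positivity),
    ← ENNReal.ofReal_add (by positivity) (by positivity), ← ENNReal.ofReal_mul hM]
  apply ENNReal.ofReal_le_ofReal
  apply le_of_eq
  field_simp
  ring

lemma vp_pf_point {M a P Q R G : ℝ} {x y p p0 q e : E3} (hG : 0 ≤ G) (hGM : G ≤ M) (ha : 1 ≤ a) (hP : 0 < P)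
    (hPQ : P ≤ Q) (hR : 0 < R) (hp : ‖p - p0‖ ≤ P * a ^ 3) (hp0 : ‖p0‖ ≤ Q * a ^ 5)
    (hq : ‖e‖ ≤ 1) :
    ENNReal.ofReal (G * (vph δ (x - y)) ^ 2) ≤ vpTE δ M a P Q R x q (y, p) + ENNReal.ofReal (a ^ 2 * (G * ‖p‖ ^ 2))
      + (if 4 * P * a ^ 3 < ‖q - p0‖ ∧ 4 * P * a ^ 3 < ‖p0‖ then
          ENNReal.ofReal (G * (2 * ((R / ‖p0‖ ^ 2) ^ 2 + ⟪x - y, e⟫_ℝ ^ 2)⁻¹)) else 0) := by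
  have ha0 : 0 < a := by linarith
  have hPa : 0 < P * a ^ 3 := by positivity
  set Y := x - y with hY
  have hM : 0 ≤ M := hG.trans hGM
  have hh0 := vph_nonneg δ Y
  have hh1 := vph_mul_norm δ Y
  have hGM' : ENNReal.ofReal (G * (vph δ Y) ^ 2) ≤ ENNReal.ofReal M * ENNReal.ofReal ((vph δ Y) ^ 2) := by
    rw [← ENNReal.ofReal_mul hM]
    exact ENNReal.ofReal_le_ofReal (mul_le_mul_of_nonneg_right hGM (sq_nonneg _))
  have hle : ∀ Z : ℝ, 0 < ‖Y‖ → (‖Y‖ ^ 2)⁻¹ ≤ Z → (vph δ Y) ^ 2 ≤ Z := by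
    intro Z hYp hZ
    refine le_trans ?_ hZ
    rw [← inv_pow]
    refine pow_le_pow_left₀ hh0 ?_ 2
    rw [← one_div, le_div_iff₀ hYp]; exact hh1
  by_cases hfar : (a ^ 4)⁻¹ ≤ ‖Y‖
  · have hYp : 0 < ‖Y‖ := lt_of_lt_of_le (by positivity) hfar
    by_cases hk : ‖p‖ * ‖Y‖ ≤ a⁻¹
    · refine le_trans ?_ (le_self_add.trans le_self_add)
      unfold vpTE
      simp only [← hY]
      rw [if_pos ⟨hfar, hk⟩]
      refine le_trans ?_ (mul_le_mul_right le_self_add _)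
      refine hGM'.trans (mul_le_mul_right (ENNReal.ofReal_le_ofReal (hle _ hYp le_rfl)) _)
    · refine le_trans ?_ (le_add_self.trans le_self_add)
      apply ENNReal.ofReal_le_ofReal
      have : (vph δ Y) ^ 2 ≤ a ^ 2 * ‖p‖ ^ 2 := by
        refine hle _ hYp ?_
        push Not at hk
        rw [inv_le_iff_one_le_mul₀ (by positivity)]
        have h1 : 1 ≤ a * (‖p‖ * ‖Y‖) := by
          rw [inv_lt_iff_one_lt_mul₀ ha0] at hk; linarith
        calc (1:ℝ) ≤ (a * (‖p‖ * ‖Y‖)) ^ 2 := one_le_pow₀ h1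
          _ = _ := by ring
      calc G * (vph δ Y) ^ 2 ≤ G * (a ^ 2 * ‖p‖ ^ 2) := mul_le_mul_of_nonneg_left this hG
        _ = _ := by ring
  push Not at hfar
  by_cases hgood1 : ‖p0‖ ≤ 4 * P * a ^ 3
  · refine le_trans ?_ (le_self_add.trans le_self_add)
    unfold vpTE
    simp only [← hY]
    rw [if_pos (c := _ ∧ ‖p - 0‖ < _) ⟨hfar, ?_⟩]
    · refine le_trans ?_ (mul_le_mul_right (le_self_add.trans le_add_self) _)
      exact hGM'
    · rw [sub_zero]
      have : ‖p‖ ≤ ‖p - p0‖ + ‖p0‖ := by simpa using norm_add_le (p - p0) p0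
      nlinarith
  by_cases hgood2 : ‖q - p0‖ ≤ 4 * P * a ^ 3
  · refine le_trans ?_ (le_self_add.trans le_self_add)
    unfold vpTE
    simp only [← hY]
    rw [if_pos (c := _ ∧ ‖p - q‖ < _) ⟨hfar, ?_⟩]
    · refine le_trans ?_ (mul_le_mul_right ((le_self_add.trans le_add_self).trans le_add_self) _)
      exact hGM'
    · have : ‖p - q‖ ≤ ‖p - p0‖ + ‖q - p0‖ := by
        have := norm_sub_le (p - p0) (q - p0)
        simpa using this
      nlinarith
  push Not at hgood1 hgood2
  have hp0pos : 0 < ‖p0‖ := lt_trans (by positivity) hgood1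
  set r := R / ‖p0‖ ^ 2 with hr
  have hrpos : 0 < r := by positivity
  by_cases hbad : ‖Y‖ < r
  · refine le_trans ?_ (le_self_add.trans le_self_add)
    unfold vpTE
    simp only [← hY]
    have hn1 : ‖p‖ ≤ ‖p - p0‖ + ‖p0‖ := by simpa using norm_add_le (p - p0) p0
    have hn2 : ‖p0‖ ≤ ‖p - p0‖ + ‖p‖ := by
      have := norm_sub_le p (p - p0)
      simp only [sub_sub_cancel] at this; linarith
    have hppos : 0 < ‖p‖ := by nlinarith
    rw [if_pos (c := ‖Y‖ < _ * _ ∧ _) ⟨?_, ?_⟩]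
    · refine le_trans ?_ (mul_le_mul_right ((le_add_self.trans le_add_self).trans le_add_self) _)
      exact hGM'
    · refine hbad.trans_le ?_
      rw [hr, ← div_eq_mul_inv, div_le_div_iff₀ (by positivity) (by positivity)]
      have : ‖p‖ ^ 2 ≤ 2 * ‖p0‖ ^ 2 := by nlinarith
      nlinarith
    · have h5 : P * a ^ 3 ≤ Q * a ^ 5 := by
        have : a ^ 3 ≤ a ^ 5 := pow_le_pow_right₀ ha (by norm_num)
        have : 0 < a ^ 3 := by positivity
        nlinarith
      nlinarith
  · refine le_trans ?_ le_add_self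
    rw [if_pos ⟨hgood2, hgood1⟩]
    push Not at hbad
    apply ENNReal.ofReal_le_ofReal
    refine mul_le_mul_of_nonneg_left ?_ hG
    have hYp : 0 < ‖Y‖ := hrpos.trans_le hbad
    refine hle _ hYp ?_
    have hin : ⟪Y, e⟫_ℝ ^ 2 ≤ ‖Y‖ ^ 2 := by
      rw [sq_le_sq, abs_norm]
      refine (abs_real_inner_le_norm Y e).trans ?_
      exact mul_le_of_le_one_right (norm_nonneg _) hq
    have hr2 : r ^ 2 ≤ ‖Y‖ ^ 2 := pow_le_pow_left₀ hrpos.le hbad 2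
    rw [← one_div, ← div_eq_mul_inv, div_le_div_iff₀ (by positivity) (by positivity)]
    linarith

end Pfaff2


section Pfaff3
open scoped InnerProductSpace
variable {g : Z3 → ℝ} {δ : ℝ} {F : ℝ → E3 → E3} {dF : ℝ → E3 → E3 →L[ℝ] E3}

lemma vp_norm_inv_smul_le (v : E3) : ‖‖v‖⁻¹ • v‖ ≤ 1 := by
  rw [norm_smul, norm_inv, norm_norm]
  exact inv_mul_le_one

/-- ugly part -/
def vpUg (g : Z3 → ℝ) (F : ℝ → E3 → E3) (t0 K R : ℝ) (z : Z3) (s : ℝ) (w : Z3) : ENNReal :=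
  if K < ‖(vpX F t0 z).2 - (vpX F t0 w).2‖ ∧ K < ‖(vpX F t0 w).2‖ then
    ENNReal.ofReal (g w * (2 * ((R / ‖(vpX F t0 w).2‖ ^ 2) ^ 2 + ⟪(vpX F s z).1 - (vpX F s w).1,
      ‖(vpX F t0 z).2 - (vpX F t0 w).2‖⁻¹ • ((vpX F t0 z).2 - (vpX F t0 w).2)⟫_ℝ ^ 2)⁻¹)) else 0

lemma vpUg_meas (hg : Continuous g) (hF : VPOk F) (t0 K R : ℝ) (z : Z3) :
    Measurable fun q : ℝ × Z3 => vpUg g F t0 K R z q.1 q.2 := by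
  have hX := vpX_cont hF
  have h1 : Measurable fun q : ℝ × Z3 => (vpX F t0 q.2).2 := by
    have := (continuous_snd.comp hX).comp (by fun_prop : Continuous fun q : ℝ × Z3 => (t0, q.2))
    exact this.measurable
  have h2 : Measurable fun q : ℝ × Z3 => (vpX F q.1 z).1 - (vpX F q.1 q.2).1 := by
    have h3 := (continuous_fst.comp hX).comp (by fun_prop : Continuous fun q : ℝ × Z3 => (q.1, z))
    exact h3.measurable.sub (continuous_fst.comp hX).measurable
  have h3 : Measurable fun q : ℝ × Z3 => (vpX F t0 z).2 - (vpX F t0 q.2).2 := measurable_const.sub h1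
  have h4 : Measurable fun q : ℝ × Z3 => g q.2 := hg.measurable.comp measurable_snd
  unfold vpUg
  refine Measurable.ite ?_ ?_ measurable_const
  · exact (measurableSet_lt measurable_const h3.norm).inter (measurableSet_lt measurable_const h1.norm)
  · refine (h4.mul (measurable_const.mul ?_)).ennreal_ofReal
    refine Measurable.inv ?_
    refine Measurable.add ((measurable_const.div (h1.norm.pow_const 2)).pow_const 2) ?_
    exact (h2.inner (h3.norm.inv.smul h3)).pow_const 2

lemma vpX_momentum_cont (hF : VPOk F) (z : Z3) : Continuous fun s => (vpX F s z).2 :=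
  continuous_iff_continuousAt.mpr fun s => (vpX_deriv2 hF s z).continuousAt

lemma vpX_pos_cont (hF : VPOk F) (z : Z3) : Continuous fun s => (vpX F s z).1 :=
  continuous_iff_continuousAt.mpr fun s => (vpX_deriv1 hF s z).continuousAt

lemma vp_ugly {a P R t0 t c : ℝ} (hg0 : ∀ z, 0 ≤ g z) (hF : VPOk F) (ha : 1 ≤ a) (hP : 0 < P) (hR : 0 < R)
    (ht0 : 0 ≤ t0) (haτ : a ^ 3 = vpτ t0) (ht : t0 ≤ t) (htc : t ≤ t0 + c * a) (hc : c ≤ 1)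
    {z w : Z3} (hz : ∀ s ∈ Icc t0 t, ‖(vpX F s z).2 - (vpX F t0 z).2‖ ≤ P * a ^ 3)
    (hw : ∀ s ∈ Icc t0 t, ‖(vpX F s w).2 - (vpX F t0 w).2‖ ≤ P * a ^ 3) :
    ∫⁻ s in Icc t0 t, vpUg g F t0 (4 * P * a ^ 3) R z s w ≤
      ENNReal.ofReal (4 * π * a ^ 3 * (P * R)⁻¹ * (g w • ‖(vpX F t0 w).2‖ ^ 2)) := by
  have ha0 : 0 < a := by linarith
  unfold vpUg
  by_cases hif : 4 * P * a ^ 3 < ‖(vpX F t0 z).2 - (vpX F t0 w).2‖ ∧ 4 * P * a ^ 3 < ‖(vpX F t0 w).2‖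
  swap
  · simp [hif]
  simp only [if_pos hif]
  set d := (vpX F t0 z).2 - (vpX F t0 w).2 with hd
  set e := ‖d‖⁻¹ • d with he
  have hdpos : 0 < ‖d‖ := lt_trans (by positivity) hif.1
  have hppos : 0 < ‖(vpX F t0 w).2‖ := lt_trans (by positivity) hif.2
  set r := R / ‖(vpX F t0 w).2‖ ^ 2 with hr
  have hrpos : 0 < r := by positivity
  have hel : ‖e‖ ≤ 1 := vp_norm_inv_smul_le d
  have key := vp_arctan (u := fun s => ⟪(vpX F s z).1 - (vpX F s w).1, e⟫_ℝ)
    (u' := fun s => (vpτ s ^ 2)⁻¹ * ⟪(vpX F s z).2 - (vpX F s w).2, e⟫_ℝ) (β := P / (2 * a ^ 3)) ht hrpos (by positivity)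
    (by
      intro s
      have h1 := ((vpX_deriv1 hF s z).sub (vpX_deriv1 hF s w)).inner ℝ (hasDerivAt_const s e)
      refine h1.congr_deriv ?_
      simp only [inner_zero_right, zero_add, ← smul_sub]
      rw [inner_smul_left]; simp)
    (by
      have h1 := ((vpX_momentum_cont hF z).sub (vpX_momentum_cont hF w)).inner (𝕜 := ℝ) (continuous_const (y := e))
      exact vpτ_inv2_cont.mul h1)
    (by
      intro s hs
      have hs0 : 0 ≤ s := ht0.trans hs.1
      have hτ : vpτ s ≤ 2 * a ^ 3 := by
        rw [vpτ_of_nonneg hs0]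
        rw [vpτ_of_nonneg ht0] at haτ
        have h1 : s ≤ t0 + c * a := hs.2.trans htc
        have h2 : c * a ≤ a := by nlinarith
        have h3 : a ≤ a ^ 3 := le_self_pow₀ ha (by norm_num)
        linarith
      have hin : 2 * P * a ^ 3 ≤ ⟪(vpX F s z).2 - (vpX F s w).2, e⟫_ℝ := by
        have h1 : (vpX F s z).2 - (vpX F s w).2 = d + (((vpX F s z).2 - (vpX F t0 z).2) - ((vpX F s w).2 - (vpX F t0 w).2)) := by
          rw [hd]; abel
        rw [h1, inner_add_left]
        have h2 : ⟪d, e⟫_ℝ = ‖d‖ := by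
          rw [he, inner_smul_right, real_inner_self_eq_norm_sq]; field_simp
        have h3 := abs_real_inner_le_norm (((vpX F s z).2 - (vpX F t0 z).2) - ((vpX F s w).2 - (vpX F t0 w).2)) e
        have h4 := norm_sub_le ((vpX F s z).2 - (vpX F t0 z).2) ((vpX F s w).2 - (vpX F t0 w).2)
        have h5 := hz s hs
        have h6 := hw s hs
        have h7 : ‖((vpX F s z).2 - (vpX F t0 z).2) - ((vpX F s w).2 - (vpX F t0 w).2)‖ * ‖e‖ ≤ 2 * P * a ^ 3 := by
          refine (mul_le_of_le_one_right (norm_nonneg _) hel).trans ?_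
          linarith
        have h8 := neg_abs_le ⟪((vpX F s z).2 - (vpX F t0 z).2) - ((vpX F s w).2 - (vpX F t0 w).2), e⟫_ℝ
        linarith [hif.1]
      have hτp := vpτ_pos s
      have h9 : ((2 * a ^ 3) ^ 2)⁻¹ ≤ (vpτ s ^ 2)⁻¹ := by gcongr
      calc P / (2 * a ^ 3) = ((2 * a ^ 3) ^ 2)⁻¹ * (2 * P * a ^ 3) := by field_simp
        _ ≤ _ := by gcongr)
  calc _ = ENNReal.ofReal (g w) * ∫⁻ s in Icc t0 t, ENNReal.ofReal (2 * (r ^ 2 + ⟪(vpX F s z).1 - (vpX F s w).1, e⟫_ℝ ^ 2)⁻¹) := by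
        rw [← lintegral_const_mul' _ _ ENNReal.ofReal_ne_top]
        simp only [ENNReal.ofReal_mul (hg0 w)]
    _ ≤ ENNReal.ofReal (g w) * ENNReal.ofReal (2 * π * (P / (2 * a ^ 3) * r)⁻¹) := mul_le_mul_right key _
    _ = _ := by
        rw [← ENNReal.ofReal_mul (hg0 w)]
        congr 1
        rw [hr, smul_eq_mul]
        field_simp
        ring

lemma vp_lint_K (hg : Continuous g) (hgc : HasCompactSupport g) (hg0 : ∀ z, 0 ≤ g z) (hF : VPOk F) (s A : ℝ) (hA : 0 ≤ A) :
    ∫⁻ w, ENNReal.ofReal (A * (g w • ‖(vpX F s w).2‖ ^ 2)) = ENNReal.ofReal (A * vpK g F s) := by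
  have hX := vpX_cont hF
  have hi : Integrable fun w => g w • ‖(vpX F s w).2‖ ^ 2 := vp_int_wF hg hgc (by
    have h1 := (continuous_snd.comp hX).comp (by fun_prop : Continuous fun z : Z3 => (s, z))
    exact h1.norm.pow 2)
  rw [← ofReal_integral_eq_lintegral_ofReal (hi.const_mul A), integral_const_mul]
  · rfl
  · exact Eventually.of_forall fun w => mul_nonneg hA (mul_nonneg (hg0 w) (sq_nonneg _))

lemma vp_step {M H0 a P Q R t0 t c : ℝ} (hδ : 0 < δ) (hg : Continuous g) (hgc : HasCompactSupport g) (hg0 : ∀ z, 0 ≤ g z)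
    (hM : ∀ z, g z ≤ M) (h : VPReg g δ F dF) (hH0 : 0 ≤ H0) (hK : ∀ s, 0 ≤ s → vpK g F s ≤ H0 * vpτ s)
    (ha : 1 ≤ a) (hP : 0 < P) (hR : 0 < R) (hPQ : P ≤ Q)
    (ht0 : 0 ≤ t0) (haτ : a ^ 3 = vpτ t0) (ht : t0 ≤ t) (htc : t ≤ t0 + c * a) (hc0 : 0 ≤ c) (hc : c ≤ 1)
    (hq : ∀ z ∈ tsupport g, ‖(vpX F t0 z).2‖ ≤ Q * a ^ 5)
    (hb : ∀ z ∈ tsupport g, ∀ s ∈ Icc t0 t, ‖(vpX F s z).2 - (vpX F t0 z).2‖ ≤ P * a ^ 3)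
    (z : Z3) (hz : z ∈ tsupport g) :
    ‖(vpX F t z).2 - (vpX F t0 z).2‖ ≤ a ^ 3 * (c * (M * (4 * vpκ ^ 2 + 432 * vpκ ^ 2 * P ^ 3 + 6 * vpκ ^ 2 * R * Q) + 2 * H0)
      + 4 * π * H0 * (P * R)⁻¹) := by
  have hF := h.ok1.ok
  have ha0 : 0 < a := by linarith
  have hM0 : 0 ≤ M := (hg0 0).trans (hM 0)
  have hκ := vpκ_nonneg
  have hQ : 0 ≤ Q := hP.le.trans hPQ
  set C1 := M * (4 * vpκ ^ 2 + 432 * vpκ ^ 2 * P ^ 3 + 6 * vpκ ^ 2 * R * Q) with hC1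
  have hC10 : 0 ≤ C1 := by positivity
  have hFc : Continuous fun s => (vpτ s)⁻¹ • F s (vpX F s z).1 := by
    have h1 := h.ok1.bc.comp (continuous_id.prodMk (vpX_pos_cont hF z))
    exact vpτ_inv_cont.smul h1
  have hftc := intervalIntegral.integral_eq_sub_of_hasDerivAt (a := t0) (b := t) (fun s _ => vpX_deriv2 hF s z)
    (hFc.intervalIntegrable _ _)
  rw [← hftc, intervalIntegral.integral_of_le ht, ← integral_Icc_eq_integral_Ioc]
  refine vp_normint_le (by positivity) ?_
  -- pointwise in time
  have hτb : ∀ s ∈ Icc t0 t, a ^ 3 ≤ vpτ s ∧ vpτ s ≤ 2 * a ^ 3 := by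
    intro s hs
    have hs0 : 0 ≤ s := ht0.trans hs.1
    rw [vpτ_of_nonneg hs0]
    rw [vpτ_of_nonneg ht0] at haτ
    have h1 : s ≤ t0 + c * a := hs.2.trans htc
    have h2 : c * a ≤ a := by nlinarith
    have h3 : a ≤ a ^ 3 := le_self_pow₀ ha (by norm_num)
    exact ⟨by linarith [hs.1], by linarith⟩
  have hUm := vpUg_meas hg hF t0 (4 * P * a ^ 3) R z
  have hpt : ∀ s ∈ Icc t0 t, ENNReal.ofReal ‖(vpτ s)⁻¹ • F s (vpX F s z).1‖ ≤
      ENNReal.ofReal (a ^ 3)⁻¹ * (ENNReal.ofReal ((C1 + 2 * H0) * a ^ 5) + ∫⁻ w, vpUg g F t0 (4 * P * a ^ 3) R z s w) := by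
    intro s hs
    have hs0 : 0 ≤ s := ht0.trans hs.1
    obtain ⟨hτ1, hτ2⟩ := hτb s hs
    have hτp := vpτ_pos s
    rw [norm_smul, norm_inv, Real.norm_of_nonneg hτp.le, ENNReal.ofReal_mul (by positivity)]
    refine mul_le_mul' (ENNReal.ofReal_le_ofReal (by gcongr)) ?_
    refine (vp_field_lint hg0 h s hs0 _).trans ?_
    have hmp := vpX_mp h.ok1 s
    calc _ ≤ ∫⁻ w, ((vpTE δ M a P Q R (vpX F s z).1 (vpX F t0 z).2 (vpX F s w) +
            ENNReal.ofReal (a ^ 2 * (g w • ‖(vpX F s w).2‖ ^ 2))) + vpUg g F t0 (4 * P * a ^ 3) R z s w) := by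
          refine lintegral_mono fun w => ?_
          by_cases hw : g w = 0
          · simp [hw]
          have hwt : w ∈ tsupport g := subset_tsupport g hw
          exact vp_pf_point (hg0 w) (hM w) ha hP hPQ hR (hb w hwt s hs) (hq w hwt) (vp_norm_inv_smul_le _)
      _ = (∫⁻ w, vpTE δ M a P Q R (vpX F s z).1 (vpX F t0 z).2 (vpX F s w)) +
            (∫⁻ w, ENNReal.ofReal (a ^ 2 * (g w • ‖(vpX F s w).2‖ ^ 2))) + ∫⁻ w, vpUg g F t0 (4 * P * a ^ 3) R z s w := by
          rw [lintegral_add_right _ (hUm.of_uncurry_left (x := s)), lintegral_add_left]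
          exact (vpTE_meas _ _ _ _ _ _ _ _).comp hmp.measurable
      _ ≤ ENNReal.ofReal (C1 * a ^ 5) + ENNReal.ofReal (2 * H0 * a ^ 5) + ∫⁻ w, vpUg g F t0 (4 * P * a ^ 3) R z s w := by
          gcongr
          · rw [hmp.lintegral_comp (vpTE_meas _ _ _ _ _ _ _ _)]
            exact vpTE_int δ M a P Q R _ _ hM0 ha hP.le hQ hR.le
          · rw [vp_lint_K hg hgc hg0 hF s _ (by positivity)]
            apply ENNReal.ofReal_le_ofReal
            calc a ^ 2 * vpK g F s ≤ a ^ 2 * (H0 * (2 * a ^ 3)) := by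
                  have := hK s hs0
                  have : H0 * vpτ s ≤ H0 * (2 * a ^ 3) := by gcongr
                  gcongr; linarith
              _ = _ := by ring
      _ = _ := by
          rw [← ENNReal.ofReal_add (by positivity) (by positivity), add_mul]
  have hug : ∫⁻ s in Icc t0 t, ∫⁻ w, vpUg g F t0 (4 * P * a ^ 3) R z s w ≤
      ENNReal.ofReal (4 * π * a ^ 3 * (P * R)⁻¹ * (H0 * a ^ 3)) := by
    rw [lintegral_lintegral_swap hUm.aemeasurable]
    calc _ ≤ ∫⁻ w, ENNReal.ofReal (4 * π * a ^ 3 * (P * R)⁻¹ * (g w • ‖(vpX F t0 w).2‖ ^ 2)) := by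
          refine lintegral_mono fun w => ?_
          by_cases hw : g w = 0
          · simp [vpUg, hw]
          have hwt : w ∈ tsupport g := subset_tsupport g hw
          exact vp_ugly hg0 hF ha hP hR ht0 haτ ht htc hc (hb z hz) (hb w hwt)
      _ ≤ _ := by
          rw [vp_lint_K hg hgc hg0 hF t0 _ (by positivity)]
          apply ENNReal.ofReal_le_ofReal
          have := hK t0 ht0
          rw [← haτ] at this
          gcongr
  calc _ ≤ ∫⁻ s in Icc t0 t, ENNReal.ofReal (a ^ 3)⁻¹ * (ENNReal.ofReal ((C1 + 2 * H0) * a ^ 5) + ∫⁻ w, vpUg g F t0 (4 * P * a ^ 3) R z s w) :=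
        setLIntegral_mono' measurableSet_Icc hpt
    _ = ENNReal.ofReal (a ^ 3)⁻¹ * (ENNReal.ofReal ((C1 + 2 * H0) * a ^ 5) * ENNReal.ofReal (t - t0) +
          ∫⁻ s in Icc t0 t, ∫⁻ w, vpUg g F t0 (4 * P * a ^ 3) R z s w) := by
        rw [lintegral_const_mul' _ _ ENNReal.ofReal_ne_top, lintegral_add_left measurable_const, setLIntegral_const, Real.volume_Icc]
    _ ≤ ENNReal.ofReal (a ^ 3)⁻¹ * (ENNReal.ofReal ((C1 + 2 * H0) * a ^ 5) * ENNReal.ofReal (c * a) +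
          ENNReal.ofReal (4 * π * a ^ 3 * (P * R)⁻¹ * (H0 * a ^ 3))) := by
        gcongr; linarith
    _ = _ := by
        rw [← ENNReal.ofReal_mul (by positivity), ← ENNReal.ofReal_add (by positivity) (by positivity),
          ← ENNReal.ofReal_mul (by positivity)]
        congr 1
        field_simp

end Pfaff3


section Pfaff4
variable {g : Z3 → ℝ} {δ : ℝ} {F : ℝ → E3 → E3} {dF : ℝ → E3 → E3 →L[ℝ] E3}

lemma vp_boot {M H0 a P Q R t0 c : ℝ} (hδ : 0 < δ) (hg : Continuous g) (hgc : HasCompactSupport g) (hg0 : ∀ z, 0 ≤ g z)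
    (hM : ∀ z, g z ≤ M) (h : VPReg g δ F dF) (hH0 : 0 ≤ H0) (hK : ∀ s, 0 ≤ s → vpK g F s ≤ H0 * vpτ s)
    (ha : 1 ≤ a) (hP : 0 < P) (hR : 0 < R) (hPQ : P ≤ Q)
    (ht0 : 0 ≤ t0) (haτ : a ^ 3 = vpτ t0) (hc0 : 0 < c) (hc : c ≤ 1)
    (hq : ∀ z ∈ tsupport g, ‖(vpX F t0 z).2‖ ≤ Q * a ^ 5)
    (hcon : c * (M * (4 * vpκ ^ 2 + 432 * vpκ ^ 2 * P ^ 3 + 6 * vpκ ^ 2 * R * Q) + 2 * H0)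
      + 4 * π * H0 * (P * R)⁻¹ ≤ P / 2) :
    ∀ t ∈ Icc t0 (t0 + c * a), ∀ z ∈ tsupport g, ‖(vpX F t z).2 - (vpX F t0 z).2‖ ≤ P * a ^ 3 := by
  have hF := h.ok1.ok
  have ha0 : 0 < a := by linarith
  have hPa : 0 < P * a ^ 3 := by positivity
  set S : Set ℝ := {t | ∀ θ ∈ Icc (0:ℝ) 1, ∀ z ∈ tsupport g,
    ‖(vpX F (t0 + θ * (t - t0)) z).2 - (vpX F t0 z).2‖ ≤ P * a ^ 3} with hS
  have hSc : IsClosed S := by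
    have : S = ⋂ θ ∈ Icc (0:ℝ) 1, ⋂ z ∈ tsupport g,
        {t | ‖(vpX F (t0 + θ * (t - t0)) z).2 - (vpX F t0 z).2‖ ≤ P * a ^ 3} := by
      ext t; simp [hS]
    rw [this]
    refine isClosed_biInter fun θ _ => isClosed_biInter fun z _ => ?_
    refine isClosed_le (Continuous.norm ?_) continuous_const
    have h1 := (vpX_momentum_cont hF z).comp (by fun_prop : Continuous fun t : ℝ => t0 + θ * (t - t0))
    exact h1.sub continuous_const
  have hmem : ∀ t, t0 ≤ t → (t ∈ S ↔ ∀ s ∈ Icc t0 t, ∀ z ∈ tsupport g, ‖(vpX F s z).2 - (vpX F t0 z).2‖ ≤ P * a ^ 3) := by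
    intro t ht
    constructor
    · intro hts s hs z hz
      rcases ht.eq_or_lt with rfl | hlt
      · have : s = t0 := le_antisymm hs.2 hs.1
        subst this; simpa using hPa.le
      have hpos : 0 < t - t0 := by linarith
      have := hts ((s - t0) / (t - t0)) ⟨div_nonneg (by linarith [hs.1]) hpos.le, (div_le_one hpos).mpr (by linarith [hs.2])⟩ z hz
      rwa [div_mul_cancel₀ _ hpos.ne', add_sub_cancel] at this
    · intro hts θ hθ z hz
      refine hts _ ⟨?_, ?_⟩ z hz
      · nlinarith [hθ.1]
      · nlinarith [hθ.2]
  have hsub : Icc t0 (t0 + c * a) ⊆ S := by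
    refine IsClosed.Icc_subset_of_forall_exists_gt (hSc.inter isClosed_Icc) ?_ ?_
    · rw [hmem t0 le_rfl]
      intro s hs z hz
      have : s = t0 := le_antisymm hs.2 hs.1
      subst this; simpa using hPa.le
    · rintro x ⟨hxS, hx1, hx2⟩ y hy
      rw [hmem x hx1] at hxS
      have hstr : ∀ z ∈ tsupport g, ‖(vpX F x z).2 - (vpX F t0 z).2‖ < P * a ^ 3 := by
        intro z hz
        have h1 := vp_step hδ hg hgc hg0 hM h hH0 hK ha hP hR hPQ ht0 haτ hx1 hx2.le hc0.le hc hq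
          (fun w hw s hs => hxS s hs w hw) z hz
        refine h1.trans_lt ?_
        have : 0 < a ^ 3 := by positivity
        nlinarith
      have hev : ∀ᶠ s in 𝓝 x, ∀ z ∈ tsupport g, ‖(vpX F s z).2 - (vpX F t0 z).2‖ < P * a ^ 3 := by
        refine hgc.isCompact.eventually_forall_of_forall_eventually fun z hz => ?_
        have hc1 : Continuous fun q : ℝ × Z3 => ‖(vpX F q.1 q.2).2 - (vpX F t0 q.2).2‖ := by
          have h1 : Continuous fun q : ℝ × Z3 => (vpX F q.1 q.2).2 := continuous_snd.comp (vpX_cont hF)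
          have h2 := h1.comp (by fun_prop : Continuous fun q : ℝ × Z3 => (t0, q.2))
          exact (h1.sub h2).norm
        exact hc1.continuousAt.eventually_lt continuousAt_const (hstr z hz)
      obtain ⟨ε, hε, hball⟩ := Metric.eventually_nhds_iff.mp hev
      have hy' : x < y := hy
      refine ⟨min y (x + ε / 2), ?_, lt_min hy' (by linarith), min_le_left _ _⟩
      rw [hmem _ (hx1.trans (le_min hy'.le (by linarith)))]
      intro s hs z hz
      by_cases hsx : s ≤ x
      · exact hxS s ⟨hs.1, hsx⟩ z hz
      · push Not at hsx
        refine (hball ?_ z hz).le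
        rw [Real.dist_eq, abs_of_pos (by linarith)]
        have := hs.2.trans (min_le_right _ _)
        linarith
  intro t ht z hz
  exact (hmem t ht.1).mp (hsub ht) t ⟨ht.1, le_rfl⟩ z hz

/-- constants -/
lemma vp_consts (M H0 q0 : ℝ) (hM : 0 ≤ M) (hH0 : 0 ≤ H0) : ∃ P R c Q : ℝ, 0 < P ∧ 0 < R ∧ 0 < c ∧ c ≤ 1 ∧ P ≤ Q ∧ q0 ≤ Q ∧
    Q * c = P ∧ c * (M * (4 * vpκ ^ 2 + 432 * vpκ ^ 2 * P ^ 3 + 6 * vpκ ^ 2 * R * Q) + 2 * H0)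
      + 4 * π * H0 * (P * R)⁻¹ ≤ P / 2 := by
  have hκ := vpκ_nonneg
  set R := (1 / (48 * (vpκ ^ 2 * M + 1)) : ℝ) with hR
  have hRp : 0 < R := by positivity
  have hRb : 6 * vpκ ^ 2 * R * M ≤ 1 / 8 := by
    rw [hR]
    have : 0 < vpκ ^ 2 * M + 1 := by positivity
    rw [show 6 * vpκ ^ 2 * (1 / (48 * (vpκ ^ 2 * M + 1))) * M = (vpκ ^ 2 * M) / (8 * (vpκ ^ 2 * M + 1)) by field_simp; ring]
    rw [div_le_div_iff₀ (by positivity) (by norm_num)]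
    linarith
  set P := max 1 (max q0 (32 * π * H0 / R)) with hP
  have hP1 : 1 ≤ P := le_max_left _ _
  have hPq : q0 ≤ P := (le_max_left _ _).trans (le_max_right _ _)
  have hPH : 32 * π * H0 / R ≤ P := (le_max_right _ _).trans (le_max_right _ _)
  have hPp : 0 < P := by linarith
  set D := M * (4 * vpκ ^ 2 + 432 * vpκ ^ 2 * P ^ 3) + 2 * H0 with hD
  have hD0 : 0 ≤ D := by positivity
  set c := 1 / (8 * (D + 1)) with hc
  have hcp : 0 < c := by positivity
  have hc1 : c ≤ 1 := by rw [hc, div_le_one (by positivity)]; linarith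
  have hcD : c * D ≤ P / 8 := by
    have : c * D ≤ 1 / 8 := by
      rw [hc, div_mul_eq_mul_div, div_le_div_iff₀ (by positivity) (by norm_num)]; linarith
    linarith
  have hPQ : P ≤ P / c := by rw [le_div_iff₀ hcp]; nlinarith
  refine ⟨P, R, c, P / c, hPp, hRp, hcp, hc1, hPQ, hPq.trans hPQ, div_mul_cancel₀ _ hcp.ne', ?_⟩
  have h1 : 4 * π * H0 * (P * R)⁻¹ ≤ P / 8 := by
    have h2 : 4 * π * H0 * (P * R)⁻¹ = (32 * π * H0 / R) / (8 * P) := by field_simp; ring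
    rw [h2, div_le_div_iff₀ (by positivity) (by norm_num)]
    nlinarith
  have h3 : c * (M * (4 * vpκ ^ 2 + 432 * vpκ ^ 2 * P ^ 3 + 6 * vpκ ^ 2 * R * (P / c)) + 2 * H0)
      = c * D + 6 * vpκ ^ 2 * R * M * P := by
    rw [hD]; field_simp; ring
  rw [h3]
  nlinarith

end Pfaff4


section Moment
variable {g : Z3 → ℝ} {δ : ℝ} {F : ℝ → E3 → E3} {dF : ℝ → E3 → E3 →L[ℝ] E3}

lemma vp_cbrt {x : ℝ} (hx : 1 ≤ x) : ∃ a : ℝ, 1 ≤ a ∧ a ^ 3 = x ∧ a ^ 5 = x ^ ((5:ℝ)/3) := by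
  have hx0 : 0 ≤ x := by linarith
  refine ⟨x ^ ((1:ℝ)/3), Real.one_le_rpow hx (by norm_num), ?_, ?_⟩
  · rw [← Real.rpow_natCast, ← Real.rpow_mul hx0]; norm_num
  · rw [← Real.rpow_natCast, ← Real.rpow_mul hx0]; norm_num

lemma vp_moment (hg : Continuous g) (hgc : HasCompactSupport g) (hg0 : ∀ z, 0 ≤ g z) :
    ∃ C : ℝ, 0 < C ∧ ∀ δ F dF, 0 < δ → VPReg g δ F dF → ∀ t, 0 ≤ t → ∀ z ∈ tsupport g,
      ‖(vpX F t z).1‖ ≤ C * (vpτ t) ^ ((2:ℝ)/3) ∧ ‖(vpX F t z).2‖ ≤ C * (vpτ t) ^ ((5:ℝ)/3) := by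
  obtain ⟨H0, hH0, hE⟩ := vp_energy0 hg hgc hg0
  obtain ⟨M, hM⟩ := hg.bounded_above_of_compact_support hgc
  have hM' : ∀ z, g z ≤ M := fun z => (le_abs_self _).trans (hM z)
  have hM0 : 0 ≤ M := (hg0 0).trans (hM' 0)
  obtain ⟨q0, hq0⟩ := hgc.isBounded.exists_norm_le
  obtain ⟨P, R, c, Q, hP, hR, hc0, hc1, hPQ, hqQ, hQc, hcon⟩ := vp_consts M H0 q0 hM0 hH0
  have hQp : 0 < Q := hP.trans_le hPQ
  refine ⟨3 * Q + |q0|, by positivity, fun δ F dF hδ h => ?_⟩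
  have hF := h.ok1.ok
  have hK := hE δ F dF hδ h
  have hind : ∀ n : ℕ, ∃ tn : ℝ, 0 ≤ tn ∧ c * n ≤ tn ∧
      (∀ z ∈ tsupport g, ∀ a, 1 ≤ a → a ^ 3 = vpτ tn → ‖(vpX F tn z).2‖ ≤ Q * a ^ 5) ∧
      ∀ t ∈ Icc 0 tn, ∀ z ∈ tsupport g, ‖(vpX F t z).2‖ ≤ 2 * Q * (vpτ t) ^ ((5:ℝ)/3) := by
    intro n
    induction n with
    | zero =>
      have h0 : ∀ z ∈ tsupport g, ‖(vpX F 0 z).2‖ ≤ Q := by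
        intro z hz
        rw [vpX_zero hF]
        exact (norm_snd_le z).trans ((hq0 z hz).trans hqQ)
      refine ⟨0, le_rfl, by simp, ?_, ?_⟩
      · intro z hz a ha _
        refine (h0 z hz).trans ?_
        exact le_mul_of_one_le_right hQp.le (one_le_pow₀ ha)
      · intro t ht z hz
        have : t = 0 := le_antisymm ht.2 ht.1
        subst this
        refine (h0 z hz).trans ?_
        rw [vpτ_of_nonneg le_rfl]; simp; linarith
    | succ n ih =>
      obtain ⟨t0, ht0, hcn, hq, hall⟩ := ih
      obtain ⟨a, ha, ha3, ha5⟩ := vp_cbrt (vpτ_ge_one ht0)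
      have ha0 : 0 < a := by linarith
      have hb := vp_boot hδ hg hgc hg0 hM' h hH0 hK ha hP hR hPQ ht0 ha3 hc0 hc1 (fun z hz => hq z hz a ha ha3) hcon
      have hp : ∀ t ∈ Icc t0 (t0 + c * a), ∀ z ∈ tsupport g, ‖(vpX F t z).2‖ ≤ Q * a ^ 5 + P * a ^ 3 := by
        intro t ht z hz
        have h1 := hb t ht z hz
        have h2 := hq z hz a ha ha3
        have h3 : ‖(vpX F t z).2‖ ≤ ‖(vpX F t z).2 - (vpX F t0 z).2‖ + ‖(vpX F t0 z).2‖ := by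
          simpa using norm_add_le ((vpX F t z).2 - (vpX F t0 z).2) (vpX F t0 z).2
        linarith
      have hca : 0 ≤ c * a := by positivity
      refine ⟨t0 + c * a, by positivity, ?_, ?_, ?_⟩
      · push_cast; nlinarith
      · intro z hz b hb1 hb3
        refine (hp _ ⟨by linarith, le_rfl⟩ z hz).trans ?_
        rw [vpτ_of_nonneg (by positivity)] at hb3
        rw [vpτ_of_nonneg ht0] at ha3
        have hb3' : b ^ 3 = a ^ 3 + c * a := by linarith
        have hab : a ≤ b := by
          refine le_of_pow_le_pow_left₀ (n := 3) (by norm_num) (by linarith) ?_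
          linarith
        have h2 : a ^ 2 ≤ b ^ 2 := pow_le_pow_left₀ ha0.le hab 2
        calc Q * a ^ 5 + P * a ^ 3 = Q * ((a ^ 3 + c * a) * a ^ 2) := by rw [← hQc]; ring
          _ ≤ Q * (b ^ 3 * b ^ 2) := by rw [← hb3']; gcongr
          _ = _ := by ring
      · intro t ht z hz
        by_cases htt : t ≤ t0
        · exact hall t ⟨ht.1, htt⟩ z hz
        · push Not at htt
          refine (hp t ⟨htt.le, ht.2⟩ z hz).trans ?_
          have h35 : a ^ 3 ≤ a ^ 5 := pow_le_pow_right₀ ha (by norm_num)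
          have hle : a ^ 5 ≤ (vpτ t) ^ ((5:ℝ)/3) := by
            rw [ha5]
            refine Real.rpow_le_rpow (vpτ_pos t0).le ?_ (by norm_num)
            rw [vpτ_of_nonneg ht0, vpτ_of_nonneg ht.1]; linarith
          have ha3p : 0 < a ^ 3 := by positivity
          nlinarith
  have hmom : ∀ t, 0 ≤ t → ∀ z ∈ tsupport g, ‖(vpX F t z).2‖ ≤ 2 * Q * (vpτ t) ^ ((5:ℝ)/3) := by
    intro t ht z hz
    obtain ⟨n, hn⟩ := exists_nat_ge (t / c)
    obtain ⟨tn, -, htn, -, hall⟩ := hind n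
    refine hall t ⟨ht, ?_⟩ z hz
    rw [div_le_iff₀ hc0] at hn; linarith
  intro t ht z hz
  have hpow0 : 0 ≤ (vpτ t) ^ ((5:ℝ)/3) := Real.rpow_nonneg (vpτ_pos t).le _
  constructor
  swap
  · refine (hmom t ht z hz).trans ?_
    gcongr
    have := abs_nonneg q0
    linarith
  have hB' : ∀ s ∈ Ico 0 t, HasDerivWithinAt (fun s => |q0| + 3 * Q * (vpτ s) ^ ((2:ℝ)/3)) (2 * Q * (vpτ s) ^ (-(1:ℝ)/3)) (Ici s) s := by
    intro s hs
    have h1 := ((vpτ_deriv' hs.1).rpow_const (p := (2:ℝ)/3) (Or.inl (vpτ_pos s).ne')).const_mul (3 * Q)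
    have h2 : HasDerivAt (fun s => |q0| + 3 * Q * (vpτ s) ^ ((2:ℝ)/3)) _ s := h1.const_add |q0|
    refine (h2.congr_deriv ?_).hasDerivWithinAt
    norm_num
    ring
  have key := image_norm_le_of_norm_deriv_right_le_deriv_boundary' (a := 0) (b := t) (f := fun s => (vpX F s z).1)
    (f' := fun s => (vpτ s ^ 2)⁻¹ • (vpX F s z).2)
    (vpX_pos_cont hF z).continuousOn (fun s hs => (vpX_deriv1 hF s z).hasDerivWithinAt)
    (B := fun s => |q0| + 3 * Q * (vpτ s) ^ ((2:ℝ)/3)) (B' := fun s => 2 * Q * (vpτ s) ^ (-(1:ℝ)/3))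
    (by
      simp only [vpX_zero hF, vpτ_of_nonneg le_rfl]
      have h1 := (norm_fst_le z).trans ((hq0 z hz).trans (le_abs_self q0))
      simp; linarith)
    (by
      refine continuousOn_const.add (continuousOn_const.mul ?_)
      exact (vpτ_cont.continuousOn).rpow_const fun s _ => Or.inl (vpτ_pos s).ne')
    hB'
    (by
      intro s hs
      have hτ := vpτ_pos s
      rw [norm_smul, norm_inv, norm_pow, Real.norm_of_nonneg hτ.le]
      refine (mul_le_mul_of_nonneg_left (hmom s hs.1 z hz) (by positivity)).trans (le_of_eq ?_)
      have h3 : (vpτ s) ^ ((5:ℝ)/3) = (vpτ s) ^ 2 * (vpτ s) ^ (-(1:ℝ)/3) := by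
        rw [← Real.rpow_natCast, ← Real.rpow_add hτ]; norm_num
      rw [h3]; field_simp)
  have h1 := key (⟨ht, le_rfl⟩ : t ∈ Icc 0 t)
  refine h1.trans ?_
  have h2 : 1 ≤ (vpτ t) ^ ((2:ℝ)/3) := Real.one_le_rpow (vpτ_ge_one ht) (by norm_num)
  have := abs_nonneg q0
  nlinarith

end Moment


/-- bounded, compactly supported continuous phase-space densities -/
structure VPDens (M R : ℝ) (h : Z3 → ℝ) : Prop where
  cont : Continuous h
  bd : ∀ w, |h w| ≤ M
  supp : ∀ w, h w ≠ 0 → ‖w‖ < R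

lemma VPDens.M0 {M R h} (H : VPDens M R h) : 0 ≤ M := (abs_nonneg _).trans (H.bd 0)

lemma VPDens.cs {M R h} (H : VPDens M R h) : HasCompactSupport h := by
  refine HasCompactSupport.of_support_subset_isCompact (isCompact_closedBall (0 : Z3) R) ?_
  intro w hw
  simpa using (H.supp w hw).le

lemma vp_conv0 {H : Z3 → ℝ} {ε R : ℝ} (hε : 0 ≤ ε) (hR : 0 ≤ R) (hb : ∀ w, |H w| ≤ ε)
    (hs : ∀ w, H w ≠ 0 → ‖w.2‖ < R) (A : E3 → ENNReal) (hA : Measurable A) (x : E3) :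
    ∫⁻ w : Z3, ENNReal.ofReal |H w| * A (x - w.1) ≤ ENNReal.ofReal (ε * (vpκ * R ^ 3)) * ∫⁻ y, A y := by
  set B : E3 → ENNReal := (Metric.ball (0:E3) R).indicator 1 with hB
  have hBm : Measurable B := measurable_one.indicator Metric.isOpen_ball.measurableSet
  calc ∫⁻ w : Z3, ENNReal.ofReal |H w| * A (x - w.1)
      ≤ ∫⁻ w : Z3, ENNReal.ofReal ε * (A (x - w.1) * B w.2) := by
        refine lintegral_mono fun w => ?_
        by_cases hw : H w = 0
        · simp [hw]
        · have : B w.2 = 1 := by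
            rw [hB, indicator_of_mem]; · rfl
            simpa using hs w hw
          rw [this, mul_one]
          gcongr
          exact hb w
    _ = ENNReal.ofReal ε * ((∫⁻ y, A y) * ∫⁻ p, B p) := by
        rw [lintegral_const_mul, vp_euler A hA x B hBm]
        exact (hA.comp (measurable_const.sub measurable_fst)).mul (hBm.comp measurable_snd)
    _ ≤ ENNReal.ofReal ε * ((∫⁻ y, A y) * ENNReal.ofReal (vpκ * R ^ 3)) := by
        gcongr
        rw [hB, lintegral_indicator_one Metric.isOpen_ball.measurableSet]
        exact vp_A3 R hR
    _ = _ := by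
        rw [ENNReal.ofReal_mul hε]; ring

lemma vp_conv1 {H : Z3 → ℝ} {ε R a c : ℝ} (hε : 0 ≤ ε) (hR : 0 ≤ R) (hb : ∀ w, |H w| ≤ ε)
    (hs : ∀ w, H w ≠ 0 → ‖w‖ < R) (A : E3 → ENNReal) (hA : Measurable A) (x : E3) (ha : 0 ≤ a) (hc : 0 ≤ c)
    (hAa : ∫⁻ y, (if ‖y‖ < 1 then A y else 0) ≤ ENNReal.ofReal a) (hAc : ∀ y, 1 ≤ ‖y‖ → A y ≤ ENNReal.ofReal c) :
    ∫⁻ w : Z3, ENNReal.ofReal |H w| * A (x - w.1) ≤ ENNReal.ofReal (ε * (vpκ * R ^ 3 * a + c * (vpκ * R ^ 3) ^ 2)) := by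
  have hκ := vpκ_nonneg
  have hs2 : ∀ w, H w ≠ 0 → ‖w.2‖ < R := fun w hw => (norm_snd_le w).trans_lt (hs w hw)
  set A1 : E3 → ENNReal := fun y => if ‖y‖ < 1 then A y else 0 with hA1
  have hA1m : Measurable A1 := Measurable.ite (measurableSet_lt (by fun_prop) (by fun_prop)) hA measurable_const
  set A2 : E3 → ENNReal := (Metric.ball (0:E3) R).indicator (fun _ => ENNReal.ofReal c) with hA2
  have hA2m : Measurable A2 := measurable_const.indicator Metric.isOpen_ball.measurableSet
  have hm1 : ∀ w : Z3, ENNReal.ofReal |H w| * A (x - w.1) ≤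
      ENNReal.ofReal |H w| * A1 (x - w.1) + ENNReal.ofReal |H w| * A2 (0 - w.1) := by
    intro w
    by_cases hw : H w = 0
    · simp [hw]
    · have h2 : A2 (0 - w.1) = ENNReal.ofReal c := by
        rw [hA2, indicator_of_mem]
        simpa using (norm_fst_le w).trans_lt (hs w hw)
      rw [h2, ← mul_add]
      gcongr
      by_cases hy : ‖x - w.1‖ < 1
      · simp [hA1, hy]
      · exact (hAc _ (not_lt.1 hy)).trans le_add_self
  have hb1 := vp_conv0 hε hR hb hs2 A1 hA1m x
  have hb2 := vp_conv0 hε hR hb hs2 A2 hA2m 0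
  have hi2 : ∫⁻ y, A2 y ≤ ENNReal.ofReal (c * (vpκ * R ^ 3)) := by
    rw [hA2, lintegral_indicator Metric.isOpen_ball.measurableSet, setLIntegral_const, ENNReal.ofReal_mul hc]
    gcongr
    exact vp_A3 R hR
  -- subadditivity of the lower integral without measurability of `H`: use an upper bound
  set B : E3 → ENNReal := (Metric.ball (0:E3) R).indicator 1 with hB
  have hBm : Measurable B := measurable_one.indicator Metric.isOpen_ball.measurableSet
  have hH : ∀ w : Z3, ENNReal.ofReal |H w| ≤ ENNReal.ofReal ε * B w.2 := by
    intro w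
    by_cases hw : H w = 0
    · simp [hw]
    · have : B w.2 = 1 := by
        rw [hB, indicator_of_mem]; · rfl
        simpa using hs2 w hw
      rw [this, mul_one]
      gcongr
      exact hb w
  calc ∫⁻ w : Z3, ENNReal.ofReal |H w| * A (x - w.1)
      ≤ ∫⁻ w : Z3, (ENNReal.ofReal ε * (A1 (x - w.1) * B w.2) + ENNReal.ofReal ε * (A2 (0 - w.1) * B w.2)) := by
        refine lintegral_mono fun w => (hm1 w).trans ?_
        have := hH w
        calc _ ≤ (ENNReal.ofReal ε * B w.2) * A1 (x - w.1) + (ENNReal.ofReal ε * B w.2) * A2 (0 - w.1) := by gcongr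
          _ = _ := by ring
    _ = ENNReal.ofReal ε * ((∫⁻ y, A1 y) * ∫⁻ p, B p) + ENNReal.ofReal ε * ((∫⁻ y, A2 y) * ∫⁻ p, B p) := by
        have m1 : Measurable fun w : Z3 => A1 (x - w.1) * B w.2 :=
          (hA1m.comp (measurable_const.sub measurable_fst)).mul (hBm.comp measurable_snd)
        have m2 : Measurable fun w : Z3 => A2 (0 - w.1) * B w.2 :=
          (hA2m.comp (measurable_const.sub measurable_fst)).mul (hBm.comp measurable_snd)
        rw [lintegral_add_left (m1.const_mul _), lintegral_const_mul _ m1, lintegral_const_mul _ m2, vp_euler A1 hA1m x B hBm,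
          vp_euler A2 hA2m 0 B hBm]
    _ ≤ ENNReal.ofReal ε * (ENNReal.ofReal a * ENNReal.ofReal (vpκ * R ^ 3)) +
        ENNReal.ofReal ε * (ENNReal.ofReal (c * (vpκ * R ^ 3)) * ENNReal.ofReal (vpκ * R ^ 3)) := by
        have : ∫⁻ p, B p ≤ ENNReal.ofReal (vpκ * R ^ 3) := by
          rw [hB, lintegral_indicator_one Metric.isOpen_ball.measurableSet]
          exact vp_A3 R hR
        gcongr
    _ = _ := by
        rw [← ENNReal.ofReal_mul ha, ← ENNReal.ofReal_mul (by positivity), ← ENNReal.ofReal_mul (by positivity),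
          ← ENNReal.ofReal_mul (by positivity), ← ENNReal.ofReal_add (by positivity) (by positivity)]
        congr 1; ring

/-- constant in the basic convolution bound -/
def vpB0 (R : ℝ) : ℝ := vpκ * R ^ 3 * vpκ + 1 * (vpκ * R ^ 3) ^ 2

lemma vpB0_nonneg {R : ℝ} (hR : 0 ≤ R) : 0 ≤ vpB0 R := by
  have := vpκ_nonneg; unfold vpB0; positivity

lemma vpk_meas (δ : ℝ) : Measurable (vpk δ) := by
  have := vph_meas δ
  unfold vpk; fun_prop

/-- smoothed field of a density -/
def vpCv (δ : ℝ) (h : Z3 → ℝ) (x : E3) : E3 := ∫ w : Z3, h w • vpk δ (x - w.1)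

lemma vp_normlint_le {V : Type*} [NormedAddCommGroup V] [NormedSpace ℝ V] {f : Z3 → V} {C : ℝ} (hC : 0 ≤ C)
    (h : ∫⁻ w, ENNReal.ofReal ‖f w‖ ≤ ENNReal.ofReal C) : ‖∫ w, f w‖ ≤ C := by
  have h1 : ‖∫ w, f w‖ₑ ≤ ∫⁻ w, ‖f w‖ₑ := enorm_integral_le_lintegral_enorm f
  have h2 : ∫⁻ w, ‖f w‖ₑ ≤ ENNReal.ofReal C := by simpa only [ofReal_norm] using h
  have h3 := h1.trans h2
  rw [← ofReal_norm] at h3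
  exact (ENNReal.ofReal_le_ofReal_iff hC).1 h3

lemma vp_cv_lint {H : Z3 → ℝ} {ε R : ℝ} (hε : 0 ≤ ε) (hR : 0 ≤ R) (hb : ∀ w, |H w| ≤ ε)
    (hs : ∀ w, H w ≠ 0 → ‖w‖ < R) (δ : ℝ) (x : E3) :
    ∫⁻ w : Z3, ENNReal.ofReal ‖H w • vpk δ (x - w.1)‖ ≤ ENNReal.ofReal (ε * vpB0 R) := by
  have := vp_conv1 hε hR hb hs (fun y => ENNReal.ofReal ‖vpk δ y‖) (by have := vpk_meas δ; fun_prop) x vpκ_nonneg zero_le_one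
    ?_ ?_
  · refine le_trans (le_of_eq ?_) this
    refine lintegral_congr fun w => ?_
    rw [norm_smul, ENNReal.ofReal_mul (norm_nonneg _), Real.norm_eq_abs]
  · refine le_trans ?_ ((vp_A1 1 zero_le_one).trans (le_of_eq (by rw [mul_one])))
    refine lintegral_mono fun y => ?_
    dsimp only
    split_ifs
    · exact ENNReal.ofReal_le_ofReal (vpk_norm_le δ y)
    · rfl
  · intro y hy
    refine ENNReal.ofReal_le_ofReal ((vpk_norm_le δ y).trans ?_)
    exact inv_le_one_of_one_le₀ (by nlinarith)

lemma vp_cv_int {M R : ℝ} {h : Z3 → ℝ} (H : VPDens M R h) (hR : 0 ≤ R) (δ : ℝ) (x : E3) :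
    Integrable fun w : Z3 => h w • vpk δ (x - w.1) := by
  refine ⟨?_, ?_⟩
  · have h1 := H.cont.measurable
    have h2 := vpk_meas δ
    exact Measurable.aestronglyMeasurable (by fun_prop)
  · have := vp_cv_lint H.M0 hR H.bd H.supp δ x
    rw [hasFiniteIntegral_iff_norm]
    exact this.trans_lt ENNReal.ofReal_lt_top

lemma vp_cv_bound {M R : ℝ} {h : Z3 → ℝ} (H : VPDens M R h) (hR : 0 ≤ R) (δ : ℝ) (x : E3) :
    ‖vpCv δ h x‖ ≤ M * vpB0 R :=
  vp_normlint_le (mul_nonneg H.M0 (vpB0_nonneg hR)) (vp_cv_lint H.M0 hR H.bd H.supp δ x)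

/-- D: change of density -/
lemma vp_cvD {M R ε : ℝ} {h1 h2 : Z3 → ℝ} (H1 : VPDens M R h1) (H2 : VPDens M R h2) (hR : 0 ≤ R)
    (hε : ∀ w, |h1 w - h2 w| ≤ ε) (δ : ℝ) (x : E3) : ‖vpCv δ h1 x - vpCv δ h2 x‖ ≤ ε * vpB0 R := by
  have hε0 : 0 ≤ ε := (abs_nonneg _).trans (hε 0)
  unfold vpCv
  rw [← integral_sub (vp_cv_int H1 hR δ x) (vp_cv_int H2 hR δ x)]
  simp_rw [← sub_smul]
  refine vp_normlint_le (mul_nonneg hε0 (vpB0_nonneg hR)) (vp_cv_lint hε0 hR hε ?_ δ x)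
  intro w hw
  by_cases h0 : h1 w = 0
  · exact H2.supp w (fun h => hw (by rw [h0, h, sub_zero]))
  · exact H1.supp w h0

lemma vp_kdiff_lint (δ d : ℝ) (hδ : 0 ≤ δ) (hd : 0 < d) :
    ∫⁻ y, ENNReal.ofReal ‖vpk δ y - vpk d y‖ ≤ ENNReal.ofReal (vpκ * (π * (δ + d))) := by
  have hκ := vpκ_nonneg
  have key : ∀ e : ℝ, 0 ≤ e → ∫⁻ y, ENNReal.ofReal ‖vpk e y - vpk 0 y‖ ≤ ENNReal.ofReal (vpκ * (π * e)) := by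
    intro e he
    rcases he.eq_or_lt with rfl | he'
    · simp
    · exact (lintegral_mono fun y => ENNReal.ofReal_le_ofReal (vpk_diff e he y)).trans (vp_A4 e he')
  have hm1 := vpk_meas δ
  have hm2 := vpk_meas d
  have hm3 := vpk_meas 0
  calc ∫⁻ y, ENNReal.ofReal ‖vpk δ y - vpk d y‖
      ≤ ∫⁻ y, (ENNReal.ofReal ‖vpk δ y - vpk 0 y‖ + ENNReal.ofReal ‖vpk d y - vpk 0 y‖) := by
        refine lintegral_mono fun y => ?_
        rw [← ENNReal.ofReal_add (norm_nonneg _) (norm_nonneg _)]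
        refine ENNReal.ofReal_le_ofReal ?_
        have : vpk δ y - vpk d y = (vpk δ y - vpk 0 y) - (vpk d y - vpk 0 y) := by abel
        rw [this]; exact norm_sub_le _ _
    _ = _ := lintegral_add_left (by fun_prop) _
    _ ≤ ENNReal.ofReal (vpκ * (π * δ)) + ENNReal.ofReal (vpκ * (π * d)) := add_le_add (key δ hδ) (key d hd.le)
    _ = _ := by
        rw [← ENNReal.ofReal_add (by positivity) (by positivity)]; congr 1; ring

lemma vp_convdiff {H : Z3 → ℝ} {ε R : ℝ} (hε : 0 ≤ ε) (hR : 0 ≤ R) (hb : ∀ w, |H w| ≤ ε)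
    (hs : ∀ w, H w ≠ 0 → ‖w.2‖ < R) (δ d : ℝ) (hδ : 0 ≤ δ) (hd : 0 < d) (x : E3) :
    ‖∫ w : Z3, H w • (vpk δ (x - w.1) - vpk d (x - w.1))‖ ≤ ε * (vpκ * R ^ 3) * (vpκ * (π * (δ + d))) := by
  have hκ := vpκ_nonneg
  refine vp_normlint_le (by positivity) ?_
  have hm1 := vpk_meas δ
  have hm2 := vpk_meas d
  have := vp_conv0 hε hR hb hs (fun y => ENNReal.ofReal ‖vpk δ y - vpk d y‖) (by fun_prop) x
  rw [ENNReal.ofReal_mul (by positivity)]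
  refine le_trans (le_of_eq ?_) (this.trans (by gcongr; exact vp_kdiff_lint δ d hδ hd))
  refine lintegral_congr fun w => ?_
  rw [norm_smul, ENNReal.ofReal_mul (norm_nonneg _), Real.norm_eq_abs]

/-- C: change of smoothing -/
lemma vp_cvC {M R : ℝ} {h : Z3 → ℝ} (H : VPDens M R h) (hR : 0 ≤ R) (δ d : ℝ) (hδ : 0 ≤ δ) (hd : 0 < d) (x : E3) :
    ‖vpCv δ h x - vpCv d h x‖ ≤ M * (vpκ * R ^ 3) * (vpκ * (π * (δ + d))) := by
  unfold vpCv
  rw [← integral_sub (vp_cv_int H hR δ x) (vp_cv_int H hR d x)]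
  simp_rw [← smul_sub]
  exact vp_convdiff H.M0 hR H.bd (fun w hw => (norm_snd_le w).trans_lt (H.supp w hw)) δ d hδ hd x

/-- B: Lipschitz bound of the change of smoothing -/
lemma vp_cvB {M R L : ℝ} {h : Z3 → ℝ} (H : VPDens M R h) (hR : 0 ≤ R) (hL : 0 ≤ L) (hLip : ∀ w w', |h w - h w'| ≤ L * ‖w - w'‖)
    (δ d : ℝ) (hδ : 0 ≤ δ) (hd : 0 < d) (x x' : E3) :
    ‖(vpCv δ h x' - vpCv d h x') - (vpCv δ h x - vpCv d h x)‖ ≤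
      (vpκ * R ^ 3) * (vpκ * (π * (δ + d))) * L * ‖x' - x‖ := by
  set e : Z3 := (x' - x, 0) with he
  have hde : ∀ y : E3, vpCv δ h y - vpCv d h y = ∫ w : Z3, h w • (vpk δ (y - w.1) - vpk d (y - w.1)) := by
    intro y
    unfold vpCv
    rw [← integral_sub (vp_cv_int H hR δ y) (vp_cv_int H hR d y)]
    simp_rw [← smul_sub]
  have hint : ∀ y : E3, Integrable fun w : Z3 => h w • (vpk δ (y - w.1) - vpk d (y - w.1)) := by
    intro y
    simp_rw [smul_sub]
    exact (vp_cv_int H hR δ y).sub (vp_cv_int H hR d y)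
  have heq : ∀ w : Z3, h (w + e) • (vpk δ (x' - (w + e).1) - vpk d (x' - (w + e).1)) =
      h (w + e) • (vpk δ (x - w.1) - vpk d (x - w.1)) := by
    intro w
    have : x' - (w + e).1 = x - w.1 := by rw [he]; simp only [Prod.fst_add]; abel
    rw [this]
  have h1 : ∫ w : Z3, h w • (vpk δ (x' - w.1) - vpk d (x' - w.1)) =
      ∫ w : Z3, h (w + e) • (vpk δ (x - w.1) - vpk d (x - w.1)) := by
    rw [← integral_add_right_eq_self (μ := (volume : Measure Z3)) _ e]
    exact integral_congr_ae (Eventually.of_forall heq)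
  have hi1 : Integrable fun w : Z3 => h (w + e) • (vpk δ (x - w.1) - vpk d (x - w.1)) := by
    have := (hint x').comp_add_right e
    exact this.congr (Eventually.of_forall heq)
  rw [hde x', hde x, h1, ← integral_sub hi1 (hint x)]
  simp_rw [← sub_smul]
  have hne : ‖e‖ = ‖x' - x‖ := by rw [he, Prod.norm_mk]; simp
  have := vp_convdiff (H := fun w => h (w + e) - h w) (ε := L * ‖x' - x‖) (R := R) (by positivity) hR
    (fun w => by
      refine (hLip _ _).trans (le_of_eq ?_)
      rw [add_sub_cancel_left, hne])
    (fun w hw => by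
      by_cases h0 : h w = 0
      · have : h (w + e) ≠ 0 := fun h => hw (by simp only [h, h0, sub_zero])
        have h2 := (norm_snd_le (w + e)).trans_lt (H.supp _ this)
        simpa [he] using h2
      · exact (norm_snd_le w).trans_lt (H.supp w h0)) δ d hδ hd x
  refine this.trans (le_of_eq (by ring))

/-- derivative of the smoothed field -/
def vpdCv (δ : ℝ) (h : Z3 → ℝ) (x : E3) : E3 →L[ℝ] E3 := ∫ w : Z3, h w • vpdk δ (x - w.1)

lemma vp_cv_deriv {M R : ℝ} {h : Z3 → ℝ} (H : VPDens M R h) (d : ℝ) (hd : 0 < d) (x : E3) :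
    HasFDerivAt (vpCv d h) (vpdCv d h x) x := by
  refine vp_dpi (F := fun x (w : Z3) => vpk d (x - w.1)) (F' := fun x (w : Z3) => vpdk d (x - w.1)) H.cont H.cs ?_ ?_ ?_ x
  · intro x
    exact (vpk_cont d hd).comp (by fun_prop)
  · exact (vpdk_cont d hd).comp (by fun_prop : Continuous fun q : E3 × Z3 => q.1 - q.2.1)
  · intro x w
    have h2 := (vpk_hasFDerivAt d hd (x - w.1)).comp x ((hasFDerivAt_id x).sub_const w.1)
    exact h2

/-- A: logarithmic Lipschitz bound -/
lemma vp_cvA {M R : ℝ} {h : Z3 → ℝ} (H : VPDens M R h) (hR : 0 ≤ R) (d : ℝ) (hd : 0 < d) (x x' : E3) :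
    ‖vpCv d h x' - vpCv d h x‖ ≤
      M * (vpκ * R ^ 3 * (4 * (vpκ * (2 * Real.log (1 + d⁻¹)))) + 4 * (vpκ * R ^ 3) ^ 2) * ‖x' - x‖ := by
  have hκ := vpκ_nonneg
  have hM := H.M0
  have hlog : 0 ≤ Real.log (1 + d⁻¹) := Real.log_nonneg (by have := inv_pos.2 hd; linarith)
  refine Convex.norm_image_sub_le_of_norm_hasFDerivWithin_le (𝕜 := ℝ) (s := univ) (f' := vpdCv d h)
    (fun z _ => (vp_cv_deriv H d hd z).hasFDerivWithinAt) (fun z _ => ?_) convex_univ (mem_univ x) (mem_univ x')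
  refine vp_normlint_le (by positivity) ?_
  have hm := vph_meas d
  have := vp_conv1 hM hR H.bd H.supp (fun y => ENNReal.ofReal (4 * (vph d y) ^ 3)) (by fun_prop) z
    (a := 4 * (vpκ * (2 * Real.log (1 + d⁻¹)))) (c := 4) (by positivity) (by norm_num) ?_ ?_
  · refine le_trans (lintegral_mono fun w => ?_) this
    rw [norm_smul, ENNReal.ofReal_mul (norm_nonneg _), Real.norm_eq_abs]
    gcongr
    exact vpdk_norm_le _ _
  · rw [ENNReal.ofReal_mul (by norm_num)]
    have h5 := vp_A5 d hd
    have : ∀ y : E3, (if ‖y‖ < 1 then ENNReal.ofReal (4 * (vph d y) ^ 3) else 0) =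
        ENNReal.ofReal 4 * (if ‖y‖ < 1 then ENNReal.ofReal ((vph d y) ^ 3) else 0) := by
      intro y
      split_ifs
      · rw [ENNReal.ofReal_mul (by norm_num)]
      · simp
    simp_rw [this]
    rw [lintegral_const_mul]
    · gcongr
    · exact Measurable.ite (measurableSet_lt (by fun_prop) (by fun_prop)) (by fun_prop) measurable_const
  · intro y hy
    refine ENNReal.ofReal_le_ofReal ?_
    have h1 : vph d y ≤ 1 := by
      have := vph_mul_norm d y
      nlinarith [vph_nonneg d y]
    have : vph d y ^ 3 ≤ 1 := pow_le_one₀ (vph_nonneg d y) h1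
    linarith


/-- inverse flow: initial point of the characteristic through `w` at time `t` -/
def vpG (F : ℝ → E3 → E3) (t : ℝ) (w : Z3) : Z3 := vpSol (vpb F) t w 0

section
variable {F : ℝ → E3 → E3} {dF : ℝ → E3 → E3 →L[ℝ] E3} {g : Z3 → ℝ} {δ : ℝ}

lemma vpX_G (hF : VPOk F) (t : ℝ) (w : Z3) : vpX F t (vpG F t w) = w := by
  unfold vpX vpG
  rw [vpSol_comp (vpb_ok hF), vpSol_self (vpb_ok hF)]

lemma vpG_X (hF : VPOk F) (t : ℝ) (z : Z3) : vpG F t (vpX F t z) = z := by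
  unfold vpX vpG
  rw [vpSol_comp (vpb_ok hF), vpSol_self (vpb_ok hF)]

lemma vpG_zero (hF : VPOk F) (w : Z3) : vpG F 0 w = w := vpSol_self (vpb_ok hF) 0 w

lemma vpG_cont (hF : VPOk F) : Continuous fun q : ℝ × Z3 => vpG F q.1 q.2 := vpInv_cont (vpb_ok hF)

lemma vpG_cont1 (hF : VPOk F) (t : ℝ) : Continuous (vpG F t) := by
  have h : Continuous fun z : Z3 => (t, z) := by fun_prop
  have h2 := (vpG_cont hF).comp h
  exact h2

lemma vpX_cont1 (hF : VPOk F) (t : ℝ) : Continuous (vpX F t) := by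
  have h : Continuous fun z : Z3 => (t, z) := by fun_prop
  have h2 := (vpX_cont hF).comp h
  exact h2

lemma vp_pull (hF : VPOk1 F dF) (t : ℝ) (x : E3) (g : Z3 → ℝ) (δ : ℝ) :
    ∫ z, g z • vpk δ (x - (vpX F t z).1) = vpCv δ (fun w => g (vpG F t w)) x := by
  have hemb : MeasurableEmbedding (vpX F t) :=
    (Homeomorph.mk (Equiv.mk (vpX F t) (vpG F t) (vpG_X hF.ok t) (vpX_G hF.ok t)) (vpX_cont1 hF.ok t)
      (vpG_cont1 hF.ok t)).measurableEmbedding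
  unfold vpCv
  rw [← (vpX_mp hF t).integral_comp hemb (fun w => g (vpG F t w) • vpk δ (x - w.1))]
  refine integral_congr_ae (Eventually.of_forall fun z => ?_)
  simp only [vpG_X hF.ok]

lemma vpReg_cv (h : VPReg g δ F dF) (t : ℝ) (ht : 0 ≤ t) (x : E3) :
    F t x = vpCv δ (fun w => g (vpG F t w)) x := by
  rw [vpReg_self h t ht x, vp_pull h.ok1]

end

/-- uniform bounds on densities -/
lemma vp_dens {g : Z3 → ℝ} (hg : Continuous g) (hgc : HasCompactSupport g) (hg0 : ∀ z, 0 ≤ g z) (T : ℝ) :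
    ∃ M R : ℝ, 0 ≤ R ∧ ∀ δ F dF, 0 < δ → VPReg g δ F dF → ∀ t, 0 ≤ t → t ≤ T → VPDens M R (fun w => g (vpG F t w)) := by
  obtain ⟨C, hC, hm⟩ := vp_moment hg hgc hg0
  obtain ⟨M, hM⟩ := hgc.exists_bound_of_continuous hg
  refine ⟨M, C * (1 + |T|) ^ ((5:ℝ) / 3) + 1, by positivity, fun δ F dF hδ h t ht htT => ⟨?_, fun w => hM _, ?_⟩⟩
  · exact hg.comp (vpG_cont1 h.ok1.ok t)
  · intro w hw
    obtain ⟨h1, h2⟩ := hm δ F dF hδ h t ht _ (subset_tsupport g hw)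
    rw [vpX_G h.ok1.ok, vpτ_of_nonneg ht] at h1 h2
    have hle : 1 + t ≤ 1 + |T| := by linarith [le_abs_self T]
    have e1 : (1 + t) ^ ((2:ℝ) / 3) ≤ (1 + |T|) ^ ((5:ℝ) / 3) :=
      (Real.rpow_le_rpow (by linarith) hle (by norm_num)).trans
        (Real.rpow_le_rpow_of_exponent_le (by linarith [abs_nonneg T]) (by norm_num))
    have e2 : (1 + t) ^ ((5:ℝ) / 3) ≤ (1 + |T|) ^ ((5:ℝ) / 3) :=
      Real.rpow_le_rpow (by linarith) hle (by norm_num)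
    rw [Prod.norm_def]
    have e3 := mul_le_mul_of_nonneg_left e1 hC.le
    have e4 := mul_le_mul_of_nonneg_left e2 hC.le
    refine max_lt (by linarith) (by linarith)

lemma vp_iter {ι : Type*} (val wt : ι → ℝ) (hwt : ∀ i, 0 ≤ wt i) (C N0 : ℝ) (hC : 0 < C) (hN0 : 0 < N0)
    (h0 : ∀ i, val i ≤ N0 * wt i)
    (step : ∀ N, 0 < N → (∀ i, val i ≤ N * wt i) → ∀ i, val i ≤ (C + N / 2) * wt i) (i : ι) :
    val i ≤ 2 * C * wt i := by
  have key : ∀ n : ℕ, ∀ i, val i ≤ (2 * C + N0 * (1 / 2) ^ n) * wt i := by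
    intro n
    induction n with
    | zero =>
      intro i
      refine (h0 i).trans (mul_le_mul_of_nonneg_right ?_ (hwt i))
      simp; linarith
    | succ k ih =>
      intro i
      refine (step _ (by positivity) ih i).trans (le_of_eq ?_)
      rw [pow_succ]; ring
  have hl : Tendsto (fun n : ℕ => (2 * C + N0 * (1 / 2) ^ n) * wt i) atTop (𝓝 ((2 * C + N0 * 0) * wt i)) := by
    refine Tendsto.mul_const _ (Tendsto.const_add _ (Tendsto.const_mul _ ?_))
    exact tendsto_pow_atTop_nhds_zero_of_lt_one (by norm_num) (by norm_num)
  have := ge_of_tendsto' hl (fun n => key n i)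
  simpa using this

lemma vp_back {E : Type*} [NormedAddCommGroup E] [NormedSpace ℝ E] (d d' : ℝ → E) (β β' : ℝ → ℝ) (t : ℝ) (ht : 0 ≤ t)
    (hd : ∀ s, HasDerivAt d (d' s) s) (hβ : ∀ s, HasDerivAt β (β' s) s) (h0 : ‖d t‖ ≤ β t)
    (hb : ∀ s, 0 ≤ s → s ≤ t → ‖d s‖ = β s → ‖d' s‖ < - β' s) : ‖d 0‖ ≤ β 0 := by
  have hsub : ∀ s : ℝ, HasDerivAt (fun s => t - s) (-1) s := fun s => by
    simpa using (hasDerivAt_id s).const_sub t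
  have h1 : ∀ s, HasDerivAt (fun σ => d (t - σ)) (- d' (t - s)) s := fun s => by
    have h2 : HasDerivAt (fun σ => d (t - σ)) _ s := HasDerivAt.scomp s (hd (t - s)) (hsub s)
    refine h2.congr_deriv (by simp)
  have h2 : ∀ s, HasDerivAt (fun σ => β (t - σ)) (- β' (t - s)) s := fun s => by
    have h2 : HasDerivAt (fun σ => β (t - σ)) _ s := HasDerivAt.scomp s (hβ (t - s)) (hsub s)
    refine h2.congr_deriv (by simp)
  have := image_norm_le_of_norm_deriv_right_lt_deriv_boundary (f := fun σ => d (t - σ)) (a := 0) (b := t)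
    (fun s _ => (h1 s).continuousAt.continuousWithinAt) (fun s _ => (h1 s).hasDerivWithinAt)
    (B := fun σ => β (t - σ)) (B' := fun s => - β' (t - s)) (by simpa using h0) h2
    (fun s hs he => by
      rw [norm_neg]
      exact hb (t - s) (by linarith [hs.2]) (by linarith [hs.1]) he) (x := t) ⟨ht, le_refl t⟩
  simpa using this

lemma vpb_comp {F F' : ℝ → E3 → E3} {s K ε : ℝ} (hs : 0 ≤ s) (hK : 0 ≤ K) (hε : 0 ≤ ε)
    (h : ∀ x x', ‖F s x - F' s x'‖ ≤ K * ‖x - x'‖ + ε) (z z' : Z3) :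
    ‖vpb F s z - vpb F' s z'‖ ≤ (1 + K) * ‖z - z'‖ + ε := by
  have ht := vpτ_ge_one hs
  have h1 := norm_fst_le (z - z')
  have h2 := norm_snd_le (z - z')
  rw [Prod.fst_sub] at h1
  rw [Prod.snd_sub] at h2
  have i1 : (vpτ s)⁻¹ ≤ 1 := inv_le_one_of_one_le₀ ht
  have i2 : (vpτ s ^ 2)⁻¹ ≤ 1 := inv_le_one_of_one_le₀ (by nlinarith)
  have p1 : 0 ≤ (vpτ s)⁻¹ := by have := vpτ_pos s; positivity
  have p2 : 0 ≤ (vpτ s ^ 2)⁻¹ := by positivity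
  have hn := norm_nonneg (z - z')
  rw [Prod.norm_def]
  refine max_le ?_ ?_
  · have e : (vpb F s z - vpb F' s z').1 = (vpτ s ^ 2)⁻¹ • (z.2 - z'.2) := by simp [vpb, smul_sub]
    rw [e, norm_smul, Real.norm_of_nonneg p2]
    nlinarith [mul_nonneg hK hn, norm_nonneg (z.2 - z'.2)]
  · have e : (vpb F s z - vpb F' s z').2 = (vpτ s)⁻¹ • (F s z.1 - F' s z'.1) := by simp [vpb, smul_sub]
    rw [e, norm_smul, Real.norm_of_nonneg p1]
    have := h z.1 z'.1
    have hh := mul_le_mul_of_nonneg_left h1 hK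
    nlinarith [norm_nonneg (F s z.1 - F' s z'.1)]

/-- Lipschitz bound of the inverse flow under an exponential Lipschitz bound of the field -/
lemma vpG_lip {F : ℝ → E3 → E3} (hF : VPOk F) (N B t : ℝ) (hN : 0 < N) (hB : 0 < B) (ht : 0 ≤ t)
    (h : ∀ s, 0 ≤ s → s ≤ t → ∀ x x', ‖F s x - F s x'‖ ≤ N * Real.exp (B * s) * ‖x - x'‖) (w w' : Z3) :
    ‖vpG F t w - vpG F t w'‖ ≤ Real.exp (2 * t + N / B * Real.exp (B * t)) * ‖w - w'‖ := by
  rcases eq_or_ne w w' with rfl | hne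
  · simp
  have hpos : 0 < ‖w - w'‖ := norm_pos_iff.2 (sub_ne_zero.2 hne)
  have hok := vpb_ok hF
  have hE : ∀ s, HasDerivAt (fun s => Real.exp (B * s)) (B * Real.exp (B * s)) s := fun s => by
    have h2 : HasDerivAt (fun s => Real.exp (B * s)) _ s := ((hasDerivAt_id s).const_mul B).exp
    refine h2.congr_deriv (by simp [mul_comm])
  have hin : ∀ s, HasDerivAt (fun s => 2 * (t - s) + N / B * (Real.exp (B * t) - Real.exp (B * s)))
      (-(2 + N * Real.exp (B * s))) s := fun s => by
    have h2 : HasDerivAt (fun s => 2 * (t - s) + N / B * (Real.exp (B * t) - Real.exp (B * s))) _ s :=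
      (((hasDerivAt_id s).const_sub t).const_mul 2).add (((hE s).const_sub (Real.exp (B * t))).const_mul (N / B))
    refine h2.congr_deriv ?_
    field_simp; ring
  set β : ℝ → ℝ := fun s => ‖w - w'‖ * Real.exp (2 * (t - s) + N / B * (Real.exp (B * t) - Real.exp (B * s))) with hβ
  have hβ' : ∀ s, HasDerivAt β (-((2 + N * Real.exp (B * s)) * β s)) s := fun s => by
    have h2 : HasDerivAt β _ s := ((hin s).exp).const_mul ‖w - w'‖
    refine h2.congr_deriv ?_
    rw [hβ]; ring
  have hβpos : ∀ s, 0 < β s := fun s => by rw [hβ]; positivity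
  have := vp_back (fun s => vpSol (vpb F) t w s - vpSol (vpb F) t w' s) _ β _ t ht
    (fun s => (vpSol_deriv hok t w s).sub (vpSol_deriv hok t w' s)) hβ'
    (by simp only [vpSol_self hok]; rw [hβ]; simp)
    (fun s hs0 hst he => by
      have h1 := vpb_comp (F := F) (F' := F) (K := N * Real.exp (B * s)) (ε := 0) hs0 (by positivity) le_rfl
        (by simpa using h s hs0 hst) (vpSol (vpb F) t w s) (vpSol (vpb F) t w' s)
      rw [he] at h1
      have := hβpos s
      nlinarith)
  refine this.trans ?_
  rw [hβ]
  simp only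
  rw [mul_comm]
  gcongr
  · linarith
  · simp

set_option maxHeartbeats 800000 in
/-- uniform Lipschitz bound of the regularised fields -/
lemma vp_unif_lip {g : Z3 → ℝ} {Lg M R T : ℝ} (hT : 0 ≤ T) (hR : 0 ≤ R) (hM : 0 ≤ M) (hLg : 0 ≤ Lg)
    (hlip : ∀ z z', |g z - g z'| ≤ Lg * ‖z - z'‖) :
    ∃ K : ℝ, 0 ≤ K ∧ ∀ δ F dF, 0 < δ → VPReg g δ F dF →
      (∀ t, 0 ≤ t → t ≤ T → VPDens M R (fun w => g (vpG F t w))) →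
      ∀ t, 0 ≤ t → t ≤ T → ∀ x x', ‖F t x - F t x'‖ ≤ K * ‖x - x'‖ := by
  have hκ := vpκ_nonneg
  set b : ℝ := M * (vpκ * R ^ 3 * (4 * (vpκ * 2))) with hb
  have hb0 : 0 ≤ b := by positivity
  set a : ℝ := (vpκ * R ^ 3) * (vpκ * (π * 2)) + M * (4 * (vpκ * R ^ 3) ^ 2) with ha
  have ha0 : 0 ≤ a := by positivity
  set B : ℝ := 2 * b + 1 with hB
  have hB0 : 0 < B := by positivity
  set C : ℝ := a + b * (Real.log (2 + Lg) + 2 * T) + 1 with hC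
  have hlg : 0 ≤ Real.log (2 + Lg) := Real.log_nonneg (by linarith)
  have hC0 : 0 < C := by positivity
  refine ⟨2 * C * Real.exp (B * T), by positivity, fun δ F dF hδ hreg hD => ?_⟩
  obtain ⟨K0, hK0, hK0'⟩ := hreg.ok1.ok.lip' T
  have main := vp_iter (ι := {t : ℝ // 0 ≤ t ∧ t ≤ T} × E3 × E3)
    (fun i => ‖F i.1 i.2.1 - F i.1 i.2.2‖) (fun i => Real.exp (B * i.1) * ‖i.2.1 - i.2.2‖)
    (fun i => by positivity) C (K0 + 1) hC0 (by linarith) ?_ ?_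
  · intro t ht htT x x'
    have := main ⟨⟨t, ht, htT⟩, x, x'⟩
    dsimp only at this
    refine this.trans ?_
    rw [← mul_assoc]
    gcongr
  · rintro ⟨⟨t, ht, htT⟩, x, x'⟩
    dsimp only
    refine (hK0' t (by rwa [abs_of_nonneg ht]) x x').trans ?_
    have h1 : 1 ≤ Real.exp (B * t) := Real.one_le_exp (by positivity)
    rw [← mul_assoc]
    gcongr
    nlinarith
  · intro N hN hval
    rintro ⟨⟨t, ht, htT⟩, x, x'⟩
    dsimp only
    have hGl := vpG_lip hreg.ok1.ok N B t hN hB0 ht (fun s hs0 hst x x' => by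
      have := hval ⟨⟨s, hs0, hst.trans htT⟩, x, x'⟩
      dsimp only at this
      rwa [← mul_assoc] at this)
    set ex := Real.exp (2 * t + N / B * Real.exp (B * t)) with hex
    have hex1 : 1 ≤ ex := Real.one_le_exp (by positivity)
    set L := Lg * ex with hL
    have hL0 : 0 ≤ L := by positivity
    have hLip : ∀ w w' : Z3, |g (vpG F t w) - g (vpG F t w')| ≤ L * ‖w - w'‖ := fun w w' => by
      refine (hlip _ _).trans ?_
      rw [hL, mul_assoc]
      gcongr
      exact hGl w w'
    have hDt := hD t ht htT
    set d : ℝ := (1 + L)⁻¹ with hd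
    have hd0 : 0 < d := by positivity
    have hdL : d * L ≤ 1 := by
      rw [hd, inv_mul_le_iff₀ (by positivity)]; linarith
    have hlogd : Real.log (1 + d⁻¹) ≤ Real.log (2 + Lg) + 2 * T + N / B * Real.exp (B * t) := by
      have h1 : 1 + d⁻¹ ≤ (2 + Lg) * ex := by
        rw [hd, inv_inv, hL]; nlinarith
      refine (Real.log_le_log (by positivity) h1).trans ?_
      rw [Real.log_mul (by positivity) (by positivity), hex, Real.log_exp]
      linarith
    have hsum : a + b * Real.log (1 + d⁻¹) ≤ (C + N / 2) * Real.exp (B * t) := by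
      have h1 : 1 ≤ Real.exp (B * t) := Real.one_le_exp (by positivity)
      have h2 := mul_le_mul_of_nonneg_left hlogd hb0
      have h3 : b * (N / B * Real.exp (B * t)) ≤ N / 2 * Real.exp (B * t) := by
        rw [← mul_assoc]
        gcongr
        rw [← mul_div_assoc, div_le_div_iff₀ hB0 (by norm_num), hB]
        nlinarith
      nlinarith
    have hA : ∀ e, d ≤ e → ∀ x x', ‖vpCv e (fun w => g (vpG F t w)) x' - vpCv e (fun w => g (vpG F t w)) x‖ ≤
        (b * Real.log (1 + d⁻¹) + M * (4 * (vpκ * R ^ 3) ^ 2)) * ‖x' - x‖ := by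
      intro e hde x x'
      have he0 : 0 < e := hd0.trans_le hde
      refine (vp_cvA hDt hR e he0 x x').trans ?_
      have : Real.log (1 + e⁻¹) ≤ Real.log (1 + d⁻¹) := Real.log_le_log (by positivity) (by gcongr)
      have h2 := mul_le_mul_of_nonneg_left this hb0
      gcongr
      rw [hb] at h2 ⊢
      linarith
    rw [vpReg_cv hreg t ht x, vpReg_cv hreg t ht x']
    have hfin : ‖vpCv δ (fun w => g (vpG F t w)) x - vpCv δ (fun w => g (vpG F t w)) x'‖ ≤
        (a + b * Real.log (1 + d⁻¹)) * ‖x - x'‖ := by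
      rcases le_total d δ with hc | hc
      · refine (hA δ hc x' x).trans (mul_le_mul_of_nonneg_right ?_ (norm_nonneg _))
        have : 0 ≤ (vpκ * R ^ 3) * (vpκ * (π * 2)) := by positivity
        rw [ha]; linarith
      · have e1 := hA d le_rfl x' x
        have e2 := vp_cvB hDt hR hL0 hLip δ d hδ.le hd0 x' x
        have e3 : (vpκ * R ^ 3) * (vpκ * (π * (δ + d))) * L ≤ (vpκ * R ^ 3) * (vpκ * (π * 2)) := by
          have : (δ + d) * L ≤ 2 := by
            have := mul_le_mul_of_nonneg_right hc hL0
            linarith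
          have h0 : 0 ≤ (vpκ * R ^ 3) * (vpκ * π) := by positivity
          have h1 := mul_le_mul_of_nonneg_left this h0
          linarith
        have e4 := mul_le_mul_of_nonneg_right e3 (norm_nonneg (x - x'))
        have e5 : ∀ p q r s : E3, ‖p - q‖ ≤ ‖(p - r) - (q - s)‖ + ‖r - s‖ := fun p q r s => by
          have : p - q = ((p - r) - (q - s)) + (r - s) := by abel
          rw [this]; exact norm_add_le _ _
        refine (e5 _ _ (vpCv d (fun w => g (vpG F t w)) x) (vpCv d (fun w => g (vpG F t w)) x')).trans ?_
        rw [ha]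
        linarith
    refine hfin.trans ?_
    rw [← mul_assoc]
    gcongr


lemma vpG_diff {F F' : ℝ → E3 → E3} (hF : VPOk F) (hF' : VPOk F') (K N B t : ℝ) (hK : 0 ≤ K) (hN : 0 < N) (hB : 0 < B)
    (ht : 0 ≤ t) (h : ∀ s, 0 ≤ s → s ≤ t → ∀ x x', ‖F s x - F' s x'‖ ≤ K * ‖x - x'‖ + N * Real.exp (B * s)) (w : Z3) :
    ‖vpG F t w - vpG F' t w‖ ≤ 4 * N / B * Real.exp ((1 + K) * t) * Real.exp (B * t) := by
  have hok := vpb_ok hF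
  have hok' := vpb_ok hF'
  have hE : ∀ s, HasDerivAt (fun s => Real.exp (B * s)) (B * Real.exp (B * s)) s := fun s => by
    have h2 : HasDerivAt (fun s => Real.exp (B * s)) _ s := ((hasDerivAt_id s).const_mul B).exp
    refine h2.congr_deriv (by simp [mul_comm])
  set J := 1 + K with hJ
  have hE2 : ∀ s, HasDerivAt (fun s => Real.exp (J * (t - s))) (-(J * Real.exp (J * (t - s)))) s := fun s => by
    have h2 : HasDerivAt (fun s => Real.exp (J * (t - s))) _ s := (((hasDerivAt_id s).const_sub t).const_mul J).exp
    refine h2.congr_deriv (by simp [mul_comm])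
  set A := 2 * N / B with hA
  have hA0 : 0 < A := by positivity
  have hAB : A * B = 2 * N := by rw [hA]; field_simp
  set β : ℝ → ℝ := fun s => A * (2 * Real.exp (B * t) * Real.exp (J * (t - s)) - Real.exp (B * s)) with hβ
  have hβ' : ∀ s, HasDerivAt β (A * (2 * Real.exp (B * t) * (-(J * Real.exp (J * (t - s)))) - B * Real.exp (B * s))) s := fun s => by
    have h2 : HasDerivAt β _ s := (((hE2 s).const_mul (2 * Real.exp (B * t))).sub (hE s)).const_mul A
    exact h2
  have := vp_back (fun s => vpSol (vpb F) t w s - vpSol (vpb F') t w s) _ β _ t ht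
    (fun s => (vpSol_deriv hok t w s).sub (vpSol_deriv hok' t w s)) hβ'
    (by
      simp only [vpSol_self hok, vpSol_self hok', sub_self, norm_zero]; rw [hβ]
      have := Real.exp_pos (B * t)
      simp only [sub_self, mul_zero, Real.exp_zero, mul_one]
      exact mul_nonneg hA0.le (by linarith))
    (fun s hs0 hst he => by
      have h1 := vpb_comp (F := F) (F' := F') (K := K) (ε := N * Real.exp (B * s)) hs0 hK (by positivity)
        (h s hs0 hst) (vpSol (vpb F) t w s) (vpSol (vpb F') t w s)
      rw [he] at h1
      refine h1.trans_lt ?_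
      rw [hβ]
      simp only
      have e1 : 0 < N * Real.exp (B * s) := by positivity
      have e2 : A * B * Real.exp (B * s) = 2 * (N * Real.exp (B * s)) := by rw [hAB]; ring
      have e3 : 0 ≤ J * (A * Real.exp (B * s)) := by positivity
      nlinarith)
  refine this.trans ?_
  rw [hβ]
  simp only [mul_zero, sub_zero, Real.exp_zero]
  have : 4 * N / B = A * 2 := by rw [hA]; ring
  rw [this]
  nlinarith

lemma vp_cauchy {g : Z3 → ℝ} {Lg M R T K : ℝ} (hT : 0 ≤ T) (hR : 0 ≤ R) (hM : 0 ≤ M) (hLg : 0 ≤ Lg) (hK : 0 ≤ K)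
    (hlip : ∀ z z', |g z - g z'| ≤ Lg * ‖z - z'‖) :
    ∃ C : ℝ, 0 < C ∧ ∀ δ δ' F F' dF dF', 0 < δ → 0 < δ' → VPReg g δ F dF → VPReg g δ' F' dF' →
      (∀ t, 0 ≤ t → t ≤ T → VPDens M R (fun w => g (vpG F t w))) →
      (∀ t, 0 ≤ t → t ≤ T → VPDens M R (fun w => g (vpG F' t w))) →
      (∀ t, 0 ≤ t → t ≤ T → ∀ x x', ‖F' t x - F' t x'‖ ≤ K * ‖x - x'‖) →
      ∀ t, 0 ≤ t → t ≤ T → ∀ x, ‖F t x - F' t x‖ ≤ C * (δ + δ') := by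
  have hκ := vpκ_nonneg
  have hB0' := vpB0_nonneg hR
  set B : ℝ := 8 * vpB0 R * Lg * Real.exp ((1 + K) * T) + 1 with hB
  have hB0 : 0 < B := by positivity
  set C0 : ℝ := M * (vpκ * R ^ 3) * (vpκ * π) + 1 with hC0
  have hC0p : 0 < C0 := by positivity
  refine ⟨2 * C0 * Real.exp (B * T), by positivity, fun δ δ' F F' dF dF' hδ hδ' hreg hreg' hD hD' hLip => ?_⟩
  have main := vp_iter (ι := {t : ℝ // 0 ≤ t ∧ t ≤ T} × E3)
    (fun i => ‖F i.1 i.2 - F' i.1 i.2‖) (fun i => Real.exp (B * i.1))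
    (fun i => by positivity) (C0 * (δ + δ')) (2 * (M * vpB0 R) + 1) (by positivity) (by positivity) ?_ ?_
  · intro t ht htT x
    have := main ⟨⟨t, ht, htT⟩, x⟩
    dsimp only at this
    refine this.trans ?_
    have h1 : Real.exp (B * t) ≤ Real.exp (B * T) := by gcongr
    calc 2 * (C0 * (δ + δ')) * Real.exp (B * t) ≤ 2 * (C0 * (δ + δ')) * Real.exp (B * T) := by gcongr
      _ = _ := by ring
  · rintro ⟨⟨t, ht, htT⟩, x⟩
    dsimp only
    rw [vpReg_cv hreg t ht, vpReg_cv hreg' t ht]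
    have h1 : 1 ≤ Real.exp (B * t) := Real.one_le_exp (by positivity)
    have e1 := vp_cv_bound (hD t ht htT) hR δ x
    have e2 := vp_cv_bound (hD' t ht htT) hR δ' x
    refine (norm_sub_le _ _).trans ?_
    have : 0 ≤ M * vpB0 R := by positivity
    nlinarith
  · intro N hN hval
    rintro ⟨⟨t, ht, htT⟩, x⟩
    dsimp only
    have hGd := vpG_diff hreg.ok1.ok hreg'.ok1.ok K N B t hK hN hB0 ht (fun s hs0 hst x x' => by
      have h1 := hval ⟨⟨s, hs0, hst.trans htT⟩, x⟩
      dsimp only at h1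
      have h2 := hLip s hs0 (hst.trans htT) x x'
      have : F s x - F' s x' = (F' s x - F' s x') + (F s x - F' s x) := by abel
      rw [this]
      exact (norm_add_le _ _).trans (add_le_add h2 h1))
    have hdiff : ∀ w : Z3, |g (vpG F t w) - g (vpG F' t w)| ≤
        Lg * (4 * N / B * Real.exp ((1 + K) * T) * Real.exp (B * t)) := fun w => by
      refine (hlip _ _).trans (mul_le_mul_of_nonneg_left ((hGd w).trans ?_) hLg)
      gcongr
    have e1 := vp_cvC (hD t ht htT) hR δ δ' hδ.le hδ' x
    have e2 := vp_cvD (hD t ht htT) (hD' t ht htT) hR hdiff δ' x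
    rw [vpReg_cv hreg t ht, vpReg_cv hreg' t ht]
    have h1 : 1 ≤ Real.exp (B * t) := Real.one_le_exp (by positivity)
    have e3 : Lg * (4 * N / B * Real.exp ((1 + K) * T) * Real.exp (B * t)) * vpB0 R ≤ N / 2 * Real.exp (B * t) := by
      have : Lg * (4 * N / B * Real.exp ((1 + K) * T)) * vpB0 R ≤ N / 2 := by
        have e : Lg * (4 * N / B * Real.exp ((1 + K) * T)) * vpB0 R = N / 2 * ((8 * vpB0 R * Lg * Real.exp ((1 + K) * T)) / B) := by ring
        rw [e]
        refine mul_le_of_le_one_right (by positivity) ?_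
        rw [div_le_one hB0, hB]; linarith
      calc _ = Lg * (4 * N / B * Real.exp ((1 + K) * T)) * vpB0 R * Real.exp (B * t) := by ring
        _ ≤ _ := by gcongr
    have e4 : M * (vpκ * R ^ 3) * (vpκ * (π * (δ + δ'))) ≤ C0 * (δ + δ') * Real.exp (B * t) := by
      calc _ = M * (vpκ * R ^ 3) * (vpκ * π) * (δ + δ') := by ring
        _ ≤ C0 * (δ + δ') := by gcongr; rw [hC0]; linarith
        _ ≤ _ := le_mul_of_one_le_right (by positivity) h1
    have e5 := norm_sub_le_norm_sub_add_norm_sub (vpCv δ (fun w => g (vpG F t w)) x) (vpCv δ' (fun w => g (vpG F t w)) x)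
      (vpCv δ' (fun w => g (vpG F' t w)) x)
    nlinarith


/-- smoothing sequence -/
def vpδ (n : ℕ) : ℝ := 1 / ((n : ℝ) + 1)

lemma vpδ_pos (n : ℕ) : 0 < vpδ n := by unfold vpδ; positivity

lemma vpδ_lim : Tendsto vpδ atTop (𝓝 0) := tendsto_one_div_add_atTop_nhds_zero_nat

lemma vpδ_lim_mul (C : ℝ) : Tendsto (fun n => C * vpδ n) atTop (𝓝 0) := by
  simpa using vpδ_lim.const_mul C

lemma vp_ulim {V : Type*} [NormedAddCommGroup V] [CompleteSpace V] (Φ : ℕ → ℝ → E3 → V)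
    (hΦ : ∀ T, 0 ≤ T → ∃ C, 0 < C ∧ ∀ m k t, 0 ≤ t → t ≤ T → ∀ x, ‖Φ m t x - Φ k t x‖ ≤ C * (vpδ m + vpδ k))
    (hc : ∀ m, Continuous fun q : ℝ × E3 => Φ m (max q.1 0) q.2) :
    ∃ Ψ : ℝ → E3 → V, (∀ T, 0 ≤ T → ∃ C, 0 < C ∧ ∀ m t, 0 ≤ t → t ≤ T → ∀ x, ‖Φ m t x - Ψ t x‖ ≤ C * vpδ m) ∧
      (∀ t, Ψ t = Ψ (max t 0)) ∧ Continuous fun q : ℝ × E3 => Ψ q.1 q.2 := by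
  have hlim : ∀ t x, ∃ y, Tendsto (fun m => Φ m (max t 0) x) atTop (𝓝 y) := by
    intro t x
    obtain ⟨C, hC, h⟩ := hΦ (max t 0) (le_max_right _ _)
    refine cauchySeq_tendsto_of_complete ?_
    rw [Metric.cauchySeq_iff']
    intro ε hε
    have h1 := (vpδ_lim_mul (2 * C)).eventually_lt_const hε
    have h1' := h1.exists_forall_of_atTop
    obtain ⟨N, hN⟩ := h1'
    refine ⟨N, fun n hn => ?_⟩
    rw [dist_eq_norm]
    refine (h n N (max t 0) (le_max_right _ _) le_rfl x).trans_lt ?_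
    have : vpδ n ≤ vpδ N := by
      unfold vpδ; gcongr
    have := hN N le_rfl
    nlinarith
  choose Ψ hΨ using hlim
  have heq : ∀ t, Ψ t = Ψ (max t 0) := by
    intro t; funext x
    refine tendsto_nhds_unique (hΨ t x) ?_
    have := hΨ (max t 0) x
    simpa using this
  have hb : ∀ T, 0 ≤ T → ∃ C, 0 < C ∧ ∀ m t, 0 ≤ t → t ≤ T → ∀ x, ‖Φ m t x - Ψ t x‖ ≤ C * vpδ m := by
    intro T hT
    obtain ⟨C, hC, h⟩ := hΦ T hT
    refine ⟨C, hC, fun m t ht htT x => ?_⟩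
    have l1 := hΨ t x
    rw [max_eq_left ht] at l1
    have l2 : Tendsto (fun k => ‖Φ m t x - Φ k t x‖) atTop (𝓝 ‖Φ m t x - Ψ t x‖) := (l1.const_sub _).norm
    have l3 : Tendsto (fun k => C * (vpδ m + vpδ k)) atTop (𝓝 (C * (vpδ m + 0))) := (vpδ_lim.const_add _).const_mul C
    rw [add_zero] at l3
    exact le_of_tendsto_of_tendsto' l2 l3 (fun k => h m k t ht htT x)
  refine ⟨Ψ, hb, heq, ?_⟩
  have hlu : TendstoLocallyUniformly (fun m (q : ℝ × E3) => Φ m (max q.1 0) q.2) (fun q => Ψ q.1 q.2) atTop := by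
    rw [Metric.tendstoLocallyUniformly_iff]
    intro ε hε q
    obtain ⟨C, hC, h⟩ := hb (|q.1| + 1) (by positivity)
    refine ⟨{p : ℝ × E3 | p.1 < |q.1| + 1}, ?_, ?_⟩
    · refine (isOpen_lt continuous_fst continuous_const).mem_nhds ?_
      simp only [mem_setOf_eq]; linarith [le_abs_self q.1]
    · filter_upwards [(vpδ_lim_mul C).eventually_lt_const hε] with m hm p hp
      rw [heq p.1, dist_comm, dist_eq_norm]
      refine (h m (max p.1 0) (le_max_right _ _) (max_le (le_of_lt hp) (by positivity)) p.2).trans_lt hm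
  exact hlu.continuous (Frequently.of_forall hc)

/-- limit field, before differentiability -/
lemma vp_limit0 {g : Z3 → ℝ} {Lg : ℝ} (hg : Continuous g) (hgc : HasCompactSupport g) (hg0 : ∀ z, 0 ≤ g z) (hLg : 0 ≤ Lg)
    (hlip : ∀ z z', |g z - g z'| ≤ Lg * ‖z - z'‖) :
    ∃ E : ℝ → E3 → E3, VPOk E ∧ (Continuous fun q : ℝ × E3 => E q.1 q.2) ∧ (∀ t, E t = E (max t 0)) ∧
      (∀ t, 0 ≤ t → ∀ x, E t x = vpCv 0 (fun w => g (vpG E t w)) x) ∧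
      (∃ C, 0 < C ∧ ∀ t, 0 ≤ t → ∀ w, g (vpG E t w) ≠ 0 →
        ‖w.1‖ ≤ C * (vpτ t) ^ ((2:ℝ) / 3) ∧ ‖w.2‖ ≤ C * (vpτ t) ^ ((5:ℝ) / 3)) ∧
      (∀ T, 0 ≤ T → ∃ M R, 0 ≤ R ∧ ∀ t, 0 ≤ t → t ≤ T → VPDens M R (fun w => g (vpG E t w))) := by
  have hex : ∀ n, ∃ F dF, VPReg g (vpδ n) F dF := fun n => vp_reg_exists hg hgc (vpδ_pos n)
  choose F dF hreg using hex
  have hu : ∀ T, 0 ≤ T → ∃ M R K C, 0 ≤ R ∧ 0 ≤ M ∧ 0 ≤ K ∧ 0 < C ∧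
      (∀ n t, 0 ≤ t → t ≤ T → VPDens M R (fun w => g (vpG (F n) t w))) ∧
      (∀ n t, 0 ≤ t → t ≤ T → ∀ x x', ‖F n t x - F n t x'‖ ≤ K * ‖x - x'‖) ∧
      (∀ n m t, 0 ≤ t → t ≤ T → ∀ x, ‖F n t x - F m t x‖ ≤ C * (vpδ n + vpδ m)) := by
    intro T hT
    obtain ⟨M, R, hR, hD⟩ := vp_dens hg hgc hg0 T
    have hD' : ∀ n t, 0 ≤ t → t ≤ T → VPDens M R (fun w => g (vpG (F n) t w)) := fun n => hD _ _ _ (vpδ_pos n) (hreg n)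
    have hM : 0 ≤ M := (hD' 0 0 le_rfl hT).M0
    obtain ⟨K, hK, hK'⟩ := vp_unif_lip hT hR hM hLg hlip
    obtain ⟨C, hC, hC'⟩ := vp_cauchy hT hR hM hLg hK hlip
    have hK'' : ∀ n t, 0 ≤ t → t ≤ T → ∀ x x', ‖F n t x - F n t x'‖ ≤ K * ‖x - x'‖ :=
      fun n => hK' _ _ _ (vpδ_pos n) (hreg n) (hD' n)
    exact ⟨M, R, K, C, hR, hM, hK, hC, hD', hK'', fun n m =>
      hC' _ _ _ _ _ _ (vpδ_pos n) (vpδ_pos m) (hreg n) (hreg m) (hD' n) (hD' m) (hK'' m)⟩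
  obtain ⟨E, hE, hEmax, hEc⟩ := vp_ulim F (fun T hT => by
      obtain ⟨M, R, K, C, hR, hM, hK, hC, h1, h2, h3⟩ := hu T hT
      exact ⟨C, hC, h3⟩) (fun m => by
      have h : Continuous fun q : ℝ × E3 => (max q.1 0, q.2) := by fun_prop
      have h2 := (hreg m).ok1.bc.comp h
      exact h2)
  have hlimE : ∀ t, 0 ≤ t → ∀ x, Tendsto (fun n => F n t x) atTop (𝓝 (E t x)) := by
    intro t ht x
    obtain ⟨C, hC, h⟩ := hE t ht
    rw [tendsto_iff_norm_sub_tendsto_zero]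
    exact squeeze_zero (fun _ => norm_nonneg _) (fun n => h n t ht le_rfl x) (vpδ_lim_mul C)
  have hLipE : ∀ T, 0 ≤ T → ∃ K, 0 ≤ K ∧ ∀ t, 0 ≤ t → t ≤ T → ∀ x x', ‖E t x - E t x'‖ ≤ K * ‖x - x'‖ := by
    intro T hT
    obtain ⟨M, R, K, C, hR, hM, hK, hC, h1, h2, h3⟩ := hu T hT
    refine ⟨K, hK, fun t ht htT x x' => ?_⟩
    exact le_of_tendsto' ((hlimE t ht x).sub (hlimE t ht x')).norm (fun n => h2 n t ht htT x x')
  have hok : VPOk E := by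
    refine ⟨fun T => ?_, fun x => ?_⟩
    · obtain ⟨K, hK, h⟩ := hLipE |T| (abs_nonneg T)
      refine ⟨K, fun t ht x y => ?_⟩
      rw [hEmax t]
      refine h _ (le_max_right _ _) (max_le ?_ (abs_nonneg _)) x y
      exact (le_abs_self t).trans (ht.trans (le_abs_self T))
    · have h : Continuous fun t : ℝ => (t, x) := by fun_prop
      have h2 := hEc.comp h
      exact h2
  have hGlim : ∀ T, 0 ≤ T → ∃ c, 0 < c ∧ ∀ n t, 0 ≤ t → t ≤ T → ∀ w, ‖vpG (F n) t w - vpG E t w‖ ≤ c * vpδ n := by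
    intro T hT
    obtain ⟨K, hK, hL⟩ := hLipE T hT
    obtain ⟨C, hC, hE'⟩ := hE T hT
    refine ⟨4 * C / 1 * Real.exp ((1 + K) * T) * Real.exp (1 * T), by positivity, fun n t ht htT w => ?_⟩
    have := vpG_diff (hreg n).ok1.ok hok K (C * vpδ n) 1 t hK (mul_pos hC (vpδ_pos n)) one_pos ht
      (fun s hs0 hst x x' => by
        have e1 := hL s hs0 (hst.trans htT) x x'
        have e2 := hE' n s hs0 (hst.trans htT) x
        have e3 : F n s x - E s x' = (E s x - E s x') + (F n s x - E s x) := by abel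
        have e4 : C * vpδ n ≤ C * vpδ n * Real.exp (1 * s) :=
          le_mul_of_one_le_right (mul_pos hC (vpδ_pos n)).le (Real.one_le_exp (by linarith))
        rw [e3]
        exact (norm_add_le _ _).trans (add_le_add e1 (e2.trans e4))) w
    refine this.trans ?_
    have hp := vpδ_pos n
    calc 4 * (C * vpδ n) / 1 * Real.exp ((1 + K) * t) * Real.exp (1 * t)
        ≤ 4 * (C * vpδ n) / 1 * Real.exp ((1 + K) * T) * Real.exp (1 * T) := by gcongr
      _ = _ := by ring
  have hev : ∀ t, 0 ≤ t → ∀ w, g (vpG E t w) ≠ 0 → ∃ n, g (vpG (F n) t w) ≠ 0 := by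
    intro t ht w hw
    obtain ⟨c, hc, h⟩ := hGlim t ht
    have l1 : Tendsto (fun n => vpG (F n) t w) atTop (𝓝 (vpG E t w)) := by
      rw [tendsto_iff_norm_sub_tendsto_zero]
      exact squeeze_zero (fun _ => norm_nonneg _) (fun n => h n t ht le_rfl w) (vpδ_lim_mul c)
    have l2 := (hg.tendsto _).comp l1
    exact (l2.eventually_ne hw).exists
  have hdens : ∀ T, 0 ≤ T → ∀ M R, (∀ n t, 0 ≤ t → t ≤ T → VPDens M R (fun w => g (vpG (F n) t w))) →
      ∀ t, 0 ≤ t → t ≤ T → VPDens M R (fun w => g (vpG E t w)) := by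
    intro T hT M R h t ht htT
    refine ⟨hg.comp (vpG_cont1 hok t), fun w => ?_, fun w hw => ?_⟩
    · have := (h 0 t ht htT).bd (vpX (F 0) t (vpG E t w))
      simp only [vpG_X (hreg 0).ok1.ok] at this
      exact this
    · obtain ⟨n, hn⟩ := hev t ht w hw
      exact (h n t ht htT).supp w hn
  refine ⟨E, hok, hEc, hEmax, ?_, ?_, ?_⟩
  · intro t ht x
    obtain ⟨M, R, K, C, hR, hM, hK, hC, h1, h2, h3⟩ := hu t ht
    obtain ⟨c, hc, h⟩ := hGlim t ht
    have hDE := hdens t ht M R h1 t ht le_rfl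
    refine tendsto_nhds_unique (hlimE t ht x) ?_
    rw [tendsto_iff_norm_sub_tendsto_zero]
    refine squeeze_zero (fun _ => norm_nonneg _) (g := fun n => (Lg * c * vpB0 R + M * (vpκ * R ^ 3) * (vpκ * π)) * vpδ n)
      (fun n => ?_) (vpδ_lim_mul _)
    rw [vpReg_cv (hreg n) t ht x]
    have e1 := vp_cvD (h1 n t ht le_rfl) hDE hR (ε := Lg * (c * vpδ n))
      (fun w => (hlip _ _).trans (mul_le_mul_of_nonneg_left (h n t ht le_rfl w) hLg)) (vpδ n) x
    have e2 := vp_cvC hDE hR 0 (vpδ n) le_rfl (vpδ_pos n) x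
    rw [norm_sub_rev] at e2
    refine (norm_sub_le_norm_sub_add_norm_sub _ (vpCv (vpδ n) (fun w => g (vpG E t w)) x) _).trans ?_
    refine (add_le_add e1 e2).trans (le_of_eq (by ring))
  · obtain ⟨C, hC, h⟩ := vp_moment hg hgc hg0
    refine ⟨C, hC, fun t ht w hw => ?_⟩
    obtain ⟨n, hn⟩ := hev t ht w hw
    have := h _ _ _ (vpδ_pos n) (hreg n) t ht _ (subset_tsupport g hn)
    rwa [vpX_G (hreg n).ok1.ok] at this
  · intro T hT
    obtain ⟨M, R, K, C, hR, hM, hK, hC, h1, h2, h3⟩ := hu T hT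
    exact ⟨M, R, hR, hdens T hT M R h1⟩


lemma vp_dcv_cont {H : ℝ → Z3 → ℝ} (hH : Continuous fun q : ℝ × Z3 => H q.1 q.2)
    (hs : ∀ T, 0 ≤ T → ∃ R, ∀ t, 0 ≤ t → t ≤ T → ∀ w, H t w ≠ 0 → ‖w‖ < R) (d : ℝ) (hd : 0 < d) :
    Continuous fun q : ℝ × E3 => vpdCv d (H (max q.1 0)) q.2 := by
  rw [continuous_iff_continuousAt]
  intro q0
  obtain ⟨R, hR⟩ := hs (|q0.1| + 1) (by positivity)
  have hc : Continuous fun q : ℝ × E3 => ∫ w in Metric.closedBall (0 : Z3) R, H (max q.1 0) w • vpdk d (q.2 - w.1) := by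
    refine continuous_parametric_integral_of_continuous
      (f := fun (q : ℝ × E3) (w : Z3) => H (max q.1 0) w • vpdk d (q.2 - w.1)) ?_ (isCompact_closedBall _ _)
    have h1 : Continuous fun p : (ℝ × E3) × Z3 => (max p.1.1 0, p.2) := by fun_prop
    have h2 := hH.comp h1
    have h3 := (vpdk_cont d hd).comp (by fun_prop : Continuous fun p : (ℝ × E3) × Z3 => p.1.2 - p.2.1)
    exact h2.smul h3
  refine (hc.continuousAt (x := q0)).congr ?_
  have : {p : ℝ × E3 | p.1 < |q0.1| + 1} ∈ 𝓝 q0 := by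
    refine (isOpen_lt continuous_fst continuous_const).mem_nhds ?_
    show q0.1 < |q0.1| + 1
    linarith [le_abs_self q0.1]
  filter_upwards [this] with p hp
  unfold vpdCv
  rw [setIntegral_eq_integral_of_forall_compl_eq_zero]
  intro w hw
  by_contra hne
  have h0 : H (max p.1 0) w ≠ 0 := fun h => hne (by rw [h]; exact zero_smul ℝ (vpdk d (p.2 - w.1)))
  have := hR _ (le_max_right _ _) (max_le (le_of_lt hp) (by positivity)) w h0
  exact hw (by simpa using this.le)

/-- limit field with differentiability -/
lemma vp_limit1 {g : Z3 → ℝ} {Lg : ℝ} (hg : Continuous g) (hgc : HasCompactSupport g) (hg0 : ∀ z, 0 ≤ g z) (hLg : 0 ≤ Lg)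
    (hlip : ∀ z z', |g z - g z'| ≤ Lg * ‖z - z'‖) :
    ∃ E dE, VPOk1 E dE ∧ 
      (∀ t, 0 ≤ t → ∀ x, E t x = vpCv 0 (fun w => g (vpG E t w)) x) ∧
      (∃ C, 0 < C ∧ ∀ t, 0 ≤ t → ∀ w, g (vpG E t w) ≠ 0 →
        ‖w.1‖ ≤ C * (vpτ t) ^ ((2:ℝ) / 3) ∧ ‖w.2‖ ≤ C * (vpτ t) ^ ((5:ℝ) / 3)) ∧
      (∀ t, 0 ≤ t → ∃ M R, 0 ≤ R ∧ VPDens M R (fun w => g (vpG E t w))) := by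
  obtain ⟨E, hok, hEc, hEmax, hself, hmom, hdens⟩ := vp_limit0 hg hgc hg0 hLg hlip
  have hκ := vpκ_nonneg
  set H : ℝ → Z3 → ℝ := fun t w => g (vpG E t w) with hH
  have hHc : Continuous fun q : ℝ × Z3 => H q.1 q.2 := hg.comp (vpG_cont hok)
  have hHL : ∀ T, 0 ≤ T → ∃ L, 0 ≤ L ∧ ∀ t, 0 ≤ t → t ≤ T → ∀ w w', |H t w - H t w'| ≤ L * ‖w - w'‖ := by
    intro T hT
    obtain ⟨L, hL, h⟩ := vpSol_lip2 (vpb_ok hok) T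
    refine ⟨Lg * L, by positivity, fun t ht htT w w' => ?_⟩
    refine (hlip _ _).trans ?_
    rw [mul_assoc]
    exact mul_le_mul_of_nonneg_left (h t 0 (by rwa [abs_of_nonneg ht]) (by simpa using hT) w w') hLg
  obtain ⟨dE, hdE, hdEmax, hdEc⟩ := vp_ulim (fun m t x => vpdCv (vpδ m) (H t) x) (fun T hT => by
      obtain ⟨M, R, hR, hD⟩ := hdens T hT
      obtain ⟨L, hL, hL'⟩ := hHL T hT
      refine ⟨(vpκ * R ^ 3) * (vpκ * π) * L + 1, by positivity, fun m k t ht htT x => ?_⟩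
      have hder : HasFDerivAt (fun x => vpCv (vpδ m) (H t) x - vpCv (vpδ k) (H t) x) _ x :=
        (vp_cv_deriv (hD t ht htT) (vpδ m) (vpδ_pos m) x).sub (vp_cv_deriv (hD t ht htT) (vpδ k) (vpδ_pos k) x)
      have hm := vpδ_pos m
      have hk := vpδ_pos k
      refine hder.le_of_lip' (by positivity) (Eventually.of_forall fun y => ?_)
      refine (vp_cvB (hD t ht htT) hR hL (hL' t ht htT) (vpδ m) (vpδ k) hm.le hk x y).trans ?_
      refine mul_le_mul_of_nonneg_right ?_ (norm_nonneg _)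
      linarith) (fun m => by
      refine vp_dcv_cont hHc (fun T hT => ?_) (vpδ m) (vpδ_pos m)
      obtain ⟨M, R, hR, hD⟩ := hdens T hT
      exact ⟨R, fun t ht htT => (hD t ht htT).supp⟩)
  refine ⟨E, dE, ⟨hok, hEc, fun t x => ?_, hdEc⟩, hself, hmom, fun t ht => by
    obtain ⟨M, R, hR, hD⟩ := hdens t ht
    exact ⟨M, R, hR, hD t ht le_rfl⟩⟩
  rw [hEmax t, hdEmax t]
  have ht : 0 ≤ max t 0 := le_max_right _ _
  generalize max t 0 = t at ht
  obtain ⟨M, R, hR, hD⟩ := hdens t ht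
  obtain ⟨C, hC, hC'⟩ := hdE t ht
  refine hasFDerivAt_of_tendstoUniformly (l := atTop) (f := fun m x => vpCv (vpδ m) (H t) x)
    (f' := fun m x => vpdCv (vpδ m) (H t) x) (g := E t) (g' := dE t) ?_ ?_ ?_ x
  · rw [Metric.tendstoUniformly_iff]
    intro ε hε
    filter_upwards [(vpδ_lim_mul C).eventually_lt_const hε] with m hm x
    rw [dist_comm, dist_eq_norm]
    exact (hC' m t ht le_rfl x).trans_lt hm
  · exact fun n x => vp_cv_deriv (hD t ht le_rfl) (vpδ n) (vpδ_pos n) x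
  · intro x
    rw [tendsto_iff_norm_sub_tendsto_zero]
    refine squeeze_zero (fun _ => norm_nonneg _) (g := fun n => (M * (vpκ * R ^ 3) * (vpκ * π)) * vpδ n)
      (fun n => ?_) (vpδ_lim_mul _)
    rw [hself t ht x, norm_sub_rev]
    refine (vp_cvC (hD t ht le_rfl) hR 0 (vpδ n) le_rfl (vpδ_pos n) x).trans (le_of_eq (by ring))


/-- physical to scaled phase space -/
def vpSc (t : ℝ) (x v : E3) : Z3 := ((vpτ t)⁻¹ • x, vpτ t • v - x)

/-- solution in physical variables -/
def vpFs (g : Z3 → ℝ) (E : ℝ → E3 → E3) (q : ℝ × E3 × E3) : ℝ := 4 * π * g (vpG E q.1 (vpSc q.1 q.2.1 q.2.2))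

lemma vp_scale_int {V : Type*} [NormedAddCommGroup V] [NormedSpace ℝ V] (f : E3 → V) {r : ℝ} (hr : 0 < r) :
    ∫ y, f (r • y) = (r ^ 3)⁻¹ • ∫ y, f y := by
  rw [Measure.integral_comp_smul_of_nonneg _ f r (hR := hr.le)]
  simp

lemma vpFs_density (g : Z3 → ℝ) (E : ℝ → E3 → E3) (t : ℝ) (y : E3) :
    vpDensity (vpFs g E) t y = 4 * π * ((vpτ t ^ 3)⁻¹ * ∫ p, g (vpG E t ((vpτ t)⁻¹ • y, p))) := by
  unfold vpDensity vpFs vpSc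
  simp only
  rw [integral_const_mul]
  congr 1
  have h1 := vp_scale_int (fun u : E3 => g (vpG E t ((vpτ t)⁻¹ • y, u - y))) (vpτ_pos t)
  rw [h1, smul_eq_mul]
  congr 1
  exact integral_sub_right_eq_self (fun p : E3 => g (vpG E t ((vpτ t)⁻¹ • y, p))) y

lemma vpFs_field {g : Z3 → ℝ} {E : ℝ → E3 → E3} {t M R : ℝ} (hR : 0 ≤ R) (hD : VPDens M R (fun w => g (vpG E t w))) (x : E3) :
    vpField (vpFs g E) t x = (vpτ t ^ 2)⁻¹ • vpCv 0 (fun w => g (vpG E t w)) ((vpτ t)⁻¹ • x) := by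
  have hτ := vpτ_pos t
  set τ := vpτ t with hτd
  unfold vpField
  have h1 := vp_scale_int (fun y : E3 => (vpDensity (vpFs g E) t y / ‖x - y‖ ^ 3) • (x - y)) hτ
  have h2 : ∫ y : E3, (vpDensity (vpFs g E) t y / ‖x - y‖ ^ 3) • (x - y) =
      τ ^ 3 • ∫ y : E3, (vpDensity (vpFs g E) t (τ • y) / ‖x - τ • y‖ ^ 3) • (x - τ • y) := by
    rw [h1, smul_smul, mul_inv_cancel₀ (by positivity), one_smul]
  have h3 : ∀ y : E3, (vpDensity (vpFs g E) t (τ • y) / ‖x - τ • y‖ ^ 3) • (x - τ • y) =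
      (4 * π * (τ ^ 3)⁻¹ * (τ ^ 2)⁻¹) • ∫ p, g (vpG E t (y, p)) • vpk 0 (τ⁻¹ • x - y) := by
    intro y
    have e1 : x - τ • y = τ • (τ⁻¹ • x - y) := by
      rw [smul_sub, smul_smul, mul_inv_cancel₀ hτ.ne', one_smul]
    rw [vpFs_density, e1, norm_smul, Real.norm_of_nonneg hτ.le, integral_smul_const, smul_smul, smul_smul, smul_smul, vpk, vph_zero,
      smul_smul]
    congr 1
    rw [inv_mul_cancel₀ hτ.ne', one_smul, ← hτd]
    rw [div_eq_mul_inv, mul_pow, mul_inv, inv_pow]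
    generalize (‖τ⁻¹ • x - y‖ ^ 3)⁻¹ = K
    field_simp
  have h4 : vpCv 0 (fun w => g (vpG E t w)) (τ⁻¹ • x) = ∫ y, ∫ p, g (vpG E t (y, p)) • vpk 0 (τ⁻¹ • x - y) := by
    unfold vpCv
    have hi := vp_cv_int hD hR 0 (τ⁻¹ • x)
    rw [Measure.volume_eq_prod] at hi ⊢
    rw [integral_prod _ hi]
  rw [h2]
  simp_rw [h3]
  rw [integral_smul, ← h4, smul_smul, smul_smul]
  congr 1
  have := Real.pi_pos
  field_simp

lemma vpFs_contDiff {g : Z3 → ℝ} {E : ℝ → E3 → E3} {dE : ℝ → E3 → E3 →L[ℝ] E3} (hg : ContDiff ℝ 1 g) (hE : VPOk1 E dE) :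
    ContDiff ℝ 1 (vpFs g E) := by
  have h1 := vpInv_contDiff (vpb_ok1 hE)
  have hτ : ContDiff ℝ 1 fun q : ℝ × E3 × E3 => vpτ q.1 := vpτ_contDiff.comp contDiff_fst
  have hτi : ContDiff ℝ 1 fun q : ℝ × E3 × E3 => (vpτ q.1)⁻¹ := hτ.inv fun q => (vpτ_pos q.1).ne'
  have hx : ContDiff ℝ 1 fun q : ℝ × E3 × E3 => q.2.1 := contDiff_fst.comp contDiff_snd
  have hv : ContDiff ℝ 1 fun q : ℝ × E3 × E3 => q.2.2 := contDiff_snd.comp contDiff_snd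
  have h2 : ContDiff ℝ 1 fun q : ℝ × E3 × E3 => (q.1, vpSc q.1 q.2.1 q.2.2) := by
    unfold vpSc
    exact contDiff_fst.prodMk ((hτi.smul hx).prodMk ((hτ.smul hv).sub hx))
  have h3 := hg.comp (h1.comp h2)
  exact contDiff_const.mul h3

lemma vpFs_pde {g : Z3 → ℝ} {E : ℝ → E3 → E3} {dE : ℝ → E3 → E3 →L[ℝ] E3} (hg : ContDiff ℝ 1 g) (hE : VPOk1 E dE)
    (t : ℝ) (ht : 0 ≤ t) (x v : E3) :
    fderiv ℝ (vpFs g E) (t, x, v) (1, v, (vpτ t ^ 2)⁻¹ • E t ((vpτ t)⁻¹ • x)) = 0 := by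
  have hok := vpb_ok hE.ok
  have hτ := vpτ_pos t
  have hdiff : DifferentiableAt ℝ (vpFs g E) (t, x, v) := (vpFs_contDiff hg hE).differentiable (by norm_num) _
  set w := vpSc t x v with hw
  set S : ℝ → Z3 := vpSol (vpb E) t w with hS
  have hS0 : S t = w := vpSol_self hok t w
  have hSd : HasDerivAt S (vpb E t w) t := by
    have := vpSol_deriv hok t w t
    rwa [vpSol_self hok] at this
  have hS1 : HasDerivAt (fun s => (S s).1) ((vpτ t ^ 2)⁻¹ • w.2) t := by
    have h2 := (ContinuousLinearMap.fst ℝ E3 E3).hasFDerivAt.comp_hasDerivAt t hSd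
    exact h2
  have hS2 : HasDerivAt (fun s => (S s).2) ((vpτ t)⁻¹ • E t w.1) t := by
    have h2 := (ContinuousLinearMap.snd ℝ E3 E3).hasFDerivAt.comp_hasDerivAt t hSd
    exact h2
  have hτd := vpτ_deriv' ht
  have hX : HasDerivAt (fun s => vpτ s • (S s).1) v t := by
    have h2 : HasDerivAt (fun s => vpτ s • (S s).1) _ t := hτd.smul hS1
    refine h2.congr_deriv ?_
    rw [hS0, hw, vpSc]
    simp only [smul_smul, smul_sub]
    have e1 : vpτ t * ((vpτ t ^ 2)⁻¹ * vpτ t) = 1 := by field_simp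
    have e2 : vpτ t * (vpτ t ^ 2)⁻¹ = (vpτ t)⁻¹ := by field_simp
    rw [e1, e2, one_mul, one_smul]; abel
  have hV : HasDerivAt (fun s => (S s).1 + (vpτ s)⁻¹ • (S s).2) ((vpτ t ^ 2)⁻¹ • E t ((vpτ t)⁻¹ • x)) t := by
    have h2 : HasDerivAt (fun s => (S s).1 + (vpτ s)⁻¹ • (S s).2) _ t := hS1.add ((hτd.inv hτ.ne').smul hS2)
    refine h2.congr_deriv ?_
    rw [hS0, hw, vpSc]
    simp only [smul_smul, Pi.inv_apply]
    have e2 : (vpτ t)⁻¹ * (vpτ t)⁻¹ = (vpτ t ^ 2)⁻¹ := by field_simp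
    have e3 : (-1 / vpτ t ^ 2) = -(vpτ t ^ 2)⁻¹ := by ring
    rw [e2, e3, neg_smul]; abel
  set γ : ℝ → ℝ × E3 × E3 := fun s => (s, vpτ s • (S s).1, (S s).1 + (vpτ s)⁻¹ • (S s).2) with hγ
  have hγd : HasDerivAt γ (1, v, (vpτ t ^ 2)⁻¹ • E t ((vpτ t)⁻¹ • x)) t := (hasDerivAt_id t).prodMk (hX.prodMk hV)
  have hsc : ∀ s, vpSc s (vpτ s • (S s).1) ((S s).1 + (vpτ s)⁻¹ • (S s).2) = S s := by
    intro s
    have := (vpτ_pos s).ne'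
    unfold vpSc
    rw [smul_add, smul_smul, smul_smul, inv_mul_cancel₀ this, mul_inv_cancel₀ this, one_smul, one_smul, add_sub_cancel_left]
  have hγt : γ t = (t, x, v) := by
    have e := hτ.ne'
    simp only [hγ, hS0, hw, vpSc, smul_sub, smul_smul, inv_mul_cancel₀ e, mul_inv_cancel₀ e, one_smul, add_sub_cancel]
  have hconst : ∀ s, vpFs g E (γ s) = 4 * π * g (vpSol (vpb E) t w 0) := by
    intro s
    unfold vpFs
    simp only [hγ, hsc]
    unfold vpG
    rw [hS, vpSol_comp hok]
  have hd : DifferentiableAt ℝ (vpFs g E) (γ t) := by rw [hγt]; exact hdiff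
  have h1 := hd.hasFDerivAt.comp_hasDerivAt t hγd
  have h2 : HasDerivAt (vpFs g E ∘ γ) 0 t := by
    have : vpFs g E ∘ γ = fun _ => 4 * π * g (vpSol (vpb E) t w 0) := funext hconst
    rw [this]; exact hasDerivAt_const _ _
  rw [hγt] at h1
  exact h1.unique h2


lemma vpSc_bound {C t : ℝ} {x v : E3}
    (h : ‖(vpSc t x v).1‖ ≤ C * (vpτ t) ^ ((2:ℝ)/3) ∧ ‖(vpSc t x v).2‖ ≤ C * (vpτ t) ^ ((5:ℝ)/3)) :
    ‖x‖ ≤ vpτ t * (C * (vpτ t) ^ ((2:ℝ)/3)) ∧ ‖v‖ ≤ 2 * C * (vpτ t) ^ ((2:ℝ)/3) := by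
  have hτ := vpτ_pos t
  obtain ⟨h1, h2⟩ := h
  have e0 : (vpτ t) ^ ((5:ℝ)/3) = vpτ t * (vpτ t) ^ ((2:ℝ)/3) := by
    rw [show (5:ℝ)/3 = 1 + 2/3 by norm_num, Real.rpow_add hτ, Real.rpow_one]
  rw [e0] at h2
  have ex : x = vpτ t • (vpSc t x v).1 := by
    simp only [vpSc, smul_smul, mul_inv_cancel₀ hτ.ne', one_smul]
  have ev : v = (vpSc t x v).1 + (vpτ t)⁻¹ • (vpSc t x v).2 := by
    simp only [vpSc, smul_sub, smul_smul, inv_mul_cancel₀ hτ.ne', one_smul, add_sub_cancel]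
  constructor
  · calc ‖x‖ = ‖vpτ t • (vpSc t x v).1‖ := by rw [← ex]
      _ = vpτ t * ‖(vpSc t x v).1‖ := by rw [norm_smul, Real.norm_of_nonneg hτ.le]
      _ ≤ _ := by gcongr
  · calc ‖v‖ = ‖(vpSc t x v).1 + (vpτ t)⁻¹ • (vpSc t x v).2‖ := by rw [← ev]
      _ ≤ ‖(vpSc t x v).1‖ + (vpτ t)⁻¹ * ‖(vpSc t x v).2‖ := by
          refine (norm_add_le _ _).trans ?_
          rw [norm_smul, Real.norm_of_nonneg (inv_nonneg.2 hτ.le)]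
      _ ≤ C * (vpτ t) ^ ((2:ℝ)/3) + (vpτ t)⁻¹ * (C * (vpτ t * (vpτ t) ^ ((2:ℝ)/3))) := by gcongr
      _ = _ := by field_simp; ring

theorem rein_momentum_support_bound
    (f₀ : E3 × E3 → ℝ) (hf₀_nonneg : ∀ z, 0 ≤ f₀ z)
    (hf₀_smooth : ContDiff ℝ 1 f₀) (hf₀_supp : HasCompactSupport f₀) :
    ∃ (F : ℝ × E3 × E3 → ℝ) (C : ℝ), 0 < C ∧
      IsGlobalVPSolution 1 F ∧
      (∀ x v, F (0, x, v) = f₀ (x, v)) ∧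
      (∀ t : ℝ, 0 ≤ t → vpQ F t ≤ C * (1 + t) ^ ((2 : ℝ) / 3)) := by
  have hπ := Real.pi_pos
  let L : Z3 ≃ₜ Z3 :=
    { toFun := fun z => (z.1, z.1 + z.2)
      invFun := fun z => (z.1, z.2 - z.1)
      left_inv := fun z => by simp
      right_inv := fun z => by simp
      continuous_toFun := by fun_prop
      continuous_invFun := by fun_prop }
  let g : Z3 → ℝ := fun z => (4 * π)⁻¹ * f₀ (z.1, z.1 + z.2)
  have hgs : ContDiff ℝ 1 g := by
    have h1 : ContDiff ℝ 1 fun z : Z3 => (z.1, z.1 + z.2) :=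
      contDiff_fst.prodMk (contDiff_fst.add contDiff_snd)
    exact contDiff_const.mul (hf₀_smooth.comp h1)
  have hgc : HasCompactSupport g := by
    have h1 : HasCompactSupport (f₀ ∘ L) := hf₀_supp.comp_homeomorph L
    exact h1.mul_left (f := fun _ => (4 * π)⁻¹)
  have hg0 : ∀ z, 0 ≤ g z := fun z => mul_nonneg (by positivity) (hf₀_nonneg _)
  obtain ⟨K, hK⟩ := ContDiff.lipschitzWith_of_hasCompactSupport hgc hgs (by norm_num)
  have hlip : ∀ z z', |g z - g z'| ≤ (K : ℝ) * ‖z - z'‖ := by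
    intro z z'
    have := hK.dist_le_mul z z'
    rwa [Real.dist_eq, dist_eq_norm] at this
  obtain ⟨E, dE, hE, hself, ⟨C, hC, hbd⟩, hdens⟩ := vp_limit1 hgs.continuous hgc hg0 K.2 hlip
  have hτe : ∀ t : ℝ, 0 ≤ t → vpτ t = 1 + t := fun t ht => vpτ_of_nonneg ht
  have hkey : ∀ s x v, 0 ≤ s → vpFs g E (s, x, v) ≠ 0 →
      ‖x‖ ≤ (1 + s) * (C * (1 + s) ^ ((2:ℝ)/3)) ∧ ‖v‖ ≤ 2 * C * (1 + s) ^ ((2:ℝ)/3) := by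
    intro s x v hs hne
    have h1 : g (vpG E s (vpSc s x v)) ≠ 0 := fun h => hne (by simp only [vpFs, h, mul_zero])
    have h2 := vpSc_bound (hbd s hs _ h1)
    rwa [hτe s hs] at h2
  refine ⟨vpFs g E, 2 * C, by positivity, ⟨?_, vpFs_contDiff hgs hE, ?_, ?_⟩, ?_, ?_⟩
  · intro z
    exact mul_nonneg (by positivity) (hg0 _)
  · intro t x v ht
    obtain ⟨M, R, hR, hD⟩ := hdens t ht
    rw [one_smul, vpFs_field hR hD, ← hself t ht]
    exact vpFs_pde hgs hE t ht x v
  · intro t ht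
    refine (Metric.isBounded_closedBall (x := (0 : ℝ × E3 × E3))
      (r := t + (1 + t) * (C * (1 + t) ^ ((2:ℝ)/3)) + 2 * C * (1 + t) ^ ((2:ℝ)/3))).subset ?_
    rintro ⟨s, x, v⟩ ⟨hs, hst, hne⟩
    simp only at hs hst
    obtain ⟨hx, hv⟩ := hkey s x v hs hne
    have hm : (1 + s) ^ ((2:ℝ)/3) ≤ (1 + t) ^ ((2:ℝ)/3) :=
      Real.rpow_le_rpow (by linarith) (by linarith) (by norm_num)
    have hp : 0 ≤ (1 + t) ^ ((2:ℝ)/3) := Real.rpow_nonneg (by linarith) _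
    have hx' : ‖x‖ ≤ (1 + t) * (C * (1 + t) ^ ((2:ℝ)/3)) := hx.trans (by gcongr)
    have hv' : ‖v‖ ≤ 2 * C * (1 + t) ^ ((2:ℝ)/3) := hv.trans (by gcongr)
    have a1 : 0 ≤ (1 + t) * (C * (1 + t) ^ ((2:ℝ)/3)) := by positivity
    have a2 : 0 ≤ 2 * C * (1 + t) ^ ((2:ℝ)/3) := by positivity
    rw [mem_closedBall_zero_iff, Prod.norm_def, Prod.norm_def]
    refine max_le ?_ (max_le ?_ ?_)
    · simp only [Real.norm_of_nonneg hs]; linarith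
    · simp only; linarith
    · simp only; linarith
  · intro x v
    have h0 : vpτ 0 = 1 := by rw [hτe 0 le_rfl]; norm_num
    simp only [vpFs, vpG_zero hE.ok, vpSc, h0, g, inv_one, one_smul, add_sub_cancel]
    field_simp
  · intro t ht
    have hp : 0 ≤ (1 + t) ^ ((2:ℝ)/3) := Real.rpow_nonneg (by linarith) _
    refine Real.sSup_le ?_ (by positivity)
    rintro r ⟨s, x, v, hs, hst, hne, rfl⟩
    have hm : (1 + s) ^ ((2:ℝ)/3) ≤ (1 + t) ^ ((2:ℝ)/3) :=
      Real.rpow_le_rpow (by linarith) (by linarith) (by norm_num)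
    exact (hkey s x v hs hne).2.trans (by gcongr)
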